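/- Consider the linear hyperbolic system ∂_t u + a(x,t)∂_x u + b(x,t)u = 0 on (0,1)×ℝ with the reflection boundary conditions, where a = diag(a₁,…,aₙ) and b = (b_{jk}) have bounded continuous partial derivatives up to second order on [0,1]×ℝ, a satisfies the Λ₀-condition, and (H3) holds. Let {U(t,s)}_{t≥s} be the evolution family on L²((0,1);ℝⁿ) generated by this problem. Then there exists d > 0, not depending on s ∈ ℝ, such that for all s ∈ ℝ and all t ≥ s + 3d, the operator U(t,s) is smoothing from L²((0,1);ℝⁿ) to C²([0,1];ℝⁿ): there is a bounded linear operator V from L²((0,1);ℝⁿ) to C²([0,1];ℝⁿ) whose composition with the inclusion C² ↪ L² equals U(t,s). -/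

import Mathlib

noncomputable section

open MeasureTheory Set Filter

/-- `ℝⁿ` with the Euclidean norm. -/
abbrev Vn (n : ℕ) : Type := EuclideanSpace ℝ (Fin n)

/-- The strip `[0,1] × ℝ`. -/
def strip : Set (ℝ × ℝ) := Set.Icc (0:ℝ) 1 ×ˢ (Set.univ : Set ℝ)

/-- `g` is `C^k` on the strip `[0,1] × ℝ` with the function and all its partial
derivatives up to order `k` bounded by `C` there (the `BC^k`-norm is `≤ C`). -/
def BCle (k : ℕ) (g : ℝ → ℝ → ℝ) (C : ℝ) : Prop :=
  ContDiffOn ℝ k (fun q : ℝ × ℝ => g q.1 q.2) strip ∧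
  ∀ i : ℕ, i ≤ k → ∀ q ∈ strip,
    ‖iteratedFDerivWithin ℝ i (fun q : ℝ × ℝ => g q.1 q.2) strip q‖ ≤ C

/-- The reflection boundary conditions relating the boundary values
`w0 = u(0,t)` and `w1 = u(1,t)`. -/
def BCrel (n m : ℕ) (p : Fin n → Fin n → ℝ) (w0 w1 : Vn n) : Prop :=
  ∀ j : Fin n,
    ((j : ℕ) < m →
      w0 j = ∑ k : Fin n, if m ≤ (k : ℕ) then p j k * w0 k else p j k * w1 k) ∧
    (m ≤ (j : ℕ) →
      w1 j = ∑ k : Fin n, if m ≤ (k : ℕ) then p j k * w0 k else p j k * w1 k)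

/-- Assumption (H3). -/
def H3cond (n : ℕ) (p : Fin n → Fin n → ℝ) : Prop :=
  ∀ i : Fin (n + 1) → Fin n, ∏ l : Fin n, p (i l.castSucc) (i l.succ) = 0

/-- The `Λ₀`-condition on the diagonal coefficients `a`. -/
def LamCond (n m : ℕ) (Λ₀ : ℝ) (a : ℝ → ℝ → Fin n → ℝ) : Prop :=
  ∀ x ∈ Set.Icc (0:ℝ) 1, ∀ t : ℝ,
    (∀ j : Fin n, ((j : ℕ) < m → Λ₀ ≤ a x t j) ∧ (m ≤ (j : ℕ) → a x t j ≤ -Λ₀)) ∧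
    ∀ j k : Fin n, j ≠ k → Λ₀ ≤ |a x t j - a x t k|

/-- A classical solution `u` (with partial derivatives `ux`, `ut`) of the linear
problem `∂ₜu + a ∂ₓu + b u = f` on `[0,1] × [s,∞)` with the reflection boundary
conditions and initial datum `φ` at time `s`. -/
def IsLinSol (n m : ℕ) (p : Fin n → Fin n → ℝ)
    (a : ℝ → ℝ → Fin n → ℝ) (b : ℝ → ℝ → Fin n → Fin n → ℝ)
    (f : ℝ → ℝ → Fin n → ℝ) (s : ℝ) (φ : ℝ → Vn n)
    (u ux ut : ℝ → ℝ → Vn n) : Prop :=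
  ContinuousOn (fun q : ℝ × ℝ => u q.1 q.2) (Set.Icc 0 1 ×ˢ Set.Ici s) ∧
  ContinuousOn (fun q : ℝ × ℝ => ux q.1 q.2) (Set.Icc 0 1 ×ˢ Set.Ici s) ∧
  ContinuousOn (fun q : ℝ × ℝ => ut q.1 q.2) (Set.Icc 0 1 ×ˢ Set.Ici s) ∧
  (∀ x ∈ Set.Icc (0:ℝ) 1, ∀ t ∈ Set.Ici s, ∀ j : Fin n,
    HasDerivWithinAt (fun y => u y t j) (ux x t j) (Set.Icc 0 1) x ∧
    HasDerivWithinAt (fun τ => u x τ j) (ut x t j) (Set.Ici s) t) ∧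
  (∀ x ∈ Set.Icc (0:ℝ) 1, ∀ t ∈ Set.Ici s, ∀ j : Fin n,
    ut x t j + a x t j * ux x t j + ∑ k : Fin n, b x t j k * u x t k = f x t j) ∧
  (∀ t ∈ Set.Ici s, BCrel n m p (u 0 t) (u 1 t)) ∧
  (∀ x ∈ Set.Icc (0:ℝ) 1, u x s = φ x)

/-- Lebesgue measure restricted to `(0,1)`. -/
abbrev μ01 : Measure ℝ := volume.restrict (Set.Ioo (0:ℝ) 1)

/-- The space `L²((0,1); ℝⁿ)`. -/
abbrev L2 (n : ℕ) := Lp (Vn n) 2 μ01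

/-- An evolution family of bounded linear operators. -/
def IsEvoFam {X : Type*} [NormedAddCommGroup X] [NormedSpace ℝ X]
    (U : ℝ → ℝ → X →L[ℝ] X) : Prop :=
  (∀ t : ℝ, U t t = ContinuousLinearMap.id ℝ X) ∧
  (∀ s r t : ℝ, s ≤ r → r ≤ t → ∀ x : X, U t r (U r s x) = U t s x)

/-- `U` is the evolution family on `L²((0,1);ℝⁿ)` generated by the linear
problem with coefficients `a`, `b`: it is a strongly continuous, exponentially
bounded evolution family which, on `C¹` data with compact support in `(0,1)`,
is given by the classical solutions. -/
def GeneratedBy (n m : ℕ) (p : Fin n → Fin n → ℝ)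
    (a : ℝ → ℝ → Fin n → ℝ) (b : ℝ → ℝ → Fin n → Fin n → ℝ)
    (U : ℝ → ℝ → L2 n →L[ℝ] L2 n) : Prop :=
  IsEvoFam U ∧
  (∀ φ : L2 n, ContinuousOn (fun q : ℝ × ℝ => U q.1 q.2 φ) {q : ℝ × ℝ | q.2 ≤ q.1}) ∧
  (∃ K : ℝ, 1 ≤ K ∧ ∃ ν : ℝ, ∀ s t : ℝ, s ≤ t →
    ‖U t s‖ ≤ K * Real.exp (ν * (t - s))) ∧
  ∀ s : ℝ, ∀ φ : ℝ → Vn n, ContDiff ℝ 1 φ → tsupport φ ⊆ Set.Ioo 0 1 →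
    ∀ φh : L2 n, (∀ᵐ x ∂μ01, φh x = φ x) →
    ∀ u ux ut : ℝ → ℝ → Vn n,
      IsLinSol n m p a b (fun _ _ _ => 0) s φ u ux ut →
      ∀ t : ℝ, s ≤ t → ∀ᵐ x ∂μ01, (U t s φh) x = u x t

/-- Exponential dichotomy on `ℝ` with exponent `α` and bound `M`. -/
def HasExpDichotomy {X : Type*} [NormedAddCommGroup X] [NormedSpace ℝ X]
    (U : ℝ → ℝ → X →L[ℝ] X) (α M : ℝ) : Prop :=
  ∃ P : ℝ → X →L[ℝ] X, ∃ W : ℝ → ℝ → X →L[ℝ] X,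
    (∀ t, (P t).comp (P t) = P t) ∧
    (∀ x : X, Continuous fun t => P t x) ∧
    (∀ x : X, ∃ C : ℝ, ∀ t, ‖P t x‖ ≤ C) ∧
    (∀ s t : ℝ, s ≤ t → (U t s).comp (P s) = (P t).comp (U t s)) ∧
    (∀ s t : ℝ, s ≤ t → ∀ x : X, W s t (U t s (x - P s x)) = x - P s x) ∧
    (∀ s t : ℝ, s ≤ t → ∀ x : X, U t s (W s t (x - P t x)) = x - P t x) ∧
    (∀ s t : ℝ, s ≤ t → ∀ x : X, P s (W s t (x - P t x)) = 0) ∧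
    (∀ s t : ℝ, s ≤ t → ‖(U t s).comp (P s)‖ ≤ M * Real.exp (-α * (t - s))) ∧
    (∀ s t : ℝ, s ≤ t →
      ‖(W s t).comp (ContinuousLinearMap.id ℝ X - P t)‖ ≤ M * Real.exp (-α * (t - s)))


namespace HS

/-- projection to `[0,1]` -/
def pj (x : ℝ) : ℝ := max 0 (min 1 x)

lemma pj_cont : Continuous pj := by unfold pj; fun_prop

lemma pj_mem (x : ℝ) : pj x ∈ Icc (0:ℝ) 1 := by
  unfold pj
  exact ⟨le_max_left _ _, max_le zero_le_one (min_le_left _ _)⟩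

lemma pj_eq {x : ℝ} (hx : x ∈ Icc (0:ℝ) 1) : pj x = x := by
  unfold pj
  rw [min_eq_right hx.2, max_eq_right hx.1]

/-- `vt` is the time derivative of `v`, both jointly continuous. -/
structure TD (v vt : ℝ → ℝ → ℝ) : Prop where
  cont : Continuous (fun q : ℝ × ℝ => v q.1 q.2)
  contt : Continuous (fun q : ℝ × ℝ => vt q.1 q.2)
  der : ∀ x t, HasDerivAt (v x) (vt x t) t

lemma cont2 {v : ℝ → ℝ → ℝ} (hv : Continuous (fun q : ℝ × ℝ => v q.1 q.2))
    {X : Type*} [TopologicalSpace X] {f g : X → ℝ} (hf : Continuous f) (hg : Continuous g) :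
    Continuous (fun x => v (f x) (g x)) :=
  hv.comp (hf.prodMk hg)

lemma hasDerivAt_param {G Gt : ℝ → ℝ → ℝ} (h : TD G Gt) (a b t : ℝ) :
    HasDerivAt (fun t => ∫ ξ in a..b, G ξ t) (∫ ξ in a..b, Gt ξ t) t := by
  have hK : IsCompact (uIcc a b ×ˢ Icc (t-1) (t+1)) := isCompact_uIcc.prod isCompact_Icc
  obtain ⟨C, hC⟩ := hK.exists_bound_of_continuousOn h.contt.continuousOn
  refine (intervalIntegral.hasDerivAt_integral_of_dominated_loc_of_deriv_le
    (F := fun t ξ => G ξ t) (F' := fun t ξ => Gt ξ t) (bound := fun _ => C)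
    (Icc_mem_nhds (by linarith) (by linarith) : Icc (t-1) (t+1) ∈ nhds t) ?_ ?_ ?_ ?_ ?_ ?_).2
  · filter_upwards with s
    exact (cont2 h.cont continuous_id continuous_const).aestronglyMeasurable
  · exact (cont2 h.cont continuous_id continuous_const).intervalIntegrable _ _
  · exact (cont2 h.contt continuous_id continuous_const).aestronglyMeasurable
  · filter_upwards with ξ hξ s hs
    exact hC (ξ, s) ⟨uIoc_subset_uIcc hξ, hs⟩
  · exact intervalIntegrable_const
  · filter_upwards with ξ hξ s hs
    exact h.der ξ s

lemma ftc_eq {f f' : ℝ → ℝ} (hf : Continuous f) (hf' : Continuous f')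
    (hd : ∀ ξ ∈ Ioo (0:ℝ) 1, HasDerivAt f (f' ξ) ξ) {a b : ℝ} (ha : a ∈ Icc (0:ℝ) 1)
    (hb : b ∈ Icc (0:ℝ) 1) : f b = f a + ∫ ξ in a..b, f' ξ := by
  rcases le_total a b with hab | hab
  · rw [intervalIntegral.integral_eq_sub_of_hasDerivAt_of_le hab hf.continuousOn
      (fun x hx => hd x ⟨ha.1.trans_lt hx.1, hx.2.trans_le hb.2⟩) (hf'.intervalIntegrable _ _)]
    ring
  · rw [intervalIntegral.integral_symm, intervalIntegral.integral_eq_sub_of_hasDerivAt_of_le hab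
      hf.continuousOn
      (fun x hx => hd x ⟨hb.1.trans_lt hx.1, hx.2.trans_le ha.2⟩) (hf'.intervalIntegrable _ _)]
    ring

/-- characteristic curves, parametrized by `x ∈ [0,1]` -/
def IsChar (c : ℝ → ℝ → ℝ) (S : ℝ → ℝ) : Prop :=
  Continuous S ∧ ∀ ξ ∈ Ioo (0:ℝ) 1, HasDerivAt S (c ξ (S ξ)) ξ

structure Speed (c ct : ℝ → ℝ → ℝ) (B L : ℝ) : Prop where
  td : TD c ct
  bd : ∀ x t, |c x t| ≤ B
  bdt : ∀ x t, |ct x t| ≤ L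

lemma meanval {c ct : ℝ → ℝ → ℝ} (h : TD c ct) (x s1 s2 : ℝ) :
    c x s2 - c x s1 = (s2 - s1) * ∫ r in (0:ℝ)..1, ct x (s1 + r * (s2 - s1)) := by
  have h1 : ∀ r : ℝ, HasDerivAt (fun r => c x (s1 + r * (s2 - s1)))
      (ct x (s1 + r * (s2 - s1)) * (s2 - s1)) r := by
    intro r
    have h2 : HasDerivAt (fun r => s1 + r * (s2 - s1)) (s2 - s1) r := by
      simpa using ((hasDerivAt_id r).mul_const (s2 - s1)).const_add s1
    exact (h.der x _).comp r h2
  have h3 : Continuous fun r : ℝ => ct x (s1 + r * (s2 - s1)) :=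
    cont2 h.contt continuous_const (by fun_prop)
  have h4 := intervalIntegral.integral_eq_sub_of_hasDerivAt (a := 0) (b := 1)
    (fun r _ => h1 r) ((h3.mul continuous_const).intervalIntegrable _ _)
  rw [intervalIntegral.integral_mul_const] at h4
  simp only [one_mul, zero_mul, add_zero] at h4
  rw [show s1 + (s2 - s1) = s2 by ring] at h4
  linarith

lemma char_diff {c ct : ℝ → ℝ → ℝ} (h : TD c ct) {S1 S2 : ℝ → ℝ}
    (h1 : IsChar c S1) (h2 : IsChar c S2) {a b : ℝ} (ha : a ∈ Icc (0:ℝ) 1)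
    (hb : b ∈ Icc (0:ℝ) 1) :
    S2 b - S1 b = (S2 a - S1 a) *
      Real.exp (∫ η in a..b, ∫ r in (0:ℝ)..1, ct η (S1 η + r * (S2 η - S1 η))) := by
  set q : ℝ → ℝ := fun η => ∫ r in (0:ℝ)..1, ct η (S1 η + r * (S2 η - S1 η)) with hq
  have hS1 := h1.1
  have hS2 := h2.1
  have hqc : Continuous q := by
    apply intervalIntegral.continuous_parametric_intervalIntegral_of_continuous'
    exact cont2 h.contt continuous_fst (by fun_prop)
  have hQ : ∀ ξ, HasDerivAt (fun ξ => ∫ η in a..ξ, q η) (q ξ) ξ := fun ξ =>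
    intervalIntegral.integral_hasDerivAt_right (hqc.intervalIntegrable _ _)
      (hqc.stronglyMeasurableAtFilter _ _) hqc.continuousAt
  have hQc : Continuous (fun ξ => ∫ η in a..ξ, q η) :=
    continuous_iff_continuousAt.2 fun ξ => (hQ ξ).continuousAt
  have key := ftc_eq (f := fun ξ => (S2 ξ - S1 ξ) * Real.exp (-∫ η in a..ξ, q η))
    (f' := fun _ => 0) (by fun_prop) continuous_const (fun ξ hξ => by
      have e1 := ((h2.2 ξ hξ).sub (h1.2 ξ hξ)).mul ((hQ ξ).neg.exp)
      refine e1.congr_deriv ?_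
      rw [meanval h ξ (S1 ξ) (S2 ξ)]
      simp only [Pi.sub_apply, hq]
      ring) ha hb
  simp only [intervalIntegral.integral_same, neg_zero, Real.exp_zero, mul_one,
    intervalIntegral.integral_zero, add_zero] at key
  rw [← key, mul_assoc, ← Real.exp_add]
  simp

lemma exp_int_bounds {f : ℝ → ℝ} {L : ℝ} (hL : ∀ x, |f x| ≤ L) {a b : ℝ}
    (ha : a ∈ Icc (0:ℝ) 1) (hb : b ∈ Icc (0:ℝ) 1) :
    Real.exp (-L) ≤ Real.exp (∫ η in a..b, f η) ∧ Real.exp (∫ η in a..b, f η) ≤ Real.exp L := by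
  have h0 : 0 ≤ L := (abs_nonneg _).trans (hL 0)
  have h1 : |∫ η in a..b, f η| ≤ L := by
    have := intervalIntegral.norm_integral_le_of_norm_le_const (a := a) (b := b) (f := f) (C := L)
      (fun x _ => hL x)
    rw [Real.norm_eq_abs] at this
    refine this.trans ?_
    have : |b - a| ≤ 1 := by
      rw [abs_le]; constructor <;> linarith [ha.1, ha.2, hb.1, hb.2]
    nlinarith
  rw [abs_le] at h1
  exact ⟨Real.exp_le_exp.2 h1.1, Real.exp_le_exp.2 h1.2⟩

lemma avg_bound {f : ℝ → ℝ} {L : ℝ} (hL : ∀ x, |f x| ≤ L) : |∫ r in (0:ℝ)..1, f r| ≤ L := by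
  have := intervalIntegral.norm_integral_le_of_norm_le_const (a := 0) (b := 1) (f := f) (C := L)
      (fun x _ => hL x)
  simpa using this

lemma char_dist {c ct : ℝ → ℝ → ℝ} {B L : ℝ} (h : Speed c ct B L) {S1 S2 : ℝ → ℝ}
    (h1 : IsChar c S1) (h2 : IsChar c S2) {a b : ℝ} (ha : a ∈ Icc (0:ℝ) 1)
    (hb : b ∈ Icc (0:ℝ) 1) :
    |S2 b - S1 b| ≤ Real.exp L * |S2 a - S1 a| := by
  rw [char_diff h.td h1 h2 ha hb, abs_mul, abs_of_pos (Real.exp_pos _), mul_comm]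
  gcongr
  have := (exp_int_bounds (L := L) (f := fun η => ∫ r in (0:ℝ)..1, ct η (S1 η + r * (S2 η - S1 η)))
    (fun η => avg_bound (fun r => h.bdt _ _)) ha hb).2
  simpa using this

lemma char_cont_deriv {c ct : ℝ → ℝ → ℝ} (h : TD c ct) {S : ℝ → ℝ} (hS : IsChar c S) :
    Continuous fun ξ => c ξ (S ξ) := cont2 h.cont continuous_id hS.1

lemma char_lip {c ct : ℝ → ℝ → ℝ} {B L : ℝ} (h : Speed c ct B L) {S : ℝ → ℝ}
    (hS : IsChar c S) {a b : ℝ} (ha : a ∈ Icc (0:ℝ) 1)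
    (hb : b ∈ Icc (0:ℝ) 1) : |S b - S a| ≤ B * |b - a| := by
  rw [ftc_eq hS.1 (char_cont_deriv h.td hS) hS.2 ha hb, add_sub_cancel_left]
  have := intervalIntegral.norm_integral_le_of_norm_le_const (a := a) (b := b)
    (f := fun ξ => c ξ (S ξ)) (C := B) (fun x _ => h.bd _ _)
  simpa using this

lemma char_exists {c ct : ℝ → ℝ → ℝ} {B L : ℝ} (h : Speed c ct B L) {x : ℝ}
    (hx : x ∈ Icc (0:ℝ) 1) (t : ℝ) :
    ∃ S, IsChar c S ∧ S x = t ∧ ∀ ξ, S ξ = S (pj ξ) := by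
  have hB : 0 ≤ B := (abs_nonneg _).trans (h.bd 0 0)
  have hL : 0 ≤ L := (abs_nonneg _).trans (h.bdt 0 0)
  have pl : IsPicardLindelof c (tmin := 0) (tmax := 1) ⟨x, hx⟩ t ⟨B, hB⟩ 0 ⟨B, hB⟩ ⟨L, hL⟩ := by
    refine ⟨?_, ?_, ?_, ?_⟩
    · intro ξ _
      apply LipschitzWith.lipschitzOnWith
      apply LipschitzWith.of_dist_le_mul
      intro s1 s2
      rw [Real.dist_eq, Real.dist_eq, meanval h.td ξ s2 s1, abs_mul, mul_comm]
      gcongr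
      exact avg_bound (fun r => h.bdt _ _)
    · intro s _
      exact (cont2 h.td.cont continuous_id continuous_const).continuousOn
    · intro ξ _ s _
      exact h.bd _ _
    · simp only [NNReal.coe_zero, sub_zero]
      have : max (1 - x) x ≤ 1 := max_le (by linarith [hx.1]) hx.2
      nlinarith
  obtain ⟨α, h0, h1⟩ := pl.exists_eq_forall_mem_Icc_hasDerivWithinAt₀
  have hc : ContinuousOn α (Icc 0 1) := fun ξ hξ => (h1 ξ hξ).continuousWithinAt
  refine ⟨fun ξ => α (pj ξ), ⟨?_, ?_⟩, ?_, ?_⟩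
  · exact hc.comp_continuous pj_cont pj_mem
  · intro ξ hξ
    have hξ' := Ioo_subset_Icc_self hξ
    simp only [pj_eq hξ']
    have h2 := (h1 ξ hξ').hasDerivAt (Icc_mem_nhds hξ.1 hξ.2)
    refine h2.congr_of_eventuallyEq ?_
    filter_upwards [Icc_mem_nhds hξ.1 hξ.2] with η hη
    rw [pj_eq hη]
  · simp only [pj_eq hx]
    exact h0
  · intro ξ
    simp only [pj_eq (pj_mem ξ)]

/-- flow package -/
theorem flow_exists {c ct : ℝ → ℝ → ℝ} {B L : ℝ} (h : Speed c ct B L) :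
    ∃ ω θ : ℝ → ℝ → ℝ → ℝ,
      Continuous (fun q : ℝ × ℝ × ℝ => ω q.1 q.2.1 q.2.2) ∧
      Continuous (fun q : ℝ × ℝ × ℝ => θ q.1 q.2.1 q.2.2) ∧
      (∀ x ∈ Icc (0:ℝ) 1, ∀ t, ω x x t = t) ∧
      (∀ x t, IsChar c (fun ξ => ω ξ x t)) ∧
      (∀ x ∈ Icc (0:ℝ) 1, ∀ S, IsChar c S → ∀ ξ ∈ Icc (0:ℝ) 1, ω ξ x (S x) = S ξ) ∧
      (∀ ξ x t, x ∈ Icc (0:ℝ) 1 → ξ ∈ Icc (0:ℝ) 1 → HasDerivAt (ω ξ x) (θ ξ x t) t) ∧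
      (∀ ξ x t, x ∈ Icc (0:ℝ) 1 →
        θ ξ x t = Real.exp (∫ η in x..ξ, ct η (ω η x t))) := by
  have hex : ∀ x t : ℝ, ∃ S, IsChar c S ∧ S (pj x) = t ∧ ∀ ξ, S ξ = S (pj ξ) := fun x t =>
    char_exists h (pj_mem x) t
  choose S hS hS0 hSp using hex
  have hB : 0 ≤ B := (abs_nonneg _).trans (h.bd 0 0)
  have hω : Continuous (fun q : ℝ × ℝ × ℝ => S q.2.1 q.2.2 q.1) := by
    rw [continuous_iff_continuousAt]
    rintro ⟨ξ0, x0, t0⟩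
    have hF : Continuous (fun q : ℝ × ℝ × ℝ => B * |pj q.1 - pj ξ0| +
        Real.exp L * (|q.2.2 - t0| + B * |pj x0 - pj q.2.1|)) := by
      have := pj_cont
      fun_prop
    have hF0 := hF.tendsto (ξ0, x0, t0)
    simp only [sub_self, abs_zero, mul_zero, add_zero] at hF0
    rw [ContinuousAt, tendsto_iff_dist_tendsto_zero]
    refine squeeze_zero (fun _ => dist_nonneg) (fun q => ?_) hF0
    obtain ⟨ξ, x, t⟩ := q
    simp only [Real.dist_eq]
    have e1 := char_lip h (hS x t) (pj_mem ξ0) (pj_mem ξ)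
    have e2 := char_dist h (hS x0 t0) (hS x t) (pj_mem x0) (pj_mem ξ0)
    have e3 := char_lip h (hS x t) (pj_mem x) (pj_mem x0)
    rw [hS0 x0 t0] at e2
    rw [hS0 x t] at e3
    rw [hSp x t ξ, hSp x0 t0 ξ0]
    have e4 : |S x t (pj x0) - t0| ≤ |t - t0| + B * |pj x0 - pj x| := by
      have := abs_add_le (S x t (pj x0) - t) (t - t0)
      rw [sub_add_sub_cancel] at this
      linarith
    have e5 := abs_add_le (S x t (pj ξ) - S x t (pj ξ0)) (S x t (pj ξ0) - S x0 t0 (pj ξ0))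
    rw [sub_add_sub_cancel] at e5
    have := mul_le_mul_of_nonneg_left e4 (Real.exp_pos L).le
    linarith
  have hct : Continuous (fun q : (ℝ × ℝ × ℝ) × ℝ => ct q.2 (S q.1.2.1 q.1.2.2 q.2)) := by
    refine cont2 h.td.contt continuous_snd ?_
    exact hω.comp (f := fun q : (ℝ × ℝ × ℝ) × ℝ => (q.2, q.1.2.1, q.1.2.2)) (by fun_prop)
  refine ⟨fun ξ x t => S x t ξ, fun ξ x t => Real.exp (∫ η in (pj x)..ξ, ct η (S x t η)),
    hω, ?_, ?_, ?_, ?_, ?_, ?_⟩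
  · apply Real.continuous_exp.comp
    have e1 : Continuous (fun q : ℝ × ℝ × ℝ => ∫ η in (0:ℝ)..q.1, ct η (S q.2.1 q.2.2 η)) :=
      intervalIntegral.continuous_parametric_intervalIntegral_of_continuous hct continuous_fst
    have e2 : Continuous (fun q : ℝ × ℝ × ℝ => ∫ η in (0:ℝ)..pj q.2.1, ct η (S q.2.1 q.2.2 η)) :=
      intervalIntegral.continuous_parametric_intervalIntegral_of_continuous hct
        (pj_cont.comp (by fun_prop))
    refine (e1.sub e2).congr fun q => ?_
    show (∫ η in (0:ℝ)..q.1, ct η (S q.2.1 q.2.2 η)) - _ = _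
    rw [intervalIntegral.integral_interval_sub_left]
    · exact (cont2 h.td.contt continuous_id (hS _ _).1).intervalIntegrable _ _
    · exact (cont2 h.td.contt continuous_id (hS _ _).1).intervalIntegrable _ _
  · intro x hx t
    have := hS0 x t
    rwa [pj_eq hx] at this
  · intro x t
    exact hS x t
  · intro x hx S' hS' ξ hξ
    have e2 := char_dist h hS' (hS x (S' x)) hx hξ
    have e3 := hS0 x (S' x)
    rw [pj_eq hx] at e3
    rw [e3, sub_self, abs_zero, mul_zero] at e2
    have := abs_eq_zero.1 (le_antisymm e2 (abs_nonneg _))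
    show S x (S' x) ξ = S' ξ
    linarith
  · intro ξ x t hx hξ
    simp only [pj_eq hx]
    rw [hasDerivAt_iff_tendsto_slope]
    have e0 : ∀ t', S x t' x = t' := fun t' => by
      have := hS0 x t'
      rwa [pj_eq hx] at this
    have hG : Continuous (fun t' => Real.exp (∫ η in x..ξ, ∫ r in (0:ℝ)..1,
        ct η (S x t η + r * (S x t' η - S x t η)))) := by
      apply Real.continuous_exp.comp
      apply intervalIntegral.continuous_parametric_intervalIntegral_of_continuous'
      apply intervalIntegral.continuous_parametric_intervalIntegral_of_continuous'
      refine cont2 h.td.contt (by fun_prop) ?_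
      have f1 : Continuous fun q : (ℝ × ℝ) × ℝ => S x t q.1.2 := (hS x t).1.comp (by fun_prop)
      have f2 : Continuous fun q : (ℝ × ℝ) × ℝ => S x q.1.1 q.1.2 :=
        hω.comp (f := fun q : (ℝ × ℝ) × ℝ => (q.1.2, x, q.1.1)) (by fun_prop)
      exact f1.add (continuous_snd.mul (f2.sub f1))
    have hG0 := hG.tendsto t
    simp only [sub_self, mul_zero, add_zero, intervalIntegral.integral_const, sub_zero,
      one_smul] at hG0
    refine (hG0.mono_left nhdsWithin_le_nhds).congr' ?_
    filter_upwards [self_mem_nhdsWithin] with t' ht'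
    have e1 := char_diff h.td (hS x t) (hS x t') hx hξ
    rw [e0, e0] at e1
    rw [slope_def_field, e1]
    have : t' - t ≠ 0 := sub_ne_zero.2 ht'
    field_simp
  · intro ξ x t hx
    simp only [pj_eq hx]

end HS

namespace HS

/-- `v` has derivative `g` along the characteristics of speed `c`. -/
def Along (c v g : ℝ → ℝ → ℝ) : Prop :=
  ∀ S, IsChar c S → ∀ ξ ∈ Ioo (0:ℝ) 1, HasDerivAt (fun ξ => v ξ (S ξ)) (g ξ (S ξ)) ξ

lemma TD.add {v vt w wt : ℝ → ℝ → ℝ} (hv : TD v vt) (hw : TD w wt) :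
    TD (fun x t => v x t + w x t) (fun x t => vt x t + wt x t) :=
  ⟨hv.cont.add hw.cont, hv.contt.add hw.contt, fun x t => (hv.der x t).add (hw.der x t)⟩

lemma TD.sub {v vt w wt : ℝ → ℝ → ℝ} (hv : TD v vt) (hw : TD w wt) :
    TD (fun x t => v x t - w x t) (fun x t => vt x t - wt x t) :=
  ⟨hv.cont.sub hw.cont, hv.contt.sub hw.contt, fun x t => (hv.der x t).sub (hw.der x t)⟩

lemma TD.neg {v vt : ℝ → ℝ → ℝ} (hv : TD v vt) :
    TD (fun x t => - v x t) (fun x t => - vt x t) :=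
  ⟨hv.cont.neg, hv.contt.neg, fun x t => (hv.der x t).neg⟩

lemma TD.mul {v vt w wt : ℝ → ℝ → ℝ} (hv : TD v vt) (hw : TD w wt) :
    TD (fun x t => v x t * w x t) (fun x t => vt x t * w x t + v x t * wt x t) :=
  ⟨hv.cont.mul hw.cont, (hv.contt.mul hw.cont).add (hv.cont.mul hw.contt),
    fun x t => (hv.der x t).mul (hw.der x t)⟩

lemma TD.sum {ι : Type*} {s : Finset ι} {v vt : ι → ℝ → ℝ → ℝ} (hv : ∀ i ∈ s, TD (v i) (vt i)) :
    TD (fun x t => ∑ i ∈ s, v i x t) (fun x t => ∑ i ∈ s, vt i x t) :=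
  ⟨continuous_finsetSum _ fun i hi => (hv i hi).cont,
    continuous_finsetSum _ fun i hi => (hv i hi).contt,
    fun x t => by
      have := HasDerivAt.fun_sum (u := s) (A := fun i => v i x) (A' := fun i => vt i x t) (x := t)
        (fun i hi => (hv i hi).der x t)
      exact this⟩

lemma TD.zero : TD (fun _ _ => 0) (fun _ _ => 0) :=
  ⟨continuous_const, continuous_const, fun _ t => hasDerivAt_const t 0⟩

lemma mul_zero_deriv {D K : ℝ → ℝ} {D' ξ : ℝ} (hD : HasDerivAt D D' ξ) (h0 : D ξ = 0)
    (hK : ContinuousAt K ξ) : HasDerivAt (fun η => D η * K η) (D' * K ξ) ξ := by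
  rw [hasDerivAt_iff_tendsto_slope] at hD ⊢
  refine (hD.mul (hK.tendsto.mono_left nhdsWithin_le_nhds)).congr fun η => ?_
  rw [slope_def_field, slope_def_field, h0]
  ring

lemma switch {v vt : ℝ → ℝ → ℝ} (h : TD v vt) {S1 S2 : ℝ → ℝ} (h1 : Continuous S1)
    (h2 : Continuous S2) {ξ σ1 σ2 d : ℝ} (e : S1 ξ = S2 ξ) (d1 : HasDerivAt S1 σ1 ξ)
    (d2 : HasDerivAt S2 σ2 ξ) (hd : HasDerivAt (fun η => v η (S1 η)) d ξ) :
    HasDerivAt (fun η => v η (S2 η)) (d + (σ2 - σ1) * vt ξ (S2 ξ)) ξ := by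
  have hK : Continuous (fun η => ∫ r in (0:ℝ)..1, vt η (S1 η + r * (S2 η - S1 η))) := by
    apply intervalIntegral.continuous_parametric_intervalIntegral_of_continuous'
    exact cont2 h.contt continuous_fst (by fun_prop)
  have e1 := hd.add (mul_zero_deriv (d2.sub d1) (by simp [e]) hK.continuousAt (K := fun η =>
    ∫ r in (0:ℝ)..1, vt η (S1 η + r * (S2 η - S1 η))))
  have e2 : HasDerivAt (fun η => v η (S2 η)) _ ξ := e1.congr_of_eventuallyEq
    (Eventually.of_forall fun η => by
      have := meanval h η (S1 η) (S2 η)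
      simp only [Pi.sub_apply, Pi.add_apply]
      linarith)
  refine e2.congr_deriv ?_
  simp [e]

lemma Along.curve {c ct v vt g : ℝ → ℝ → ℝ} {B L : ℝ} (hc : Speed c ct B L) (h : TD v vt)
    (ha : Along c v g) {S : ℝ → ℝ} {σ ξ : ℝ} (hS : Continuous S) (hd : HasDerivAt S σ ξ)
    (hξ : ξ ∈ Ioo (0:ℝ) 1) :
    HasDerivAt (fun η => v η (S η)) (g ξ (S ξ) + (σ - c ξ (S ξ)) * vt ξ (S ξ)) ξ := by
  obtain ⟨S1, h1, h2, -⟩ := char_exists hc (Ioo_subset_Icc_self hξ) (S ξ)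
  have := switch h h1.1 hS h2 (h1.2 ξ hξ) hd (ha S1 h1 ξ hξ)
  rwa [h2] at this

lemma Along.deriv_x {c ct v vt g : ℝ → ℝ → ℝ} {B L : ℝ} (hc : Speed c ct B L) (h : TD v vt)
    (ha : Along c v g) {ξ : ℝ} (t : ℝ) (hξ : ξ ∈ Ioo (0:ℝ) 1) :
    HasDerivAt (fun η => v η t) (g ξ t - c ξ t * vt ξ t) ξ := by
  have := ha.curve hc h (continuous_const (y := t)) (hasDerivAt_const ξ t) hξ
  exact this.congr_deriv (by ring)

lemma Along.change {c ct v vt g c' : ℝ → ℝ → ℝ} {B L : ℝ} (hc : Speed c ct B L) (h : TD v vt)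
    (ha : Along c v g) :
    Along c' v (fun x t => g x t + (c' x t - c x t) * vt x t) :=
  fun S hS ξ hξ => ha.curve hc h hS.1 (hS.2 ξ hξ) hξ

lemma Along.add {c v g w k : ℝ → ℝ → ℝ} (hv : Along c v g) (hw : Along c w k) :
    Along c (fun x t => v x t + w x t) (fun x t => g x t + k x t) :=
  fun S hS ξ hξ => (hv S hS ξ hξ).add (hw S hS ξ hξ)

lemma Along.sub {c v g w k : ℝ → ℝ → ℝ} (hv : Along c v g) (hw : Along c w k) :
    Along c (fun x t => v x t - w x t) (fun x t => g x t - k x t) :=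
  fun S hS ξ hξ => (hv S hS ξ hξ).sub (hw S hS ξ hξ)

lemma Along.mul {c v g w k : ℝ → ℝ → ℝ} (hv : Along c v g) (hw : Along c w k) :
    Along c (fun x t => v x t * w x t) (fun x t => g x t * w x t + v x t * k x t) :=
  fun S hS ξ hξ => (hv S hS ξ hξ).mul (hw S hS ξ hξ)

lemma Along.sum {ι : Type*} {s : Finset ι} {c : ℝ → ℝ → ℝ} {v g : ι → ℝ → ℝ → ℝ}
    (hv : ∀ i ∈ s, Along c (v i) (g i)) :
    Along c (fun x t => ∑ i ∈ s, v i x t) (fun x t => ∑ i ∈ s, g i x t) :=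
  fun S hS ξ hξ => by
    have := HasDerivAt.fun_sum (u := s) (A := fun i η => v i η (S η)) (A' := fun i => g i ξ (S ξ))
      (x := ξ) (fun i hi => hv i hi S hS ξ hξ)
    exact this

lemma Along.congr {c v g k : ℝ → ℝ → ℝ} (hv : Along c v g)
    (h : ∀ x ∈ Ioo (0:ℝ) 1, ∀ t, g x t = k x t) : Along c v k :=
  fun S hS ξ hξ => by rw [← h ξ hξ]; exact hv S hS ξ hξ

lemma Along.ftc {c v g : ℝ → ℝ → ℝ} (ha : Along c v g)
    (hv : Continuous (fun q : ℝ × ℝ => v q.1 q.2)) (hg : Continuous (fun q : ℝ × ℝ => g q.1 q.2))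
    {S : ℝ → ℝ} (hS : IsChar c S) {a b : ℝ} (ha' : a ∈ Icc (0:ℝ) 1) (hb : b ∈ Icc (0:ℝ) 1) :
    v b (S b) = v a (S a) + ∫ ξ in a..b, g ξ (S ξ) :=
  ftc_eq (f := fun ξ => v ξ (S ξ)) (f' := fun ξ => g ξ (S ξ)) (cont2 hv continuous_id hS.1)
    (cont2 hg continuous_id hS.1) (ha S hS) ha' hb

lemma hasDerivAt_prim {f : ℝ → ℝ} (hf : Continuous f) (a x : ℝ) :
    HasDerivAt (fun x => ∫ ξ in a..x, f ξ) (f x) x :=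
  intervalIntegral.integral_hasDerivAt_right (hf.intervalIntegrable _ _)
      (hf.stronglyMeasurableAtFilter _ _) hf.continuousAt

lemma Icc_between {a b x : ℝ} (ha : a ∈ Icc (0:ℝ) 1) (hb : b ∈ Icc (0:ℝ) 1) (hx : x ∈ uIcc a b) :
    x ∈ Icc (0:ℝ) 1 := uIcc_subset_Icc ha hb hx

lemma TD.comp_flow {g gt : ℝ → ℝ → ℝ} {ω θ : ℝ → ℝ → ℝ → ℝ} (hg : TD g gt)
    (hω : Continuous (fun q : ℝ × ℝ × ℝ => ω q.1 q.2.1 q.2.2))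
    (hθ : Continuous (fun q : ℝ × ℝ × ℝ => θ q.1 q.2.1 q.2.2))
    (hd : ∀ ξ x t, x ∈ Icc (0:ℝ) 1 → ξ ∈ Icc (0:ℝ) 1 → HasDerivAt (ω ξ x) (θ ξ x t) t)
    {x : ℝ} (hx : x ∈ Icc (0:ℝ) 1) :
    TD (fun ξ t => g ξ (ω (pj ξ) x t)) (fun ξ t => gt ξ (ω (pj ξ) x t) * θ (pj ξ) x t) := by
  have h1 : Continuous (fun q : ℝ × ℝ => ω (pj q.1) x q.2) :=
    hω.comp (f := fun q : ℝ × ℝ => (pj q.1, x, q.2)) (by have := pj_cont; fun_prop)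
  have h2 : Continuous (fun q : ℝ × ℝ => θ (pj q.1) x q.2) :=
    hθ.comp (f := fun q : ℝ × ℝ => (pj q.1, x, q.2)) (by have := pj_cont; fun_prop)
  refine ⟨cont2 hg.cont continuous_fst h1, (cont2 hg.contt continuous_fst h1).mul h2, ?_⟩
  intro ξ t
  exact (hg.der ξ _).comp t (hd (pj ξ) x t hx (pj_mem ξ))

/-- time differentiation of an equation along characteristics -/
lemma Along.dt {c ct v vt g gt : ℝ → ℝ → ℝ} {B L : ℝ} (hc : Speed c ct B L) (hv : TD v vt)
    (hg : TD g gt) (ha : Along c v g) : Along c vt (fun x t => gt x t - ct x t * vt x t) := by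
  obtain ⟨ω, θ, hω, hθ, hxx, hch, huni, hder, hθf⟩ := flow_exists hc
  intro S hS x hx
  have hx' := Ioo_subset_Icc_self hx
  have hSω : ∀ ξ ∈ Icc (0:ℝ) 1, ω ξ x (S x) = S ξ := fun ξ hξ => huni x hx' S hS ξ hξ
  set t := S x with ht
  have hctc : Continuous (fun η => ct η (ω η x t)) :=
    cont2 hc.td.contt continuous_id (hch x t).1
  have hgtc : Continuous (fun η => gt η (ω (pj η) x t) * θ (pj η) x t) :=
    (hg.comp_flow hω hθ hder hx').contt.comp (f := fun η : ℝ => (η, t)) (by fun_prop)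
  have key : ∀ ξ ∈ Icc (0:ℝ) 1, vt ξ (S ξ) = Real.exp (-∫ η in x..ξ, ct η (ω η x t)) *
      (vt x t + ∫ η in x..ξ, gt η (ω (pj η) x t) * θ (pj η) x t) := by
    intro ξ hξ
    have e1 : ∀ t', v ξ (ω ξ x t') = v x t' + ∫ η in x..ξ, g η (ω (pj η) x t') := by
      intro t'
      rw [ha.ftc hv.cont hg.cont (hch x t') hx' hξ, hxx x hx']
      congr 1
      apply intervalIntegral.integral_congr
      intro η hη
      simp only [pj_eq (Icc_between hx' hξ hη)]
    have e2 : HasDerivAt (fun t' => v ξ (ω ξ x t')) (vt ξ (ω ξ x t) * θ ξ x t) t :=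
      (hv.der ξ _).comp t (hder ξ x t hx' hξ)
    have e3 : HasDerivAt (fun t' => v x t' + ∫ η in x..ξ, g η (ω (pj η) x t'))
        (vt x t + ∫ η in x..ξ, gt η (ω (pj η) x t) * θ (pj η) x t) t :=
      (hv.der x t).add (hasDerivAt_param (hg.comp_flow hω hθ hder hx') x ξ t)
    rw [← funext e1] at e3
    have e4 := e2.unique e3
    rw [← e4, hθf ξ x t hx', hSω ξ hξ, mul_comm (vt ξ _), ← mul_assoc, ← Real.exp_add]
    simp
  have d1 : HasDerivAt (fun ξ => Real.exp (-∫ η in x..ξ, ct η (ω η x t)) *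
      (vt x t + ∫ η in x..ξ, gt η (ω (pj η) x t) * θ (pj η) x t)) _ x :=
    ((hasDerivAt_prim hctc x x).neg.exp).mul ((hasDerivAt_prim hgtc x x).const_add (vt x t))
  have d2 : HasDerivAt (fun ξ => vt ξ (S ξ)) _ x := d1.congr_of_eventuallyEq (by
    filter_upwards [Icc_mem_nhds hx.1 hx.2] with ξ hξ
    exact key ξ hξ)
  refine d2.congr_deriv ?_
  have : θ x x t = 1 := by rw [hθf x x t hx']; simp
  simp [pj_eq hx', hxx x hx', this]
  ring

/-- solution of the scalar problem -/
theorem scalar_solve {c ct g gt : ℝ → ℝ → ℝ} {B L : ℝ} (hc : Speed c ct B L) (hg : TD g gt)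
    {q qt : ℝ → ℝ} (hqt : Continuous qt) (hq : ∀ t, HasDerivAt q (qt t) t)
    {x0 : ℝ} (hx0 : x0 ∈ Icc (0:ℝ) 1) :
    ∃ v vt : ℝ → ℝ → ℝ, TD v vt ∧ Along c v g ∧
      Along c vt (fun x t => gt x t - ct x t * vt x t) ∧
      (∀ t, v x0 t = q t) ∧ (∀ t, vt x0 t = qt t) ∧ (∀ x t, v x t = v (pj x) t) ∧
      (∀ x t, vt x t = vt (pj x) t) := by
  obtain ⟨ω, θ, hω, hθ, hxx, hch, huni, hder, hθf⟩ := flow_exists hc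
  have hqc : Continuous q := continuous_iff_continuousAt.2 fun t => (hq t).continuousAt
  have hpj := pj_cont
  have hw1 : Continuous (fun r : ℝ × ℝ => ω x0 (pj r.1) r.2) :=
    hω.comp (f := fun r : ℝ × ℝ => (x0, pj r.1, r.2)) (by fun_prop)
  have ht1 : Continuous (fun r : ℝ × ℝ => θ x0 (pj r.1) r.2) :=
    hθ.comp (f := fun r : ℝ × ℝ => (x0, pj r.1, r.2)) (by fun_prop)
  have hw2 : Continuous (fun r : (ℝ × ℝ) × ℝ => ω (pj r.2) (pj r.1.1) r.1.2) :=
    hω.comp (f := fun r : (ℝ × ℝ) × ℝ => (pj r.2, pj r.1.1, r.1.2)) (by fun_prop)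
  have ht2 : Continuous (fun r : (ℝ × ℝ) × ℝ => θ (pj r.2) (pj r.1.1) r.1.2) :=
    hθ.comp (f := fun r : (ℝ × ℝ) × ℝ => (pj r.2, pj r.1.1, r.1.2)) (by fun_prop)
  have cint : ∀ k : ℝ × ℝ → ℝ → ℝ, Continuous (fun r : (ℝ × ℝ) × ℝ => k r.1 r.2) →
      Continuous (fun r : ℝ × ℝ => ∫ ξ in x0..pj r.1, k r ξ) := by
    intro k hk
    have e1 : Continuous (fun r : ℝ × ℝ => ∫ ξ in (0:ℝ)..pj r.1, k r ξ) :=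
      intervalIntegral.continuous_parametric_intervalIntegral_of_continuous hk
        (pj_cont.comp continuous_fst)
    have e2 : Continuous (fun r : ℝ × ℝ => ∫ ξ in (0:ℝ)..x0, k r ξ) :=
      intervalIntegral.continuous_parametric_intervalIntegral_of_continuous hk continuous_const
    have hkr : ∀ r, Continuous (k r) := fun r =>
      hk.comp (f := fun ξ => (r, ξ)) (by fun_prop)
    refine (e1.sub e2).congr fun r => ?_
    show (∫ ξ in (0:ℝ)..pj r.1, k r ξ) - _ = _
    rw [intervalIntegral.integral_interval_sub_left]
    · exact (hkr r).intervalIntegrable _ _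
    · exact (hkr r).intervalIntegrable _ _
  have hTD : TD (fun x t => q (ω x0 (pj x) t) + ∫ ξ in x0..pj x, g ξ (ω (pj ξ) (pj x) t))
    (fun x t => qt (ω x0 (pj x) t) * θ x0 (pj x) t +
      ∫ ξ in x0..pj x, gt ξ (ω (pj ξ) (pj x) t) * θ (pj ξ) (pj x) t) := by
    refine ⟨?_, ?_, ?_⟩
    · refine (hqc.comp hw1).add ?_
      exact cint (fun r ξ => g ξ (ω (pj ξ) (pj r.1) r.2)) (cont2 hg.cont continuous_snd hw2)
    · refine ((hqt.comp hw1).mul ht1).add ?_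
      exact cint (fun r ξ => gt ξ (ω (pj ξ) (pj r.1) r.2) * θ (pj ξ) (pj r.1) r.2)
        ((cont2 hg.contt continuous_snd hw2).mul ht2)
    · intro x t
      refine HasDerivAt.add ?_
        (hasDerivAt_param (hg.comp_flow hω hθ hder (pj_mem x)) x0 (pj x) t)
      exact (hq _).comp t (hder x0 (pj x) t (pj_mem x) hx0)
  have hAl : Along c (fun x t => q (ω x0 (pj x) t) + ∫ ξ in x0..pj x, g ξ (ω (pj ξ) (pj x) t))
      g := by
    intro S hS x hx
    have hgS : Continuous (fun ξ => g ξ (S ξ)) := cont2 hg.cont continuous_id hS.1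
    have e1 := (hasDerivAt_prim hgS x0 x).const_add (q (S x0))
    refine e1.congr_of_eventuallyEq ?_
    filter_upwards [Icc_mem_nhds hx.1 hx.2] with ξ hξ
    rw [pj_eq hξ, huni ξ hξ S hS x0 hx0]
    congr 1
    apply intervalIntegral.integral_congr
    intro η hη
    have hη' := Icc_between hx0 hξ hη
    simp only [pj_eq hη', huni ξ hξ S hS η hη']
  refine ⟨_, _, hTD, hAl, hAl.dt hc hTD hg, ?_, ?_, ?_, ?_⟩
  · intro t
    simp [pj_eq hx0, hxx x0 hx0]
  · intro t
    have : θ x0 x0 t = 1 := by rw [hθf x0 x0 t hx0]; simp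
    simp [pj_eq hx0, hxx x0 hx0, this]
  · intro x t
    simp only [pj_eq (pj_mem x)]
  · intro x t
    simp only [pj_eq (pj_mem x)]

end HS

namespace HS

lemma pi_le {f γ g : ℝ → ℝ} {G a b : ℝ} (hf : Continuous f) (hg : Continuous g) (hab : a ≤ b)
    (hd : ∀ ξ ∈ Ioo a b, HasDerivAt f (γ ξ * f ξ + g ξ) ξ)
    (hG : ∀ ξ ∈ Ioo a b, |γ ξ| ≤ G) (h1 : b - a ≤ 1) (hG0 : 0 ≤ G) :
    f b ^ 2 ≤ Real.exp (2 * G + 1) * (f a ^ 2 + ∫ ξ in a..b, g ξ ^ 2) := by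
  set k := 2 * G + 1 with hk
  have hg2 : Continuous (fun ξ => g ξ ^ 2) := hg.pow 2
  have hprim : Continuous (fun ξ => ∫ η in a..ξ, g η ^ 2) :=
    continuous_iff_continuousAt.2 fun ξ => (hasDerivAt_prim hg2 a ξ).continuousAt
  have hder : ∀ ξ ∈ Ioo a b, HasDerivAt
      (fun ξ => Real.exp (-k * (ξ - a)) * f ξ ^ 2 - ∫ η in a..ξ, g η ^ 2)
      (Real.exp (-k * (ξ - a)) * (2 * f ξ * (γ ξ * f ξ + g ξ) - k * f ξ ^ 2) - g ξ ^ 2) ξ := by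
    intro ξ hξ
    have e1 : HasDerivAt (fun ξ => -k * (ξ - a)) (-k) ξ := by
      simpa using ((hasDerivAt_id ξ).sub_const a).const_mul (-k)
    have e2 := (e1.exp.mul ((hd ξ hξ).fun_pow 2)).sub (hasDerivAt_prim hg2 a ξ)
    refine e2.congr_deriv ?_
    simp
    ring
  have hanti : AntitoneOn (fun ξ => Real.exp (-k * (ξ - a)) * f ξ ^ 2 - ∫ η in a..ξ, g η ^ 2)
      (Icc a b) := by
    apply antitoneOn_of_deriv_nonpos (convex_Icc a b)
    · apply Continuous.continuousOn
      fun_prop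
    · rw [interior_Icc]
      intro ξ hξ
      exact (hder ξ hξ).differentiableAt.differentiableWithinAt
    · rw [interior_Icc]
      intro ξ hξ
      rw [(hder ξ hξ).deriv]
      have hE : Real.exp (-k * (ξ - a)) ≤ 1 := by
        rw [Real.exp_le_one_iff]
        have := hξ.1
        nlinarith
      have hE0 := Real.exp_pos (-k * (ξ - a))
      have h2 := abs_le.1 (hG ξ hξ)
      have h3 : 2 * f ξ * (γ ξ * f ξ + g ξ) - k * f ξ ^ 2 ≤ g ξ ^ 2 := by
        nlinarith [sq_nonneg (f ξ - g ξ), sq_nonneg (f ξ)]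
      nlinarith [sq_nonneg (g ξ)]
  have h4 := hanti (left_mem_Icc.2 hab) (right_mem_Icc.2 hab) hab
  simp only [sub_self, mul_zero, Real.exp_zero, one_mul, intervalIntegral.integral_same,
    sub_zero] at h4
  have h5 : Real.exp (-k * (b - a)) * f b ^ 2 ≤ f a ^ 2 + ∫ ξ in a..b, g ξ ^ 2 := by linarith
  have h6 : Real.exp (-k) ≤ Real.exp (-k * (b - a)) := by
    apply Real.exp_le_exp.2
    nlinarith
  have h7 : f b ^ 2 = Real.exp k * (Real.exp (-k) * f b ^ 2) := by
    rw [← mul_assoc, ← Real.exp_add]; simp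
  rw [h7]
  gcongr
  exact (mul_le_mul_of_nonneg_right h6 (sq_nonneg _)).trans h5

lemma pi_ineq {f γ g : ℝ → ℝ} {G a b : ℝ} (hf : Continuous f) (hg : Continuous g)
    (hd : ∀ ξ ∈ Ioo (0:ℝ) 1, HasDerivAt f (γ ξ * f ξ + g ξ) ξ)
    (ha : a ∈ Icc (0:ℝ) 1) (hb : b ∈ Icc (0:ℝ) 1)
    (hG : ∀ ξ ∈ uIcc a b, |γ ξ| ≤ G) (hG0 : 0 ≤ G) :
    f b ^ 2 ≤ Real.exp (2 * G + 1) * (f a ^ 2 + |∫ ξ in a..b, g ξ ^ 2|) := by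
  rcases le_total a b with hab | hab
  · refine (pi_le hf hg hab (fun ξ hξ => hd ξ ⟨ha.1.trans_lt hξ.1, hξ.2.trans_le hb.2⟩)
      (fun ξ hξ => hG ξ ?_) (by linarith [ha.1, hb.2]) hG0).trans ?_
    · rw [uIcc_of_le hab]; exact Ioo_subset_Icc_self hξ
    · gcongr
      exact le_abs_self _
  · have h1 := pi_le (f := fun ξ => f (-ξ)) (γ := fun ξ => - γ (-ξ)) (g := fun ξ => - g (-ξ))
      (G := G) (a := -a) (b := -b) (by fun_prop) (by fun_prop) (by linarith) (fun ξ hξ => ?_)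
      (fun ξ hξ => ?_) (by linarith [hb.1, ha.2]) hG0
    · simp only [neg_neg] at h1
      refine h1.trans ?_
      gcongr
      refine le_trans (le_of_eq ?_) (neg_le_abs _)
      have : ∫ ξ in (-a)..(-b), (- g (-ξ)) ^ 2 = ∫ ξ in (-a)..(-b), (fun η => g η ^ 2) (-ξ) := by
        simp
      rw [this, intervalIntegral.integral_comp_neg (fun η => g η ^ 2), neg_neg, neg_neg,
        intervalIntegral.integral_symm]
    · have e1 := (hd (-ξ) ⟨by linarith [hξ.2, hb.1], by linarith [hξ.1, ha.2]⟩).comp ξ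
        (hasDerivAt_neg ξ)
      refine e1.congr_deriv ?_
      ring
    · rw [abs_neg]
      apply hG
      rw [uIcc_of_ge hab]
      exact ⟨by linarith [hξ.2], by linarith [hξ.1]⟩

lemma Along.pi {c v γ g : ℝ → ℝ → ℝ} (ha : Along c v (fun x t => γ x t * v x t + g x t))
    (hv : Continuous (fun q : ℝ × ℝ => v q.1 q.2)) (hg : Continuous (fun q : ℝ × ℝ => g q.1 q.2))
    {S : ℝ → ℝ} (hS : IsChar c S) {a b G : ℝ} (ha' : a ∈ Icc (0:ℝ) 1) (hb : b ∈ Icc (0:ℝ) 1)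
    (hG : ∀ ξ ∈ uIcc a b, |γ ξ (S ξ)| ≤ G) (hG0 : 0 ≤ G) :
    v b (S b) ^ 2 ≤ Real.exp (2 * G + 1) * (v a (S a) ^ 2 + |∫ ξ in a..b, g ξ (S ξ) ^ 2|) :=
  pi_ineq (f := fun ξ => v ξ (S ξ)) (γ := fun ξ => γ ξ (S ξ)) (g := fun ξ => g ξ (S ξ))
    (cont2 hv continuous_id hS.1)
    (cont2 hg continuous_id hS.1) (fun ξ hξ => ha S hS ξ hξ) ha' hb hG hG0

/-- direction of propagation -/
def Dir (c : ℝ → ℝ → ℝ) (xin κ : ℝ) : Prop :=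
  (xin = 0 ∧ ∀ x t, κ ≤ c x t) ∨ (xin = 1 ∧ ∀ x t, c x t ≤ -κ)

lemma Dir.mem {c : ℝ → ℝ → ℝ} {xin κ : ℝ} (h : Dir c xin κ) : xin ∈ Icc (0:ℝ) 1 := by
  rcases h with h | h <;> rw [h.1] <;> simp

lemma Dir.mono {c ct : ℝ → ℝ → ℝ} {xin κ : ℝ} (h : Dir c xin κ) (hc : TD c ct) {S : ℝ → ℝ}
    (hS : IsChar c S) {x ξ : ℝ} (hx : x ∈ Icc (0:ℝ) 1) (hξ : ξ ∈ uIcc xin x) :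
    S ξ ≤ S x - κ * |x - ξ| := by
  have hξ' := Icc_between h.mem hx hξ
  have e := ftc_eq hS.1 (char_cont_deriv hc hS) hS.2 hξ' hx
  rcases h with ⟨h0, h1⟩ | ⟨h0, h1⟩
  · rw [h0, uIcc_of_le hx.1] at hξ
    rw [e, abs_of_nonneg (by linarith [hξ.2])]
    have := intervalIntegral.integral_mono_on hξ.2 (intervalIntegrable_const (c := κ) (μ := volume))
      ((char_cont_deriv hc hS).intervalIntegrable _ _) (fun y _ => h1 y _)
    rw [intervalIntegral.integral_const, smul_eq_mul] at this
    linarith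
  · rw [h0, uIcc_of_ge hx.2] at hξ
    rw [e, intervalIntegral.integral_symm, abs_of_nonpos (by linarith [hξ.1])]
    have := intervalIntegral.integral_mono_on hξ.1
      ((char_cont_deriv hc hS).intervalIntegrable _ _) (intervalIntegrable_const (c := -κ) (μ := volume))
      (fun y _ => h1 y _)
    rw [intervalIntegral.integral_const, smul_eq_mul] at this
    linarith

lemma int_exp_bound {f : ℝ → ℝ} (hf : Continuous f) {M μ a x : ℝ} (hμ : 0 < μ) (hM : 0 ≤ M)
    (h : ∀ ξ ∈ uIcc a x, f ξ ≤ M * Real.exp (-μ * |x - ξ|)) (h0 : ∀ ξ, 0 ≤ f ξ) :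
    |∫ ξ in a..x, f ξ| ≤ M / μ := by
  rcases le_total a x with hax | hax
  · rw [abs_of_nonneg (intervalIntegral.integral_nonneg hax fun ξ _ => h0 ξ)]
    rw [uIcc_of_le hax] at h
    have hd : ∀ ξ ∈ uIcc a x, HasDerivAt (fun ξ => M / μ * Real.exp (-μ * (x - ξ)))
        (M * Real.exp (-μ * (x - ξ))) ξ := by
      intro ξ _
      have e1 : HasDerivAt (fun ξ => -μ * (x - ξ)) μ ξ := by
        simpa using ((hasDerivAt_id ξ).const_sub x).const_mul (-μ)
      refine (e1.exp.const_mul (M / μ)).congr_deriv ?_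
      field_simp
    have e2 := intervalIntegral.integral_eq_sub_of_hasDerivAt hd
      ((by fun_prop : Continuous fun ξ => M * Real.exp (-μ * (x - ξ))).intervalIntegrable _ _)
    have e3 : ∫ ξ in a..x, f ξ ≤ ∫ ξ in a..x, M * Real.exp (-μ * (x - ξ)) := by
      apply intervalIntegral.integral_mono_on hax (hf.intervalIntegrable _ _)
      · exact (by fun_prop : Continuous fun ξ => M * Real.exp (-μ * (x - ξ))).intervalIntegrable _ _
      · intro ξ hξ
        have := h ξ hξ
        rwa [abs_of_nonneg (by linarith [hξ.2])] at this
    rw [e2] at e3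
    have : 0 ≤ M / μ * Real.exp (-μ * (x - a)) := by positivity
    simp only [sub_self, mul_zero, Real.exp_zero, mul_one] at e3
    linarith
  · rw [intervalIntegral.integral_symm, abs_neg,
      abs_of_nonneg (intervalIntegral.integral_nonneg hax fun ξ _ => h0 ξ)]
    rw [uIcc_of_ge hax] at h
    have hd : ∀ ξ ∈ uIcc x a, HasDerivAt (fun ξ => -(M / μ) * Real.exp (-μ * (ξ - x)))
        (M * Real.exp (-μ * (ξ - x))) ξ := by
      intro ξ _
      have e1 : HasDerivAt (fun ξ => -μ * (ξ - x)) (-μ) ξ := by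
        simpa using ((hasDerivAt_id ξ).sub_const x).const_mul (-μ)
      refine (e1.exp.const_mul (-(M / μ))).congr_deriv ?_
      field_simp
    have e2 := intervalIntegral.integral_eq_sub_of_hasDerivAt hd
      ((by fun_prop : Continuous fun ξ => M * Real.exp (-μ * (ξ - x))).intervalIntegrable _ _)
    have e3 : ∫ ξ in x..a, f ξ ≤ ∫ ξ in x..a, M * Real.exp (-μ * (ξ - x)) := by
      apply intervalIntegral.integral_mono_on hax (hf.intervalIntegrable _ _)
      · exact (by fun_prop : Continuous fun ξ => M * Real.exp (-μ * (ξ - x))).intervalIntegrable _ _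
      · intro ξ hξ
        have := h ξ hξ
        rw [abs_of_nonpos (by linarith [hξ.1])] at this
        rwa [neg_sub] at this
    rw [e2] at e3
    have : 0 ≤ M / μ * Real.exp (-μ * (a - x)) := by positivity
    simp only [sub_self, mul_zero, Real.exp_zero, mul_one] at e3
    linarith

lemma sq_exp_le {y M l t : ℝ} (h : |y| ≤ M * Real.exp (l * t)) :
    y ^ 2 ≤ M ^ 2 * Real.exp (2 * l * t) := by
  have h1 : y ^ 2 ≤ (M * Real.exp (l * t)) ^ 2 := by
    rw [← sq_abs]
    exact pow_le_pow_left₀ (abs_nonneg _) h 2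
  rw [mul_pow, ← Real.exp_nat_mul] at h1
  convert h1 using 3
  push_cast
  ring

/-- exponential weighted estimate -/
lemma ml_exp {c ct v γ g : ℝ → ℝ → ℝ} {B L xin κ : ℝ} (hc : Speed c ct B L) (hdir : Dir c xin κ)
    (hκ : 0 < κ)
    (ha : Along c v (fun x t => γ x t * v x t + g x t))
    (hv : Continuous (fun q : ℝ × ℝ => v q.1 q.2)) (hg : Continuous (fun q : ℝ × ℝ => g q.1 q.2))
    {G : ℝ} (hG : ∀ ξ ∈ Icc (0:ℝ) 1, ∀ τ, |γ ξ τ| ≤ G) {Mq Mg l x t : ℝ} (hl : 0 < l)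
    (hx : x ∈ Icc (0:ℝ) 1)
    (h1 : ∀ τ ≤ t, |v xin τ| ≤ Mq * Real.exp (l * τ))
    (h2 : ∀ ξ ∈ Icc (0:ℝ) 1, ∀ τ ≤ t, |g ξ τ| ≤ Mg * Real.exp (l * τ)) :
    v x t ^ 2 ≤ Real.exp (2 * G + 1) * (Mq ^ 2 * Real.exp (-(2 * l * κ) * |x - xin|) +
      Mg ^ 2 / (2 * l * κ)) * Real.exp (2 * l * t) := by
  obtain ⟨S, hS, hSx, -⟩ := char_exists hc hx t
  have hG0 : 0 ≤ G := (abs_nonneg _).trans (hG 0 (by simp) 0)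
  have e1 := ha.pi hv hg hS hdir.mem hx (G := G)
    (fun ξ hξ => hG ξ (Icc_between hdir.mem hx hξ) _) hG0
  have hmono : ∀ ξ ∈ uIcc xin x, S ξ ≤ t - κ * |x - ξ| := fun ξ hξ => by
    have := hdir.mono hc.td hS hx hξ
    rwa [hSx] at this
  have hle : ∀ ξ ∈ uIcc xin x, S ξ ≤ t := fun ξ hξ => by
    have := hmono ξ hξ
    have : 0 ≤ κ * |x - ξ| := by positivity
    linarith
  have hexp : ∀ ξ ∈ uIcc xin x, Real.exp (2 * l * S ξ) ≤
      Real.exp (2 * l * t) * Real.exp (-(2 * l * κ) * |x - ξ|) := by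
    intro ξ hξ
    rw [← Real.exp_add]
    apply Real.exp_le_exp.2
    have := mul_le_mul_of_nonneg_left (hmono ξ hξ) (by positivity : 0 ≤ 2 * l)
    linarith
  rw [hSx] at e1
  have e2 : v xin (S xin) ^ 2 ≤ Mq ^ 2 * (Real.exp (2 * l * t) *
      Real.exp (-(2 * l * κ) * |x - xin|)) := by
    refine (sq_exp_le (h1 _ (hle xin left_mem_uIcc))).trans ?_
    gcongr
    exact hexp xin left_mem_uIcc
  have e3 : |∫ ξ in xin..x, g ξ (S ξ) ^ 2| ≤ Mg ^ 2 * Real.exp (2 * l * t) / (2 * l * κ) := by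
    apply int_exp_bound ((cont2 hg continuous_id hS.1).pow 2) (by positivity) (by positivity)
    · intro ξ hξ
      refine (sq_exp_le (h2 ξ (Icc_between hdir.mem hx hξ) _ (hle ξ hξ))).trans ?_
      exact (mul_le_mul_of_nonneg_left (hexp ξ hξ) (sq_nonneg Mg)).trans (le_of_eq (by ring))
    · intro ξ; exact sq_nonneg _
  refine e1.trans ?_
  rw [mul_assoc]
  gcongr
  calc _ ≤ _ := add_le_add e2 e3
    _ = _ := by ring

lemma ml_zero {c ct v γ g : ℝ → ℝ → ℝ} {B L xin κ : ℝ} (hc : Speed c ct B L) (hdir : Dir c xin κ)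
    (ha : Along c v (fun x t => γ x t * v x t + g x t))
    (hv : Continuous (fun q : ℝ × ℝ => v q.1 q.2)) (hg : Continuous (fun q : ℝ × ℝ => g q.1 q.2))
    {G : ℝ} (hG : ∀ ξ ∈ Icc (0:ℝ) 1, ∀ τ, |γ ξ τ| ≤ G) {x t : ℝ}
    (hx : x ∈ Icc (0:ℝ) 1)
    (h1 : ∀ τ ≤ t - κ * |x - xin|, v xin τ = 0)
    (h2 : ∀ ξ ∈ Icc (0:ℝ) 1, ∀ τ ≤ t - κ * |x - ξ|, g ξ τ = 0) :
    v x t = 0 := by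
  obtain ⟨S, hS, hSx, -⟩ := char_exists hc hx t
  have hG0 : 0 ≤ G := (abs_nonneg _).trans (hG 0 (by simp) 0)
  have e1 := ha.pi hv hg hS hdir.mem hx (G := G)
    (fun ξ hξ => hG ξ (Icc_between hdir.mem hx hξ) _) hG0
  have hmono : ∀ ξ ∈ uIcc xin x, S ξ ≤ t - κ * |x - ξ| := fun ξ hξ => by
    have := hdir.mono hc.td hS hx hξ
    rwa [hSx] at this
  rw [hSx, h1 _ (hmono xin left_mem_uIcc)] at e1
  have e2 : ∫ ξ in xin..x, g ξ (S ξ) ^ 2 = 0 := by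
    rw [← intervalIntegral.integral_zero (a := xin) (b := x) (μ := volume)]
    apply intervalIntegral.integral_congr
    intro ξ hξ
    simp [h2 ξ (Icc_between hdir.mem hx hξ) _ (hmono ξ hξ)]
  rw [e2] at e1
  simp at e1
  have := sq_nonneg (v x t)
  nlinarith

lemma ml_sup {c ct v γ g : ℝ → ℝ → ℝ} {B L : ℝ} (hc : Speed c ct B L)
    (ha : Along c v (fun x t => γ x t * v x t + g x t))
    (hv : Continuous (fun q : ℝ × ℝ => v q.1 q.2)) (hg : Continuous (fun q : ℝ × ℝ => g q.1 q.2))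
    {G α β M x0 : ℝ} (hG0 : 0 ≤ G) (hG : ∀ ξ ∈ Icc (0:ℝ) 1, ∀ τ ∈ Icc α β, |γ ξ τ| ≤ G)
    (hx0 : x0 ∈ Icc (0:ℝ) 1)
    (h1 : ∀ τ ∈ Icc α β, v x0 τ ^ 2 ≤ M)
    (h2 : ∀ ξ ∈ Icc (0:ℝ) 1, ∀ τ ∈ Icc α β, g ξ τ ^ 2 ≤ M) :
    ∀ x ∈ Icc (0:ℝ) 1, ∀ t ∈ Icc (α + B) (β - B),
    v x t ^ 2 ≤ Real.exp (2 * G + 1) * 2 * M := by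
  intro x hx t ht
  obtain ⟨S, hS, hSx, -⟩ := char_exists hc hx t
  have hB : 0 ≤ B := (abs_nonneg _).trans (hc.bd 0 0)
  have hSI : ∀ ξ ∈ Icc (0:ℝ) 1, S ξ ∈ Icc α β := by
    intro ξ hξ
    have e := char_lip hc hS hx hξ
    rw [hSx] at e
    have : |ξ - x| ≤ 1 := by rw [abs_le]; constructor <;> linarith [hξ.1, hξ.2, hx.1, hx.2]
    have e2 : |S ξ - t| ≤ B := e.trans (by nlinarith)
    have := abs_le.1 e2
    exact ⟨by linarith [ht.1], by linarith [ht.2]⟩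
  have hM : 0 ≤ M := (sq_nonneg _).trans (h1 _ (hSI x0 hx0))
  have e1 := ha.pi hv hg hS hx0 hx (G := G)
    (fun ξ hξ => hG ξ (Icc_between hx0 hx hξ) _ (hSI ξ (Icc_between hx0 hx hξ))) hG0
  rw [hSx] at e1
  refine e1.trans ?_
  rw [mul_assoc]
  gcongr
  rw [two_mul]
  refine add_le_add (h1 _ (hSI x0 hx0)) ?_
  have e3 := intervalIntegral.norm_integral_le_of_norm_le_const (a := x0) (b := x)
    (f := fun ξ => g ξ (S ξ) ^ 2) (C := M) (fun ξ hξ => by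
      have hξ' := Icc_between hx0 hx (uIoc_subset_uIcc hξ)
      rw [Real.norm_eq_abs, abs_of_nonneg (sq_nonneg _)]
      exact h2 ξ hξ' _ (hSI ξ hξ'))
  rw [Real.norm_eq_abs] at e3
  have : |x - x0| ≤ 1 := by rw [abs_le]; constructor <;> linarith [hx0.1, hx0.2, hx.1, hx.2]
  exact e3.trans (by nlinarith)

lemma int_abs_le {f : ℝ → ℝ} (hf : Continuous f) (h0 : ∀ ξ, 0 ≤ f ξ) {a b : ℝ}
    (ha : a ∈ Icc (0:ℝ) 1) (hb : b ∈ Icc (0:ℝ) 1) :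
    |∫ ξ in a..b, f ξ| ≤ ∫ ξ in (0:ℝ)..1, f ξ := by
  rcases le_total a b with h | h
  · rw [abs_of_nonneg (intervalIntegral.integral_nonneg h fun ξ _ => h0 ξ)]
    exact intervalIntegral.integral_mono_interval ha.1 h hb.2
      (Eventually.of_forall h0) (hf.intervalIntegrable _ _)
  · rw [intervalIntegral.integral_symm, abs_neg,
      abs_of_nonneg (intervalIntegral.integral_nonneg h fun ξ _ => h0 ξ)]
    exact intervalIntegral.integral_mono_interval hb.1 h ha.2
      (Eventually.of_forall h0) (hf.intervalIntegrable _ _)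

lemma ml_L2 {c ct v γ g : ℝ → ℝ → ℝ} {B L : ℝ} (hc : Speed c ct B L)
    (ha : Along c v (fun x t => γ x t * v x t + g x t))
    (hv : Continuous (fun q : ℝ × ℝ => v q.1 q.2)) (hg : Continuous (fun q : ℝ × ℝ => g q.1 q.2))
    {G α β x0 : ℝ} (hG0 : 0 ≤ G) (hG : ∀ ξ ∈ Icc (0:ℝ) 1, ∀ τ ∈ Icc α β, |γ ξ τ| ≤ G)
    (hx0 : x0 ∈ Icc (0:ℝ) 1) (hab : α + B ≤ β - B) :
    ∀ x ∈ Icc (0:ℝ) 1,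
    ∫ t in (α + B)..(β - B), v x t ^ 2 ≤ Real.exp (2 * G + 1) * Real.exp L *
      ((∫ t in α..β, v x0 t ^ 2) + ∫ ξ in (0:ℝ)..1, ∫ t in α..β, g ξ t ^ 2) := by
  intro x hx
  obtain ⟨ω, θ, hω, hθ, hxx, hch, huni, hder, hθf⟩ := flow_exists hc
  have hB : 0 ≤ B := (abs_nonneg _).trans (hc.bd 0 0)
  have hSI : ∀ t ∈ Icc (α + B) (β - B), ∀ ξ ∈ Icc (0:ℝ) 1, ω ξ x t ∈ Icc α β := by
    intro t ht ξ hξ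
    have e := char_lip hc (hch x t) hx hξ
    simp only [hxx x hx] at e
    have : |ξ - x| ≤ 1 := by rw [abs_le]; constructor <;> linarith [hξ.1, hξ.2, hx.1, hx.2]
    have e2 : |ω ξ x t - t| ≤ B := e.trans (by nlinarith)
    have := abs_le.1 e2
    exact ⟨by linarith [ht.1], by linarith [ht.2]⟩
  have hωt : ∀ ξ, Continuous (ω ξ x) := fun ξ =>
    hω.comp (f := fun t => (ξ, x, t)) (by fun_prop)
  have hθt : ∀ ξ, Continuous (θ ξ x) := fun ξ =>
    hθ.comp (f := fun t => (ξ, x, t)) (by fun_prop)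
  have CV : ∀ f : ℝ → ℝ, Continuous f → (∀ t, 0 ≤ f t) → ∀ ξ ∈ Icc (0:ℝ) 1,
      ∫ t in (α + B)..(β - B), f (ω ξ x t) ≤ Real.exp L * ∫ t in α..β, f t := by
    intro f hf hf0 ξ hξ
    have e1 := intervalIntegral.integral_comp_mul_deriv (a := α + B) (b := β - B)
      (f := ω ξ x) (f' := θ ξ x) (g := f) (fun t _ => hder ξ x t hx hξ) (hθt ξ).continuousOn hf
    have e2 : ∫ t in (α + B)..(β - B), f (ω ξ x t) ≤
        ∫ t in (α + B)..(β - B), Real.exp L * ((f ∘ ω ξ x) t * θ ξ x t) := by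
      apply intervalIntegral.integral_mono_on hab
      · exact (hf.comp (hωt ξ)).intervalIntegrable _ _
      · exact (continuous_const.mul ((hf.comp (hωt ξ)).mul (hθt ξ))).intervalIntegrable _ _
      · intro t _
        have e3 : Real.exp (-L) ≤ θ ξ x t := by
          rw [hθf ξ x t hx]
          exact (exp_int_bounds (f := fun η => ct η (ω η x t)) (fun η => hc.bdt _ _) hx hξ).1
        have e4 : 1 ≤ Real.exp L * θ ξ x t := by
          calc (1:ℝ) = Real.exp L * Real.exp (-L) := by rw [← Real.exp_add]; simp
            _ ≤ _ := by gcongr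
        have := hf0 (ω ξ x t)
        simp only [Function.comp]
        nlinarith
    rw [intervalIntegral.integral_const_mul, e1] at e2
    refine e2.trans ?_
    gcongr
    refine intervalIntegral.integral_mono_interval (hSI _ (left_mem_Icc.2 hab) ξ hξ).1 ?_
      (hSI _ (right_mem_Icc.2 hab) ξ hξ).2 (Eventually.of_forall hf0) (hf.intervalIntegrable _ _)
    have hmo : Monotone (ω ξ x) := by
      apply monotone_of_deriv_nonneg
      · exact fun t => (hder ξ x t hx hξ).differentiableAt
      · intro t
        rw [(hder ξ x t hx hξ).deriv, hθf ξ x t hx]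
        exact (Real.exp_pos _).le
    exact hmo hab
  have cg : Continuous (fun q : ℝ × ℝ => g q.2 (ω q.2 x q.1) ^ 2) := by
    refine (cont2 hg continuous_snd ?_).pow 2
    exact hω.comp (f := fun q : ℝ × ℝ => (q.2, x, q.1)) (by fun_prop)
  have cI : Continuous (fun t => ∫ ξ in (0:ℝ)..1, g ξ (ω ξ x t) ^ 2) :=
    intervalIntegral.continuous_parametric_intervalIntegral_of_continuous' cg 0 1
  have cv : Continuous (fun t => v x0 (ω x0 x t) ^ 2) :=
    (cont2 hv continuous_const (hωt x0)).pow 2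
  have st1 : ∫ t in (α + B)..(β - B), v x t ^ 2 ≤ ∫ t in (α + B)..(β - B),
      Real.exp (2 * G + 1) * (v x0 (ω x0 x t) ^ 2 + ∫ ξ in (0:ℝ)..1, g ξ (ω ξ x t) ^ 2) := by
    apply intervalIntegral.integral_mono_on hab
    · exact ((cont2 hv continuous_const continuous_id).pow 2).intervalIntegrable _ _
    · exact (continuous_const.mul (cv.add cI)).intervalIntegrable _ _
    · intro t ht
      have e1 := ha.pi hv hg (hch x t) hx0 hx (G := G) (fun ξ hξ =>
        hG ξ (Icc_between hx0 hx hξ) _ (hSI t ht ξ (Icc_between hx0 hx hξ))) hG0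
      rw [hxx x hx] at e1
      refine e1.trans ?_
      gcongr
      exact int_abs_le ((cont2 hg continuous_id (hch x t).1).pow 2) (fun ξ => sq_nonneg _) hx0 hx
  refine st1.trans ?_
  rw [intervalIntegral.integral_const_mul, mul_assoc, intervalIntegral.integral_add
    (cv.intervalIntegrable _ _) (cI.intervalIntegrable _ _)]
  gcongr
  rw [mul_add]
  refine add_le_add ?_ ?_
  · exact CV (fun t => v x0 t ^ 2) ((cont2 hv continuous_const continuous_id).pow 2)
      (fun t => sq_nonneg _) x0 hx0
  · rw [intervalIntegral_intervalIntegral_swap, ← intervalIntegral.integral_const_mul]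
    · apply intervalIntegral.integral_mono_on zero_le_one
      · apply Continuous.intervalIntegrable
        apply intervalIntegral.continuous_parametric_intervalIntegral_of_continuous'
        exact cg.comp (f := fun q : ℝ × ℝ => (q.2, q.1)) (by fun_prop)
      · apply Continuous.intervalIntegrable
        refine continuous_const.mul ?_
        apply intervalIntegral.continuous_parametric_intervalIntegral_of_continuous'
        exact hg.pow 2
      · intro ξ hξ
        exact CV (fun t => g ξ t ^ 2) ((cont2 hg continuous_const continuous_id).pow 2)
          (fun t => sq_nonneg _) ξ hξ
    · have : IntegrableOn (Function.uncurry fun t ξ => g ξ (ω ξ x t) ^ 2)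
          (uIcc (α + B) (β - B) ×ˢ uIcc (0:ℝ) 1) volume :=
        cg.continuousOn.integrableOn_compact (isCompact_uIcc.prod isCompact_uIcc)
      exact this.mono_set (prod_mono uIoc_subset_uIcc uIoc_subset_uIcc)

end HS

namespace HS

structure SysH {n : ℕ} (c ct : Fin n → ℝ → ℝ → ℝ) (xin xout : Fin n → ℝ)
    (κ B L : ℝ) : Prop where
  spd : ∀ j, Speed (c j) (ct j) B L
  dir : ∀ j, Dir (c j) (xin j) κ
  pos : 0 < κ
  xo : ∀ j, xout j = 1 - xin j
  Lnn : 0 ≤ L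

lemma params_exist (K κ P E : ℝ) (hK : 0 < K) (hκ : 0 < κ) :
    ∃ R : ℝ, 0 ≤ R ∧ ∃ l0 : ℝ, 0 < l0 ∧ ∀ l, l0 ≤ l → R ≤ l * κ ∧
      K * P ^ 2 * Real.exp (-2 * R) ≤ 1 / 8 ∧ K * E ^ 2 * Real.exp (2 * R) / (2 * l * κ) ≤ 1 / 8 := by
  refine ⟨4 * (K * P ^ 2), by positivity, ?_⟩
  set R := 4 * (K * P ^ 2) with hR
  have hR0 : 0 ≤ R := by positivity
  refine ⟨R / κ + 4 * K * E ^ 2 * Real.exp (2 * R) / κ + 1, by positivity, fun l hl => ?_⟩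
  have hl' : R + 4 * K * E ^ 2 * Real.exp (2 * R) ≤ l * κ := by
    have h1 : R / κ + 4 * K * E ^ 2 * Real.exp (2 * R) / κ ≤ l := by linarith
    rw [← add_div, div_le_iff₀ hκ] at h1
    exact h1
  have hl0 : 0 < l := lt_of_lt_of_le (by positivity) hl
  refine ⟨?_, ?_, ?_⟩
  · have : 0 ≤ 4 * K * E ^ 2 * Real.exp (2 * R) := by positivity
    linarith
  · have h1 := Real.add_one_le_exp (2 * R)
    rw [show -2 * R = -(2 * R) by ring, Real.exp_neg, ← div_eq_mul_inv,
      div_le_iff₀ (Real.exp_pos _)]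
    linarith
  · rw [div_le_iff₀ (by positivity)]
    linarith

lemma contr_step {c ct v γ g : ℝ → ℝ → ℝ} {B L xin κ : ℝ} (hc : Speed c ct B L)
    (hdir : Dir c xin κ) (hκ : 0 < κ)
    (ha : Along c v (fun x t => γ x t * v x t + g x t))
    (hv : Continuous (fun q : ℝ × ℝ => v q.1 q.2)) (hg : Continuous (fun q : ℝ × ℝ => g q.1 q.2))
    {G : ℝ} (hG : ∀ ξ ∈ Icc (0:ℝ) 1, ∀ τ, |γ ξ τ| ≤ G) {l R P E M : ℝ} (hl : 0 < l) (hM : 0 ≤ M)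
    (p1 : R ≤ l * κ) (p2 : Real.exp (2 * G + 1) * P ^ 2 * Real.exp (-2 * R) ≤ 1 / 8)
    (p3 : Real.exp (2 * G + 1) * E ^ 2 * Real.exp (2 * R) / (2 * l * κ) ≤ 1 / 8) (hR : 0 ≤ R)
    (h1 : ∀ τ, |v xin τ| ≤ (P * M * Real.exp (-R)) * Real.exp (l * τ))
    (h2 : ∀ ξ ∈ Icc (0:ℝ) 1, ∀ τ, |g ξ τ| ≤ (E * M) * Real.exp (l * τ)) :
    ∀ x ∈ Icc (0:ℝ) 1, ∀ t, |v x t| ≤ (M / 2) * Real.exp (l * t - R * |x - xin|) := by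
  intro x hx t
  have e1 := ml_exp hc hdir hκ ha hv hg hG hl hx (fun τ _ => h1 τ) (fun ξ hξ τ _ => h2 ξ hξ τ)
    (t := t)
  set K := Real.exp (2 * G + 1)
  set D := |x - xin| with hD
  have hD0 : 0 ≤ D := abs_nonneg _
  have hD1 : D ≤ 1 := by
    have := hdir.mem
    rw [hD, abs_le]; constructor <;> linarith [this.1, this.2, hx.1, hx.2]
  have hK : 0 < K := Real.exp_pos _
  have hX : Real.exp (-(2 * l * κ) * D) ≤ Real.exp (-2 * R * D) := by
    apply Real.exp_le_exp.2; nlinarith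
  have hY : Real.exp (-2 * R) ≤ Real.exp (-2 * R * D) := by
    apply Real.exp_le_exp.2; nlinarith
  have hsq : Real.exp (-R) ^ 2 = Real.exp (-2 * R) := by
    rw [← Real.exp_nat_mul]; congr 1; push_cast; ring
  have e2 : K * ((P * M * Real.exp (-R)) ^ 2 * Real.exp (-(2 * l * κ) * D)) ≤
      M ^ 2 / 8 * Real.exp (-2 * R * D) := by
    calc K * ((P * M * Real.exp (-R)) ^ 2 * Real.exp (-(2 * l * κ) * D))
        = (K * P ^ 2 * Real.exp (-2 * R)) * (M ^ 2 * Real.exp (-(2 * l * κ) * D)) := by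
          rw [← hsq]; ring
      _ ≤ (1 / 8) * (M ^ 2 * Real.exp (-2 * R * D)) := by gcongr
      _ = _ := by ring
  have e3 : K * ((E * M) ^ 2 / (2 * l * κ)) ≤ M ^ 2 / 8 * Real.exp (-2 * R * D) := by
    have hinv : Real.exp (2 * R) * Real.exp (-2 * R) = 1 := by
      rw [← Real.exp_add]; simp
    calc K * ((E * M) ^ 2 / (2 * l * κ))
        = (K * E ^ 2 * Real.exp (2 * R) / (2 * l * κ)) * (M ^ 2 * Real.exp (-2 * R)) := by
          linear_combination (-(K * (E * M) ^ 2 / (2 * l * κ))) * hinv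
      _ ≤ (1 / 8) * (M ^ 2 * Real.exp (-2 * R * D)) := by gcongr
      _ = _ := by ring
  have e4 : v x t ^ 2 ≤ ((M / 2) * Real.exp (l * t - R * D)) ^ 2 := by
    refine e1.trans ?_
    have : ((M / 2) * Real.exp (l * t - R * D)) ^ 2 =
        (M ^ 2 / 4) * (Real.exp (-2 * R * D) * Real.exp (2 * l * t)) := by
      rw [mul_pow, ← Real.exp_nat_mul, ← Real.exp_add]
      congr 1
      · ring
      · congr 1; push_cast; ring
    rw [this, mul_add]
    have := mul_le_mul_of_nonneg_right (add_le_add e2 e3) (Real.exp_pos (2 * l * t)).le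
    refine this.trans (le_of_eq ?_)
    ring
  exact abs_le_of_sq_le_sq e4 (by positivity)

/-- bounds for finite sums -/
lemma sum_bound {n : ℕ} {a b : Fin n → ℝ} {A X : ℝ} (ha : ∀ k, |a k| ≤ A) (hb : ∀ k, |b k| ≤ X)
    (hA : 0 ≤ A) :
    |∑ k, a k * b k| ≤ n * A * X := by
  calc |∑ k, a k * b k| ≤ ∑ k : Fin n, |a k * b k| := Finset.abs_sum_le_sum_abs _ _
    _ ≤ ∑ _k : Fin n, A * X := by
      apply Finset.sum_le_sum
      intro k _
      rw [abs_mul]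
      exact mul_le_mul (ha k) (hb k) (abs_nonneg _) hA
    _ = n * A * X := by simp; ring

lemma exp_w_le {l t R y : ℝ} (hR : 0 ≤ R) : Real.exp (l * t - R * |y|) ≤ Real.exp (l * t) := by
  apply Real.exp_le_exp.2
  have : 0 ≤ R * |y| := by positivity
  linarith

lemma SysH.xo_dist {n : ℕ} {c ct : Fin n → ℝ → ℝ → ℝ} {xin xout : Fin n → ℝ} {κ B L : ℝ}
    (h : SysH c ct xin xout κ B L) (k : Fin n) : |xout k - xin k| = 1 := by
  rw [h.xo]
  rcases h.dir k with h1 | h1 <;> rw [h1.1] <;> norm_num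

lemma SysH.xo_mem {n : ℕ} {c ct : Fin n → ℝ → ℝ → ℝ} {xin xout : Fin n → ℝ} {κ B L : ℝ}
    (h : SysH c ct xin xout κ B L) (k : Fin n) : xout k ∈ Icc (0:ℝ) 1 := by
  rw [h.xo]
  rcases h.dir k with h1 | h1 <;> rw [h1.1] <;> norm_num

theorem unique_sol {n : ℕ} {c ct : Fin n → ℝ → ℝ → ℝ} {xin xout : Fin n → ℝ} {κ B L : ℝ}
    (hs : SysH c ct xin xout κ B L) (p : Fin n → Fin n → ℝ)
    {e : Fin n → Fin n → ℝ → ℝ → ℝ} (hec : ∀ j k, Continuous (fun q : ℝ × ℝ => e j k q.1 q.2))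
    {E : ℝ} (hE : ∀ j k x t, |e j k x t| ≤ E) :
    ∃ l0 : ℝ, 0 < l0 ∧ ∀ l, l0 ≤ l → ∀ u : Fin n → ℝ → ℝ → ℝ,
      (∀ j, Continuous (fun q : ℝ × ℝ => u j q.1 q.2)) →
      (∀ j, Along (c j) (u j) (fun x t => ∑ k, e j k x t * u k x t)) →
      (∀ j t, u j (xin j) t = ∑ k, p j k * u k (xout k) t) →
      (∃ M, ∀ j, ∀ x ∈ Icc (0:ℝ) 1, ∀ t, |u j x t| ≤ M * Real.exp (l * t)) →
      ∀ j, ∀ x ∈ Icc (0:ℝ) 1, ∀ t, u j x t = 0 := by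
  obtain ⟨P, hP0, hP⟩ : ∃ P : ℝ, 0 ≤ P ∧ ∀ j k, |p j k| ≤ P := by
    refine ⟨∑ j, ∑ k, |p j k|, by positivity, fun j k => ?_⟩
    refine (Finset.single_le_sum (f := fun k => |p j k|) (fun _ _ => abs_nonneg _)
      (Finset.mem_univ k)).trans ?_
    exact (Finset.single_le_sum (f := fun j => ∑ k, |p j k|)
      (fun _ _ => Finset.sum_nonneg fun _ _ => abs_nonneg _) (Finset.mem_univ j))
  obtain ⟨R, hR, l0, hl0, hl⟩ := params_exist (Real.exp (2 * 0 + 1)) κ (n * P) (n * E)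
    (Real.exp_pos _) hs.pos
  refine ⟨l0, hl0, fun l hll u huc hal hbc ⟨M, hM⟩ => ?_⟩
  obtain ⟨p1, p2, p3⟩ := hl l hll
  have hlp : 0 < l := hl0.trans_le hll
  have step : ∀ N, 0 ≤ N → (∀ j, ∀ x ∈ Icc (0:ℝ) 1, ∀ t, |u j x t| ≤
      N * Real.exp (l * t - R * |x - xin j|)) →
      (∀ j, ∀ x ∈ Icc (0:ℝ) 1, ∀ t, |u j x t| ≤ N / 2 * Real.exp (l * t - R * |x - xin j|)) := by
    intro N hN hb j
    have hE0 : 0 ≤ E := (abs_nonneg _).trans (hE j j 0 0)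
    refine contr_step (hs.spd j) (hs.dir j) hs.pos (γ := fun _ _ => 0) (G := 0)
      (g := fun x t => ∑ k, e j k x t * u k x t) ?_ (huc j) ?_ (by simp) hlp hN p1 p2 p3 hR ?_ ?_
    · simpa using hal j
    · exact continuous_finsetSum _ fun k _ => (hec j k).mul (huc k)
    · intro τ
      rw [hbc]
      have := sum_bound (a := p j) (b := fun k => u k (xout k) τ) (A := P)
        (X := N * Real.exp (l * τ - R)) (hP j) (fun k => by
          have := hb k (xout k) (hs.xo_mem k) τ
          rwa [hs.xo_dist k, mul_one] at this) hP0
      refine this.trans (le_of_eq ?_)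
      rw [sub_eq_add_neg, Real.exp_add]
      ring
    · intro ξ hξ τ
      have := sum_bound (a := fun k => e j k ξ τ) (b := fun k => u k ξ τ) (A := E)
        (X := N * Real.exp (l * τ)) (fun k => hE j k ξ τ) (fun k => by
          refine (hb k ξ hξ τ).trans ?_
          exact mul_le_mul_of_nonneg_left (exp_w_le hR) hN) hE0
      refine this.trans (le_of_eq ?_)
      ring
  intro j x hx t
  have hM0 : 0 ≤ M := by
    have h1 := (abs_nonneg _).trans (hM j x hx t)
    have h2 := Real.exp_pos (l * t)
    by_contra h
    push Not at h
    nlinarith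
  have base : ∀ j, ∀ x ∈ Icc (0:ℝ) 1, ∀ t, |u j x t| ≤
      (M * Real.exp R) * Real.exp (l * t - R * |x - xin j|) := by
    intro j x hx t
    refine (hM j x hx t).trans ?_
    rw [mul_assoc, ← Real.exp_add]
    gcongr
    have hd : |x - xin j| ≤ 1 := by
      have := (hs.dir j).mem
      rw [abs_le]; constructor <;> linarith [this.1, this.2, hx.1, hx.2]
    nlinarith
  have iter : ∀ N : ℕ, ∀ j, ∀ x ∈ Icc (0:ℝ) 1, ∀ t, |u j x t| ≤
      (M * Real.exp R * (1 / 2) ^ N) * Real.exp (l * t - R * |x - xin j|) := by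
    intro N
    induction N with
    | zero => simpa using base
    | succ N ih =>
      have := step _ (by positivity) ih
      intro j x hx t
      refine (this j x hx t).trans (le_of_eq ?_)
      rw [pow_succ]; ring
  have lim : Tendsto (fun N : ℕ => (M * Real.exp R * (1 / 2) ^ N) *
      Real.exp (l * t - R * |x - xin j|)) atTop (nhds 0) := by
    have h1 := tendsto_pow_atTop_nhds_zero_of_lt_one (r := (1 / 2 : ℝ)) (by norm_num) (by norm_num)
    have h2 := (h1.const_mul (M * Real.exp R)).mul_const (Real.exp (l * t - R * |x - xin j|))
    simpa using h2
  have := ge_of_tendsto' lim (fun N => iter N j x hx t)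
  exact abs_eq_zero.1 (le_antisymm this (abs_nonneg _))

lemma summ_half (A : ℝ) : Summable (fun k : ℕ => A * (1 / 2 : ℝ) ^ k) :=
  (summable_geometric_of_lt_one (by norm_num) (by norm_num)).mul_left A

lemma series_cont {f : ℕ → ℝ → ℝ → ℝ} {A l : ℝ} (hl : 0 < l) (hA : 0 ≤ A)
    (hf : ∀ k, Continuous (fun q : ℝ × ℝ => f k q.1 q.2))
    (hb : ∀ k x t, |f k x t| ≤ A * (1 / 2) ^ k * Real.exp (l * t)) :
    Continuous (fun q : ℝ × ℝ => ∑' k, f k q.1 q.2) := by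
  rw [continuous_iff_continuousAt]
  rintro ⟨x0, t0⟩
  have h1 : ContinuousOn (fun q : ℝ × ℝ => ∑' k, f k q.1 q.2) {q | q.2 < t0 + 1} := by
    refine continuousOn_tsum (u := fun k => (A * Real.exp (l * (t0 + 1))) * (1 / 2) ^ k)
      (fun k => (hf k).continuousOn) (summ_half _) ?_
    intro k q hq
    rw [Real.norm_eq_abs]
    refine (hb k q.1 q.2).trans ?_
    have : Real.exp (l * q.2) ≤ Real.exp (l * (t0 + 1)) := by
      apply Real.exp_le_exp.2
      have : q.2 < t0 + 1 := hq
      nlinarith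
    calc A * (1 / 2) ^ k * Real.exp (l * q.2) ≤ A * (1 / 2) ^ k * Real.exp (l * (t0 + 1)) := by
          gcongr
      _ = _ := by ring
  apply h1.continuousAt
  apply IsOpen.mem_nhds
  · exact isOpen_lt continuous_snd continuous_const
  · simp

lemma series_summ {f : ℕ → ℝ → ℝ → ℝ} {A l : ℝ}
    (hb : ∀ k x t, |f k x t| ≤ A * (1 / 2) ^ k * Real.exp (l * t)) (x t : ℝ) :
    Summable (fun k => f k x t) := by
  refine Summable.of_norm_bounded (g := fun k => (A * Real.exp (l * t)) * (1 / 2) ^ k)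
    (summ_half _) fun k => ?_
  rw [Real.norm_eq_abs]
  exact (hb k x t).trans (le_of_eq (by ring))

lemma series_bd {f : ℕ → ℝ → ℝ → ℝ} {A l : ℝ}
    (hb : ∀ k x t, |f k x t| ≤ A * (1 / 2) ^ k * Real.exp (l * t)) (x t : ℝ) :
    |∑' k, f k x t| ≤ (2 * A) * Real.exp (l * t) := by
  have hs : HasSum (fun k : ℕ => (A * Real.exp (l * t)) * (1 / 2 : ℝ) ^ k)
      ((A * Real.exp (l * t)) * 2) := hasSum_geometric_two.mul_left _
  have := tsum_of_norm_bounded (f := fun k => f k x t) hs (fun k => by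
    rw [Real.norm_eq_abs]
    exact (hb k x t).trans (le_of_eq (by ring)))
  rw [Real.norm_eq_abs] at this
  exact this.trans (le_of_eq (by ring))

lemma series_TD {f ft : ℕ → ℝ → ℝ → ℝ} {A l : ℝ} (hl : 0 < l) (hA : 0 ≤ A)
    (hf : ∀ k, TD (f k) (ft k))
    (hb : ∀ k x t, |f k x t| ≤ A * (1 / 2) ^ k * Real.exp (l * t))
    (hbt : ∀ k x t, |ft k x t| ≤ A * (1 / 2) ^ k * Real.exp (l * t)) :
    TD (fun x t => ∑' k, f k x t) (fun x t => ∑' k, ft k x t) := by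
  refine ⟨series_cont hl hA (fun k => (hf k).cont) hb,
    series_cont hl hA (fun k => (hf k).contt) hbt, fun x t => ?_⟩
  refine hasDerivAt_tsum_of_isPreconnected (g := fun k t => f k x t) (g' := fun k t => ft k x t)
    (u := fun k => (A * Real.exp (l * (t + 1))) * (1 / 2) ^ k) (t := Iio (t + 1)) (y₀ := t)
    (summ_half _) isOpen_Iio isPreconnected_Iio (fun k y _ => (hf k).der x y) ?_ (by simp)
    (series_summ hb x t) (by simp)
  intro k y hy
  rw [Real.norm_eq_abs]
  refine (hbt k x y).trans ?_
  have : Real.exp (l * y) ≤ Real.exp (l * (t + 1)) := by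
    apply Real.exp_le_exp.2
    have : y < t + 1 := hy
    nlinarith
  calc A * (1 / 2) ^ k * Real.exp (l * y) ≤ A * (1 / 2) ^ k * Real.exp (l * (t + 1)) := by
        gcongr
    _ = _ := by ring

lemma series_along {c : ℝ → ℝ → ℝ} {f g : ℕ → ℝ → ℝ → ℝ} {A A' l : ℝ} (hl : 0 < l) (hA : 0 ≤ A')
    (hf : ∀ k, Along c (f k) (g k))
    (hb : ∀ k x t, |f k x t| ≤ A * (1 / 2) ^ k * Real.exp (l * t))
    (hbg : ∀ k, ∀ x ∈ Icc (0:ℝ) 1, ∀ t, |g k x t| ≤ A' * (1 / 2) ^ k * Real.exp (l * t)) :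
    Along c (fun x t => ∑' k, f k x t) (fun x t => ∑' k, g k x t) := by
  intro S hS x hx
  obtain ⟨T, hT⟩ := (isCompact_Icc (a := (0:ℝ)) (b := 1)).exists_bound_of_continuousOn
    hS.1.continuousOn
  refine hasDerivAt_tsum_of_isPreconnected (g := fun k t => f k t (S t))
    (g' := fun k t => g k t (S t))
    (u := fun k => (A' * Real.exp (l * T)) * (1 / 2) ^ k) (t := Ioo 0 1) (y₀ := x)
    (summ_half _) isOpen_Ioo isPreconnected_Ioo (fun k y hy => hf k S hS y hy) ?_ hx
    (series_summ hb x _) hx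
  intro k y hy
  have hy' := Ioo_subset_Icc_self hy
  rw [Real.norm_eq_abs]
  refine (hbg k y hy' _).trans ?_
  have : Real.exp (l * S y) ≤ Real.exp (l * T) := by
    apply Real.exp_le_exp.2
    have := (le_abs_self _).trans (hT y hy')
    nlinarith
  calc A' * (1 / 2) ^ k * Real.exp (l * S y) ≤ A' * (1 / 2) ^ k * Real.exp (l * T) := by
        gcongr
    _ = _ := by ring

lemma series_rec {n : ℕ} {f : ℕ → ℝ} {F : Fin n → ℕ → ℝ} {a : Fin n → ℝ} {b : ℝ}
    (h0 : f 0 = b) (h1 : ∀ k, f (k + 1) = ∑ i, a i * F i k) (hF : ∀ i, Summable (F i)) :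
    ∑' k, f k = ∑ i, a i * ∑' k, F i k + b := by
  have hs : Summable (fun k => f (k + 1)) := by
    simp only [h1]
    exact summable_sum fun i _ => (hF i).mul_left _
  rw [((summable_nat_add_iff 1).1 hs).tsum_eq_zero_add, h0, add_comm]
  congr 1
  simp only [h1]
  rw [Summable.tsum_finsetSum fun i _ => (hF i).mul_left _]
  simp only [tsum_mul_left]

end HS

namespace HS

lemma p_bound {n : ℕ} (p : Fin n → Fin n → ℝ) : ∃ P : ℝ, 0 ≤ P ∧ ∀ j k, |p j k| ≤ P := by
  refine ⟨∑ j, ∑ k, |p j k|, by positivity, fun j k => ?_⟩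
  refine (Finset.single_le_sum (f := fun k => |p j k|) (fun _ _ => abs_nonneg _)
    (Finset.mem_univ k)).trans ?_
  exact (Finset.single_le_sum (f := fun j => ∑ k, |p j k|)
    (fun _ _ => Finset.sum_nonneg fun _ _ => abs_nonneg _) (Finset.mem_univ j))

/-- closedness of a region under domains of dependence -/
structure DepClosed {n : ℕ} (xin xout : Fin n → ℝ) (κ : ℝ) (Z : ℝ → ℝ → Prop) : Prop where
  inner : ∀ x ∈ Icc (0:ℝ) 1, ∀ t, Z x t → ∀ ξ ∈ Icc (0:ℝ) 1, ∀ τ ≤ t - κ * |x - ξ|, Z ξ τ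
  bdry : ∀ x ∈ Icc (0:ℝ) 1, ∀ t, Z x t → ∀ j k, ∀ τ ≤ t - κ * |x - xin j|, Z (xout k) τ

theorem exist_sol {n : ℕ} {c ct : Fin n → ℝ → ℝ → ℝ} {xin xout : Fin n → ℝ} {κ B L : ℝ}
    (hs : SysH c ct xin xout κ B L) (p : Fin n → Fin n → ℝ)
    {e et : Fin n → Fin n → ℝ → ℝ → ℝ} (he : ∀ j k, TD (e j k) (et j k))
    {E : ℝ} (hE : ∀ j k x t, |e j k x t| ≤ E) (hEt : ∀ j k x t, |et j k x t| ≤ E) :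
    ∃ l0 : ℝ, 0 < l0 ∧ ∀ l, l0 ≤ l → ∀ h ht : Fin n → ℝ → ℝ → ℝ, (∀ j, TD (h j) (ht j)) →
      (∃ M, ∀ j x t, |h j x t| ≤ M * Real.exp (l * t) ∧ |ht j x t| ≤ M * Real.exp (l * t)) →
      ∃ u w : Fin n → ℝ → ℝ → ℝ, (∀ j, TD (u j) (w j)) ∧
      (∀ j, Along (c j) (u j) (fun x t => ∑ k, e j k x t * u k x t + h j x t)) ∧
      (∀ j t, u j (xin j) t = ∑ k, p j k * u k (xout k) t) ∧
      (∃ M, ∀ j x t, |u j x t| ≤ M * Real.exp (l * t) ∧ |w j x t| ≤ M * Real.exp (l * t)) ∧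
      (∀ Z, DepClosed xin xout κ Z → (∀ j, ∀ x ∈ Icc (0:ℝ) 1, ∀ t, Z x t → h j x t = 0) →
        ∀ j, ∀ x ∈ Icc (0:ℝ) 1, ∀ t, Z x t → u j x t = 0) := by
  obtain ⟨P, hP0, hP⟩ := p_bound p
  rcases Nat.eq_zero_or_pos n with hn | hn
  · subst hn
    exact ⟨1, one_pos, fun l _ h ht _ _ => ⟨fun j => j.elim0, fun j => j.elim0, fun j => j.elim0,
      fun j => j.elim0, fun j => j.elim0, ⟨0, fun j => j.elim0⟩, fun _ _ _ j => j.elim0⟩⟩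
  have hE0 : 0 ≤ E := (abs_nonneg _).trans (hE ⟨0, hn⟩ ⟨0, hn⟩ 0 0)
  obtain ⟨R, hR, l0, hl0, hl⟩ := params_exist (Real.exp (2 * L + 1)) κ (n * P) (n * E + n * E + 1)
    (Real.exp_pos _) hs.pos
  refine ⟨l0, hl0, fun l hll h ht hh ⟨M, hM⟩ => ?_⟩
  obtain ⟨p1, p2, p3⟩ := hl l hll
  have hlp : 0 < l := hl0.trans_le hll
  set E1 := (n * E + n * E + 1 : ℝ) with hE1
  have hnE : 0 ≤ n * E := by positivity
  have hE11 : 1 ≤ E1 := by rw [hE1]; linarith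
  have hM0 : 0 ≤ M := by
    have h1 := (abs_nonneg _).trans (hM ⟨0, hn⟩ 0 0).1
    simpa using h1
  have hctb : ∀ j, ∀ ξ ∈ Icc (0:ℝ) 1, ∀ τ, |-(ct j ξ τ)| ≤ L := fun j ξ _ τ => by
    rw [abs_neg]; exact (hs.spd j).bdt _ _
  have h0b : ∀ ξ ∈ Icc (0:ℝ) 1, ∀ τ : ℝ, |(fun _ _ => 0 : ℝ → ℝ → ℝ) ξ τ| ≤ L := fun _ _ _ => by
    simpa using hs.Lnn
  let WB : (Fin n → ℝ → ℝ → ℝ) → ℝ → Prop := fun u N =>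
    ∀ j, ∀ x ∈ Icc (0:ℝ) 1, ∀ t, |u j x t| ≤ N * Real.exp (l * t - R * |x - xin j|)
  let X := {q : (Fin n → ℝ → ℝ → ℝ) × (Fin n → ℝ → ℝ → ℝ) // ∀ j, TD (q.1 j) (q.2 j)}
  -- the initial iterate
  have iter0 : ∃ q : X, (∀ j, Along (c j) (q.1.1 j) (h j)) ∧ (∀ j t, q.1.1 j (xin j) t = 0) ∧
      (∀ j x t, q.1.1 j x t = q.1.1 j (pj x) t) ∧ (∀ j x t, q.1.2 j x t = q.1.2 j (pj x) t) ∧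
      WB q.1.1 M ∧ WB q.1.2 M := by
    have := fun j => scalar_solve (hs.spd j) (hh j) (q := fun _ => 0) (qt := fun _ => 0)
      continuous_const (fun t => hasDerivAt_const t 0) (hs.dir j).mem
    choose v vt a1 a2 a3 a4 a5 a6 a7 using this
    refine ⟨⟨(v, vt), a1⟩, a2, a4, a6, a7, ?_, ?_⟩
    · intro j x hx t
      have := contr_step (hs.spd j) (hs.dir j) hs.pos (v := v j) (γ := fun _ _ => 0) (G := L)
        (g := h j) (by simpa using a2 j) (a1 j).cont (hh j).cont h0b hlp hM0 p1 p2 p3 hR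
        (fun τ => by rw [a4]; simp; positivity)
        (fun ξ hξ τ => (hM j ξ τ).1.trans (by gcongr; nlinarith)) x hx t
      refine this.trans ?_
      gcongr
      linarith
    · intro j x hx t
      have := contr_step (hs.spd j) (hs.dir j) hs.pos (v := vt j) (γ := fun x t => -(ct j x t))
        (G := L)
        (g := ht j) ((a3 j).congr fun x _ t => by ring) (a1 j).contt (hh j).contt (hctb j)
        hlp hM0 p1 p2 p3 hR
        (fun τ => by rw [a5]; simp; positivity)
        (fun ξ hξ τ => (hM j ξ τ).2.trans (by gcongr; nlinarith)) x hx t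
      refine this.trans ?_
      gcongr
      linarith
  have step : ∀ q : X, ∃ q' : X,
      (∀ j, Along (c j) (q'.1.1 j) (fun x t => ∑ k, e j k x t * q.1.1 k x t)) ∧
      (∀ j t, q'.1.1 j (xin j) t = ∑ k, p j k * q.1.1 k (xout k) t) ∧
      (∀ j x t, q'.1.1 j x t = q'.1.1 j (pj x) t) ∧
      (∀ j x t, q'.1.2 j x t = q'.1.2 j (pj x) t) ∧
      (∀ N, 0 ≤ N → WB q.1.1 N → WB q.1.2 N → WB q'.1.1 (N / 2) ∧ WB q'.1.2 (N / 2)) := by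
    rintro ⟨⟨u, w⟩, huw⟩
    have hgT : ∀ j, TD (fun x t => ∑ k, e j k x t * u k x t)
      (fun x t => ∑ k, (et j k x t * u k x t + e j k x t * w k x t)) := fun j =>
      TD.sum fun k _ => (he j k).mul (huw k)
    have hqd : ∀ j t, HasDerivAt (fun t => ∑ k, p j k * u k (xout k) t)
        (∑ k, p j k * w k (xout k) t) t := fun j t =>
      HasDerivAt.fun_sum fun k _ => ((huw k).der _ t).const_mul _
    have hqc : ∀ j, Continuous (fun t => ∑ k, p j k * w k (xout k) t) := fun j =>
      continuous_finsetSum _ fun k _ => continuous_const.mul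
        (cont2 (huw k).contt continuous_const continuous_id)
    have := fun j => scalar_solve (hs.spd j) (hgT j) (hqc j) (hqd j) (hs.dir j).mem
    choose v vt a1 a2 a3 a4 a5 a6 a7 using this
    refine ⟨⟨(v, vt), a1⟩, a2, a4, a6, a7, fun N hN hb hb' => ⟨?_, ?_⟩⟩
    · intro j
      refine contr_step (hs.spd j) (hs.dir j) hs.pos (v := v j) (γ := fun _ _ => 0) (G := L)
        (g := fun x t => ∑ k, e j k x t * u k x t) (by simpa using a2 j) (a1 j).cont (hgT j).cont
        h0b hlp hN p1 p2 p3 hR ?_ ?_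
      · intro τ
        rw [a4]
        have := sum_bound (a := p j) (b := fun k => u k (xout k) τ) (A := P)
          (X := N * Real.exp (l * τ - R)) (hP j) (fun k => by
            have := hb k (xout k) (hs.xo_mem k) τ
            rwa [hs.xo_dist k, mul_one] at this) hP0
        refine this.trans (le_of_eq ?_)
        rw [sub_eq_add_neg, Real.exp_add]
        ring
      · intro ξ hξ τ
        have := sum_bound (a := fun k => e j k ξ τ) (b := fun k => u k ξ τ) (A := E)
          (X := N * Real.exp (l * τ)) (fun k => hE j k ξ τ) (fun k => by
            refine (hb k ξ hξ τ).trans ?_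
            exact mul_le_mul_of_nonneg_left (exp_w_le hR) hN) hE0
        refine this.trans ?_
        rw [← mul_assoc]
        gcongr
        rw [hE1]
        linarith
    · intro j
      refine contr_step (hs.spd j) (hs.dir j) hs.pos (v := vt j) (γ := fun x t => -(ct j x t))
        (G := L)
        (g := fun x t => ∑ k, (et j k x t * u k x t + e j k x t * w k x t))
        ((a3 j).congr fun x _ t => by ring) (a1 j).contt (hgT j).contt
        (hctb j) hlp hN p1 p2 p3 hR ?_ ?_
      · intro τ
        rw [a5]
        have := sum_bound (a := p j) (b := fun k => w k (xout k) τ) (A := P)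
          (X := N * Real.exp (l * τ - R)) (hP j) (fun k => by
            have := hb' k (xout k) (hs.xo_mem k) τ
            rwa [hs.xo_dist k, mul_one] at this) hP0
        refine this.trans (le_of_eq ?_)
        rw [sub_eq_add_neg, Real.exp_add]
        ring
      · intro ξ hξ τ
        have b1 := sum_bound (a := fun k => e j k ξ τ) (b := fun k => w k ξ τ) (A := E)
          (X := N * Real.exp (l * τ)) (fun k => hE j k ξ τ) (fun k => by
            refine (hb' k ξ hξ τ).trans ?_
            exact mul_le_mul_of_nonneg_left (exp_w_le hR) hN) hE0
        have b2 := sum_bound (a := fun k => et j k ξ τ) (b := fun k => u k ξ τ) (A := E)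
          (X := N * Real.exp (l * τ)) (fun k => hEt j k ξ τ) (fun k => by
            refine (hb k ξ hξ τ).trans ?_
            exact mul_le_mul_of_nonneg_left (exp_w_le hR) hN) hE0
        rw [Finset.sum_add_distrib]
        refine (abs_add_le _ _).trans ((add_le_add b2 b1).trans ?_)
        have : 0 ≤ N * Real.exp (l * τ) := by positivity
        rw [hE1]
        nlinarith
  choose nxt n1 n2 n3 n4 n5 using step
  obtain ⟨q0, i1, i2, i3, i4, i5, i6⟩ := iter0
  let sq : ℕ → X := fun k => Nat.rec q0 (fun _ q => nxt q) k
  have sq0 : sq 0 = q0 := rfl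
  have sqs : ∀ k, sq (k + 1) = nxt (sq k) := fun k => rfl
  have hWB : ∀ k, WB (sq k).1.1 (M * (1 / 2) ^ k) ∧ WB (sq k).1.2 (M * (1 / 2) ^ k) := by
    intro k
    induction k with
    | zero => simpa [sq0] using ⟨i5, i6⟩
    | succ k ih =>
      have := n5 (sq k) (M * (1 / 2) ^ k) (by positivity) ih.1 ih.2
      rw [sqs, pow_succ, ← mul_assoc, mul_one_div]
      exact this
  have hpj : ∀ k, (∀ j x t, (sq k).1.1 j x t = (sq k).1.1 j (pj x) t) ∧
      (∀ j x t, (sq k).1.2 j x t = (sq k).1.2 j (pj x) t) := by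
    intro k
    cases k with
    | zero => exact ⟨i3, i4⟩
    | succ k => exact ⟨n3 _, n4 _⟩
  have bu : ∀ j k x t, |(sq k).1.1 j x t| ≤ M * (1 / 2) ^ k * Real.exp (l * t) := by
    intro j k x t
    rw [(hpj k).1]
    refine ((hWB k).1 j _ (pj_mem x) t).trans ?_
    exact mul_le_mul_of_nonneg_left (exp_w_le hR) (by positivity)
  have bw : ∀ j k x t, |(sq k).1.2 j x t| ≤ M * (1 / 2) ^ k * Real.exp (l * t) := by
    intro j k x t
    rw [(hpj k).2]
    refine ((hWB k).2 j _ (pj_mem x) t).trans ?_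
    exact mul_le_mul_of_nonneg_left (exp_w_le hR) (by positivity)
  refine ⟨fun j x t => ∑' k, (sq k).1.1 j x t, fun j x t => ∑' k, (sq k).1.2 j x t, ?_, ?_, ?_,
    ?_, ?_⟩
  · intro j
    exact series_TD hlp hM0 (fun k => (sq k).2 j) (bu j) (bw j)
  · intro j
    let g : ℕ → ℝ → ℝ → ℝ := fun k => Nat.rec (h j)
      (fun k _ => fun x t => ∑ i, e j i x t * (sq k).1.1 i x t) k
    have hg : ∀ k, Along (c j) ((sq k).1.1 j) (g k) := by
      intro k
      cases k with
      | zero => exact i1 j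
      | succ k => exact n1 (sq k) j
    have hgb : ∀ k, ∀ x ∈ Icc (0:ℝ) 1, ∀ t,
        |g k x t| ≤ (2 * E1 * M) * (1 / 2) ^ k * Real.exp (l * t) := by
      intro k x hx t
      cases k with
      | zero =>
        refine (hM j x t).1.trans ?_
        simp only [pow_zero, mul_one]
        gcongr
        nlinarith
      | succ k =>
        have := sum_bound (a := fun k => e j k x t) (b := fun i => (sq k).1.1 i x t) (A := E)
          (X := M * (1 / 2) ^ k * Real.exp (l * t)) (fun k => hE j k x t) (fun i => bu i k x t) hE0
        refine this.trans ?_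
        calc n * E * (M * (1 / 2) ^ k * Real.exp (l * t)) ≤
            E1 * (M * (1 / 2) ^ k * Real.exp (l * t)) := by gcongr; rw [hE1]; linarith
          _ = _ := by rw [pow_succ]; ring
    refine (series_along hlp (by positivity) hg (bu j) hgb).congr ?_
    intro x hx t
    exact series_rec (f := fun k => g k x t) (F := fun i k => (sq k).1.1 i x t)
      (a := fun i => e j i x t) (b := h j x t) rfl (fun k => rfl)
      (fun i => series_summ (f := fun k => (sq k).1.1 i) (bu i) x t)
  · intro j t
    have := series_rec (f := fun k => (sq k).1.1 j (xin j) t)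
      (F := fun i k => (sq k).1.1 i (xout i) t)
      (a := fun i => p j i) (b := 0) (i2 j t) (fun k => n2 (sq k) j t)
      (fun i => series_summ (f := fun k => (sq k).1.1 i) (bu i) _ t)
    rw [add_zero] at this
    exact this
  · refine ⟨2 * M, fun j x t => ⟨?_, ?_⟩⟩
    · exact series_bd (f := fun k => (sq k).1.1 j) (bu j) x t
    · exact series_bd (f := fun k => (sq k).1.2 j) (bw j) x t
  · intro Z hZ hhZ
    have key : ∀ k j, ∀ x ∈ Icc (0:ℝ) 1, ∀ t, Z x t → (sq k).1.1 j x t = 0 := by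
      intro k
      induction k with
      | zero =>
        intro j x hx t hz
        refine ml_zero (hs.spd j) (hs.dir j) (γ := fun _ _ => 0) (G := L) (g := h j)
          (by simpa using i1 j) (q0.2 j).cont (hh j).cont h0b hx (fun τ _ => i2 j τ) ?_
        intro ξ hξ τ hτ
        exact hhZ j ξ hξ τ (hZ.inner x hx t hz ξ hξ τ hτ)
      | succ k ih =>
        intro j x hx t hz
        refine ml_zero (hs.spd j) (hs.dir j) (γ := fun _ _ => 0) (G := L)
          (g := fun x t => ∑ i, e j i x t * (sq k).1.1 i x t)
          (by simpa using n1 (sq k) j) ((sq (k + 1)).2 j).cont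
          (continuous_finsetSum _ fun i _ => (he j i).cont.mul ((sq k).2 i).cont) h0b hx ?_ ?_
        · intro τ hτ
          rw [sqs, n2]
          apply Finset.sum_eq_zero
          intro i _
          rw [ih i _ (hs.xo_mem i) τ (hZ.bdry x hx t hz j i τ hτ), mul_zero]
        · intro ξ hξ τ hτ
          apply Finset.sum_eq_zero
          intro i _
          rw [ih i ξ hξ τ (hZ.inner x hx t hz ξ hξ τ hτ), mul_zero]
    intro j x hx t hz
    simp only [key _ j x hx t hz, tsum_zero]

end HS

namespace HS

lemma TD.proj {v vt : ℝ → ℝ → ℝ} (h : TD v vt) :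
    TD (fun x t => v (pj x) t) (fun x t => vt (pj x) t) :=
  ⟨cont2 h.cont (pj_cont.comp continuous_fst) continuous_snd,
    cont2 h.contt (pj_cont.comp continuous_fst) continuous_snd, fun x t => h.der (pj x) t⟩

lemma Along.congr_left {c v v' g : ℝ → ℝ → ℝ} (hv : Along c v g)
    (h : ∀ x ∈ Ioo (0:ℝ) 1, ∀ t, v' x t = v x t) : Along c v' g := by
  intro S hS ξ hξ
  refine (hv S hS ξ hξ).congr_of_eventuallyEq ?_
  filter_upwards [isOpen_Ioo.mem_nhds hξ] with η hη
  exact h η hη _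

theorem exist_sol2 {n : ℕ} {c ct ctt : Fin n → ℝ → ℝ → ℝ} {xin xout : Fin n → ℝ} {κ B L : ℝ}
    (hs : SysH c ct xin xout κ B L) (p : Fin n → Fin n → ℝ)
    (hct : ∀ j, TD (ct j) (ctt j)) {E : ℝ} (hcb : ∀ j x t, |ctt j x t| ≤ E)
    {e et ett : Fin n → Fin n → ℝ → ℝ → ℝ} (he : ∀ j k, TD (e j k) (et j k))
    (het : ∀ j k, TD (et j k) (ett j k))
    (hE : ∀ j k x t, |e j k x t| ≤ E) (hEt : ∀ j k x t, |et j k x t| ≤ E)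
    (hEtt : ∀ j k x t, |ett j k x t| ≤ E) :
    ∃ l0 : ℝ, 0 < l0 ∧ ∀ l, l0 ≤ l → ∀ h ht htt : Fin n → ℝ → ℝ → ℝ, (∀ j, TD (h j) (ht j)) →
      (∀ j, TD (ht j) (htt j)) →
      (∃ M, ∀ j x t, |h j x t| ≤ M * Real.exp (l * t) ∧ |ht j x t| ≤ M * Real.exp (l * t)
        ∧ |htt j x t| ≤ M * Real.exp (l * t)) →
      ∃ u w y : Fin n → ℝ → ℝ → ℝ, (∀ j, TD (u j) (w j)) ∧ (∀ j, TD (w j) (y j)) ∧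
      (∀ j, Along (c j) (u j) (fun x t => ∑ k, e j k x t * u k x t + h j x t)) ∧
      (∀ j t, u j (xin j) t = ∑ k, p j k * u k (xout k) t) ∧
      (∀ Z, DepClosed xin xout κ Z → (∀ j, ∀ x ∈ Icc (0:ℝ) 1, ∀ t, Z x t → h j x t = 0) →
        ∀ j, ∀ x ∈ Icc (0:ℝ) 1, ∀ t, Z x t → u j x t = 0) := by
  rcases Nat.eq_zero_or_pos n with hn | hn
  · subst hn
    exact ⟨1, one_pos, fun l _ h ht htt _ _ _ => ⟨fun j => j.elim0, fun j => j.elim0,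
      fun j => j.elim0, fun j => j.elim0, fun j => j.elim0,
      fun j => j.elim0, fun j => j.elim0, fun _ _ _ j => j.elim0⟩⟩
  have hE0 : 0 ≤ E := (abs_nonneg _).trans (hE ⟨0, hn⟩ ⟨0, hn⟩ 0 0)
  set e' : Fin n → Fin n → ℝ → ℝ → ℝ :=
    fun j k x t => e j k x t - (if j = k then ct j x t else 0) with he'
  set e't : Fin n → Fin n → ℝ → ℝ → ℝ :=
    fun j k x t => et j k x t - (if j = k then ctt j x t else 0) with he't
  have hTe' : ∀ j k, TD (e' j k) (e't j k) := by
    intro j k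
    refine (he j k).sub ?_
    by_cases hjk : j = k
    · simp only [hjk, if_true]; exact hct k
    · simp only [hjk, if_false]; exact TD.zero
  have bE : ∀ j k x t, |e' j k x t| ≤ E + L + E := by
    intro j k x t
    have h1 := hE j k x t
    have h2 := (hs.spd j).bdt x t
    have h3 := hs.Lnn
    simp only [he']
    split_ifs
    · exact (abs_sub _ _).trans (by linarith)
    · rw [sub_zero]; linarith
  have bEt : ∀ j k x t, |e't j k x t| ≤ E + L + E := by
    intro j k x t
    have h1 := hEt j k x t
    have h2 := hcb j x t
    have h3 := hs.Lnn
    simp only [he't]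
    split_ifs
    · exact (abs_sub _ _).trans (by linarith)
    · rw [sub_zero]; linarith
  obtain ⟨l1, hl1, H1⟩ := exist_sol hs p he hE hEt
  obtain ⟨l2, hl2, H2⟩ := exist_sol hs p hTe' bE bEt
  obtain ⟨l3, hl3, H3⟩ := unique_sol hs p (fun j k => (hTe' j k).cont) bE
  refine ⟨max l1 (max l2 l3), lt_max_of_lt_left hl1, fun l hl h ht htt hh hht ⟨M, hM⟩ => ?_⟩
  obtain ⟨u, w, hu, ha, hbc, ⟨Mu, hMu⟩, hZ⟩ := H1 l ((le_max_left _ _).trans hl) h ht hh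
    ⟨M, fun j x t => ⟨(hM j x t).1, (hM j x t).2.1⟩⟩
  set h' : Fin n → ℝ → ℝ → ℝ := fun j x t => ∑ k, et j k x t * u k x t + ht j x t with hh'
  have hTh' : ∀ j, TD (h' j) (fun x t => ∑ k, (ett j k x t * u k x t + et j k x t * w k x t)
      + htt j x t) := fun j => (TD.sum fun k _ => (het j k).mul (hu k)).add (hht j)
  have hbw : ∀ j t, w j (xin j) t = ∑ k, p j k * w k (xout k) t := by
    intro j t
    have h1 := (hu j).der (xin j) t
    have h2 : HasDerivAt (fun t => ∑ k, p j k * u k (xout k) t)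
      (∑ k, p j k * w k (xout k) t) t :=
      HasDerivAt.fun_sum fun k _ => ((hu k).der (xout k) t).const_mul (p j k)
    have h3 : u j (xin j) = fun t => ∑ k, p j k * u k (xout k) t := funext (hbc j)
    rw [h3] at h1
    exact h1.unique h2
  have hwa : ∀ j, Along (c j) (w j) (fun x t => ∑ k, e' j k x t * w k x t + h' j x t) := by
    intro j
    refine (Along.dt (hs.spd j) (hu j)
      ((TD.sum fun k _ => (he j k).mul (hu k)).add (hh j)) (ha j)).congr ?_
    intro x _ t
    simp only [he', hh', sub_mul, ite_mul, zero_mul, Finset.sum_sub_distrib,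
      Finset.sum_ite_eq, Finset.mem_univ, if_true, Finset.sum_add_distrib]
    ring
  obtain ⟨w2, y, hw2, hw2a, hw2b, ⟨Mw, hMw⟩, -⟩ := H2 l
    ((le_max_left _ _).trans ((le_max_right _ _).trans hl)) h' _ hTh' (by
      refine ⟨n * E * Mu + n * E * Mu + M, fun j x t => ?_⟩
      have s1 := sum_bound (fun k => hEt j k x t) (fun k => (hMu k x t).1) hE0
      have s2 := sum_bound (fun k => hEtt j k x t) (fun k => (hMu k x t).1) hE0
      have s3 := sum_bound (fun k => hEt j k x t) (fun k => (hMu k x t).2) hE0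
      have s4 := (hM j x t).2.1
      have s5 := (hM j x t).2.2
      have s0 := (abs_nonneg _).trans s1
      constructor
      · refine (abs_add_le _ _).trans ?_
        linarith
      · rw [Finset.sum_add_distrib]
        refine (abs_add_le _ _).trans ((add_le_add_left (abs_add_le _ _) _).trans ?_)
        linarith)
  have heq := H3 l ((le_max_right _ _).trans ((le_max_right _ _).trans hl))
    (fun j x t => w j x t - w2 j x t) (fun j => (hu j).contt.sub (hw2 j).cont)
    (fun j => ((hwa j).sub (hw2a j)).congr (fun x _ t => by
      simp only [mul_sub, Finset.sum_sub_distrib]; ring))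
    (fun j t => by
      simp only [mul_sub, Finset.sum_sub_distrib]; rw [hbw, hw2b])
    ⟨Mu + Mw, fun j x _ t => (abs_sub _ _).trans (by
      have := (hMu j x t).2
      have := (hMw j x t).1
      linarith)⟩
  have hxi : ∀ j, xin j ∈ Icc (0:ℝ) 1 := fun j => (hs.dir j).mem
  refine ⟨fun j x t => u j (pj x) t, fun j x t => w j (pj x) t, fun j x t => y j (pj x) t,
    fun j => (hu j).proj, fun j => ?_, fun j => ?_, fun j t => ?_, ?_⟩
  · have : (fun x t => w j (pj x) t) = fun x t => w2 j (pj x) t := by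
      funext x t
      have := heq j (pj x) (pj_mem x) t
      linarith
    change TD (fun x t => w j (pj x) t) _
    rw [this]
    exact (hw2 j).proj
  · refine ((ha j).congr_left (fun x hx t => ?_)).congr (fun x hx t => ?_)
    · simp only [pj_eq (Ioo_subset_Icc_self hx)]
    · simp only [pj_eq (Ioo_subset_Icc_self hx)]
  · simp only [pj_eq (hxi j), pj_eq (hs.xo_mem _)]
    exact hbc j t
  · intro Z hZ1 hZ2 j x hx t hz
    simp only [pj_eq hx]
    exact hZ Z hZ1 hZ2 j x hx t hz

end HS

namespace HS

/-- `g` is `C²` in the sense needed for coefficients. -/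
structure C2 (g gt gtt gx gxt : ℝ → ℝ → ℝ) : Prop where
  td : TD g gt
  tdt : TD gt gtt
  tdx : TD gx gxt
  chain : ∀ (S : ℝ → ℝ) (σ ξ : ℝ), ξ ∈ Ioo (0:ℝ) 1 → HasDerivAt S σ ξ →
    HasDerivAt (fun η => g η (S η)) (gx ξ (S ξ) + σ * gt ξ (S ξ)) ξ

lemma strip_ud : UniqueDiffOn ℝ strip :=
  UniqueDiffOn.prod uniqueDiffOn_Icc_zero_one uniqueDiffOn_univ

lemma pj_strip (x t : ℝ) : (pj x, t) ∈ strip := ⟨pj_mem x, mem_univ _⟩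

lemma path_t (x t : ℝ) : HasDerivAt (fun t : ℝ => (pj x, t)) ((0:ℝ), (1:ℝ)) t :=
  (hasDerivAt_const t (pj x)).prodMk (hasDerivAt_id t)

lemma td_of_contDiffOn {f : ℝ × ℝ → ℝ} {k : WithTop ℕ∞} (hf : ContDiffOn ℝ k f strip)
    (hk : 1 ≤ k) :
    TD (fun x t => f (pj x, t)) (fun x t => fderivWithin ℝ f strip (pj x, t) (0, 1)) := by
  have hm : Continuous (fun q : ℝ × ℝ => (pj q.1, q.2)) :=
    (pj_cont.comp continuous_fst).prodMk continuous_snd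
  refine ⟨?_, ?_, fun x t => ?_⟩
  · exact hf.continuousOn.comp_continuous hm (fun q => pj_strip _ _)
  · have h1 : ContinuousOn (fderivWithin ℝ f strip) strip :=
      hf.continuousOn_fderivWithin strip_ud hk
    exact (h1.comp_continuous hm (fun q => pj_strip _ _)).clm_apply continuous_const
  · have h1 := ((hf.differentiableOn (by rintro rfl; simp at hk)) (pj x, t) (pj_strip x t)).hasFDerivWithinAt
    exact h1.comp_hasDerivAt t (path_t x t) (Eventually.of_forall fun τ => pj_strip x τ)

lemma coefA {H : ℝ → ℝ → ℝ} (hH : ContDiffOn ℝ 2 (fun q : ℝ × ℝ => H q.1 q.2) strip) :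
    ∃ gt gtt gx gxt, C2 (fun x t => H (pj x) t) gt gtt gx gxt ∧
      ∀ C, (∀ i : ℕ, i ≤ 2 → ∀ q ∈ strip,
        ‖iteratedFDerivWithin ℝ i (fun q : ℝ × ℝ => H q.1 q.2) strip q‖ ≤ C) →
        ∀ x t, |H (pj x) t| ≤ C ∧ |gt x t| ≤ C ∧ |gtt x t| ≤ C := by
  set f := fun q : ℝ × ℝ => H q.1 q.2 with hf
  set D := fderivWithin ℝ f strip with hD
  have hD1 : ContDiffOn ℝ 1 D strip := hH.fderivWithin strip_ud (by norm_num)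
  have hDt : ContDiffOn ℝ 1 (fun q => D q (0, 1)) strip := hD1.clm_apply contDiffOn_const
  have hDx : ContDiffOn ℝ 1 (fun q => D q (1, 0)) strip := hD1.clm_apply contDiffOn_const
  refine ⟨_, _, _, _, ⟨td_of_contDiffOn hH (by norm_num), td_of_contDiffOn hDt le_rfl,
    td_of_contDiffOn hDx le_rfl, ?_⟩, ?_⟩
  · intro S σ ξ hξ hS
    have hI := Ioo_subset_Icc_self hξ
    have h1 := ((hH.differentiableOn (by norm_num)) (ξ, S ξ) (show (ξ, S ξ) ∈ strip from ⟨hI, mem_univ _⟩)).hasFDerivWithinAt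
    have h2 : HasDerivAt (fun η => (η, S η)) ((1:ℝ), σ) ξ := (hasDerivAt_id ξ).prodMk hS
    have hev : ∀ᶠ η in nhds ξ, η ∈ Ioo (0:ℝ) 1 := isOpen_Ioo.mem_nhds hξ
    have h3 := h1.comp_hasDerivAt (f := fun η => (η, S η)) ξ h2
      (hev.mono fun η hη => (show (η, S η) ∈ strip from ⟨Ioo_subset_Icc_self hη, mem_univ _⟩))
    refine (h3.congr_of_eventuallyEq (hev.mono fun η hη => ?_)).congr_deriv ?_
    · simp only [hf, Function.comp, pj_eq (Ioo_subset_Icc_self hη)]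
    · simp only [pj_eq hI]
      have : ((1:ℝ), σ) = (1, 0) + σ • ((0:ℝ), (1:ℝ)) := by simp
      rw [this, map_add, map_smul, smul_eq_mul]
  · intro C hC x t
    have hq := pj_strip x t
    have h0 := hC 0 (by norm_num) _ hq
    have h1 := hC 1 (by norm_num) _ hq
    have h2 := hC 2 (by norm_num) _ hq
    rw [norm_iteratedFDerivWithin_zero] at h0
    have n01 : ‖((0:ℝ), (1:ℝ))‖ = 1 := by simp [Prod.norm_def]
    refine ⟨h0, ?_, ?_⟩
    · rw [norm_iteratedFDerivWithin_one _ (strip_ud _ hq)] at h1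
      have := (fderivWithin ℝ f strip (pj x, t)).le_opNorm (0, 1)
      rw [n01, mul_one] at this
      exact this.trans h1
    · rw [show (2:ℕ) = 1 + 1 from rfl, ← norm_iteratedFDerivWithin_fderivWithin strip_ud hq,
        norm_iteratedFDerivWithin_one _ (strip_ud _ hq)] at h2
      have hd := ((hD1.differentiableOn (by norm_num)) (pj x, t) hq).hasFDerivWithinAt
      have e1 := (hd.clm_apply (hasFDerivWithinAt_const ((0:ℝ), (1:ℝ)) (pj x, t) strip)).fderivWithin
        (strip_ud _ hq)
      have e2 : fderivWithin ℝ (fun q => D q (0, 1)) strip (pj x, t) (0, 1) =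
          fderivWithin ℝ D strip (pj x, t) (0, 1) (0, 1) := by
        rw [e1]; simp
      rw [e2]
      have a1 := ((fderivWithin ℝ D strip (pj x, t)) (0, 1)).le_opNorm (0, 1)
      have a2 := (fderivWithin ℝ D strip (pj x, t)).le_opNorm (0, 1)
      rw [n01, mul_one] at a1 a2
      exact a1.trans (a2.trans h2)

lemma TD.uniq {v vt vt' : ℝ → ℝ → ℝ} (h : TD v vt) (h' : TD v vt') (x t : ℝ) :
    vt x t = vt' x t := (h.der x t).unique (h'.der x t)

lemma quot_bd {q qt qtt a at' att b bt btt : ℝ → ℝ → ℝ} (hq : TD q qt) (hqt : TD qt qtt)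
    (ha : TD a at') (hat : TD at' att) (hb : TD b bt) (hbt : TD bt btt) (he : ∀ x t, q x t * a x t = b x t)
    {Λ C : ℝ} (hΛ : 0 < Λ) (hC : 0 ≤ C) (hl : ∀ x t, Λ ≤ |a x t|)
    (hat1 : ∀ x t, |at' x t| ≤ C) (hatt : ∀ x t, |att x t| ≤ C) (hb0 : ∀ x t, |b x t| ≤ C)
    (hb1 : ∀ x t, |bt x t| ≤ C) (hb2 : ∀ x t, |btt x t| ≤ C) :
    ∃ E, 0 ≤ E ∧ ∀ x t, |q x t| ≤ E ∧ |qt x t| ≤ E ∧ |qtt x t| ≤ E := by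
  have e0 : (fun x t => q x t * a x t) = b := by funext x t; exact he x t
  have h1 := hq.mul ha
  rw [e0] at h1
  have i1 := fun x t => h1.uniq hb x t
  have e1 : (fun x t => qt x t * a x t + q x t * at' x t) = bt := by funext x t; exact i1 x t
  have h2 := (hqt.mul ha).add (hq.mul hat)
  rw [e1] at h2
  have i2 := fun x t => h2.uniq hbt x t
  have key : ∀ y α r R : ℝ, Λ ≤ |α| → y * α = r → |r| ≤ R → |y| ≤ R / Λ := by
    intro y α r R h1 h2 h3
    rw [le_div_iff₀ hΛ]
    calc |y| * Λ ≤ |y| * |α| := by gcongr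
      _ = |r| := by rw [← abs_mul, h2]
      _ ≤ R := h3
  set E0 := C / Λ with hE0
  have p0 : 0 ≤ E0 := by positivity
  set E1 := (C + E0 * C) / Λ with hE1
  have p1 : 0 ≤ E1 := by positivity
  set E2 := (C + 2 * E1 * C + E0 * C) / Λ with hE2
  have p2 : 0 ≤ E2 := by positivity
  refine ⟨E0 + E1 + E2, by positivity, fun x t => ?_⟩
  have b0 : |q x t| ≤ E0 := key _ _ _ _ (hl x t) (he x t) (hb0 x t)
  have b1 : |qt x t| ≤ E1 := by
    refine key _ _ (bt x t - q x t * at' x t) _ (hl x t) (by linarith [i1 x t]) ?_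
    refine (abs_sub _ _).trans (add_le_add (hb1 x t) ?_)
    rw [abs_mul]; exact mul_le_mul b0 (hat1 x t) (abs_nonneg _) p0
  have b2 : |qtt x t| ≤ E2 := by
    refine key _ _ (btt x t - (2 * qt x t) * at' x t - q x t * att x t) _ (hl x t)
      (by linarith [i2 x t]) ?_
    refine (abs_sub _ _).trans (add_le_add ((abs_sub _ _).trans (add_le_add (hb2 x t) ?_)) ?_)
    · rw [abs_mul, abs_mul, abs_two]
      exact mul_le_mul (by linarith) (hat1 x t) (abs_nonneg _) (by positivity)
    · rw [abs_mul]; exact mul_le_mul b0 (hatt x t) (abs_nonneg _) p0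
  exact ⟨by linarith, by linarith, by linarith⟩

/-- Everything that is needed about the coefficients. -/
structure Coef {n : ℕ} (a : ℝ → ℝ → Fin n → ℝ) (b : ℝ → ℝ → Fin n → Fin n → ℝ)
    (c ct ctt cx cxt : Fin n → ℝ → ℝ → ℝ) (e et ett ex ext : Fin n → Fin n → ℝ → ℝ → ℝ)
    (mm mt mtt mx mxt : Fin n → Fin n → ℝ → ℝ → ℝ) (xin xout : Fin n → ℝ) (κ B L E : ℝ) :
    Prop where
  hc : ∀ j, C2 (c j) (ct j) (ctt j) (cx j) (cxt j)
  he : ∀ j k, C2 (e j k) (et j k) (ett j k) (ex j k) (ext j k)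
  hm : ∀ j k, C2 (mm j k) (mt j k) (mtt j k) (mx j k) (mxt j k)
  sys : SysH c ct xin xout κ B L
  bctt : ∀ j x t, |ctt j x t| ≤ E
  be : ∀ j k x t, |e j k x t| ≤ E
  bet : ∀ j k x t, |et j k x t| ≤ E
  bett : ∀ j k x t, |ett j k x t| ≤ E
  mdiag : ∀ j x t, mm j j x t = 0
  moff : ∀ j k x t, j ≠ k → mm j k x t * (c j x t - c k x t) = - e j k x t
  ac : ∀ j, ∀ x ∈ Icc (0:ℝ) 1, ∀ t, a x t j * c j x t = 1
  ae : ∀ j k, ∀ x ∈ Icc (0:ℝ) 1, ∀ t, a x t j * e j k x t = - b x t j k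

theorem coef_exists {n m : ℕ} (hn : 1 ≤ n) {a : ℝ → ℝ → Fin n → ℝ}
    {b : ℝ → ℝ → Fin n → Fin n → ℝ} (hab : ∃ C : ℝ, ∀ j : Fin n, BCle 2 (fun x t => a x t j) C ∧
      ∀ k : Fin n, BCle 2 (fun x t => b x t j k) C)
    (Λ₀ : ℝ) (hΛ₀ : 0 < Λ₀) (hLam : LamCond n m Λ₀ a) :
    ∃ c ct ctt cx cxt e et ett ex ext mm mt mtt mx mxt κ B L E,
      Coef a b c ct ctt cx cxt e et ett ex ext mm mt mtt mx mxt
        (fun j : Fin n => if (j : ℕ) < m then 0 else 1)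
        (fun j : Fin n => if (j : ℕ) < m then 1 else 0) κ B L E := by
  obtain ⟨C, hC⟩ := hab
  have hal : ∀ j, ∀ x ∈ Icc (0:ℝ) 1, ∀ t, Λ₀ ≤ |a x t j| := by
    intro j x hx t
    obtain ⟨h1, h2⟩ := (hLam x hx t).1 j
    rcases lt_or_ge (j : ℕ) m with h | h
    · exact (h1 h).trans (le_abs_self _)
    · have := h2 h
      exact (by linarith : Λ₀ ≤ - a x t j).trans (neg_le_abs _)
  have hane : ∀ j, ∀ x ∈ Icc (0:ℝ) 1, ∀ t, a x t j ≠ 0 := fun j x hx t h => by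
    have := hal j x hx t
    rw [h, abs_zero] at this; linarith
  have hdne : ∀ j k, j ≠ k → ∀ x ∈ Icc (0:ℝ) 1, ∀ t, a x t j - a x t k ≠ 0 :=
    fun j k hjk x hx t h => by
      have := (hLam x hx t).2 j k hjk
      rw [h, abs_zero] at this; linarith
  have sa := fun j => (hC j).1.1
  have sb := fun j k => ((hC j).2 k).1
  have sc : ∀ j, ContDiffOn ℝ 2 (fun q : ℝ × ℝ => (a q.1 q.2 j)⁻¹) strip := fun j =>
    (sa j).inv fun q hq => hane j _ hq.1 _
  have se : ∀ j k, ContDiffOn ℝ 2 (fun q : ℝ × ℝ => - (b q.1 q.2 j k / a q.1 q.2 j)) strip :=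
    fun j k => ((sb j k).div (sa j) fun q hq => hane j _ hq.1 _).neg
  have sm : ∀ j k, ContDiffOn ℝ 2 (fun q : ℝ × ℝ => if j = k then 0 else
      - (b q.1 q.2 j k * a q.1 q.2 k / (a q.1 q.2 j - a q.1 q.2 k))) strip := by
    intro j k
    by_cases h : j = k
    · simp only [h, if_true]; exact contDiffOn_const
    · simp only [h, if_false]
      exact (((sb j k).mul (sa k)).div ((sa j).sub (sa k)) fun q hq => hdne j k h _ hq.1 _).neg
  choose at' att ax axt hA hAb using fun j => coefA (H := fun x t => a x t j) (sa j)
  choose bt btt bx bxt hB hBb using fun j k => coefA (H := fun x t => b x t j k) (sb j k)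
  choose ct ctt cx cxt hc _ using fun j => coefA (H := fun x t => (a x t j)⁻¹) (sc j)
  choose et ett ex ext he _ using fun j k => coefA (H := fun x t => - (b x t j k / a x t j)) (se j k)
  choose mt mtt mx mxt hm _ using fun j k => coefA (H := fun x t => if j = k then 0 else
      - (b x t j k * a x t k / (a x t j - a x t k))) (sm j k)
  have bA := fun j => hAb j C (hC j).1.2
  have bB := fun j k => hBb j k C ((hC j).2 k).2
  have hC0 : 0 ≤ C := (abs_nonneg _).trans (bA ⟨0, hn⟩ 0 0).1
  have hCp : 0 < C := by
    have := hal ⟨0, hn⟩ (pj 0) (pj_mem 0) 0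
    exact (hΛ₀.trans_le this).trans_le (bA ⟨0, hn⟩ 0 0).1
  have q1 : ∀ j, ∃ E, 0 ≤ E ∧ ∀ x t, |(a (pj x) t j)⁻¹| ≤ E ∧ |ct j x t| ≤ E ∧ |ctt j x t| ≤ E := by
    intro j
    have t1 : TD (fun _ _ => (1:ℝ)) (fun _ _ => 0) :=
      ⟨continuous_const, continuous_const, fun _ t => hasDerivAt_const t 1⟩
    exact quot_bd (hc j).td (hc j).tdt (hA j).td (hA j).tdt t1 TD.zero
      (fun x t => inv_mul_cancel₀ (hane j _ (pj_mem x) t)) hΛ₀ (C := max C 1) (by positivity)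
      (fun x t => hal j _ (pj_mem x) t) (fun x t => (bA j x t).2.1.trans (le_max_left _ _))
      (fun x t => (bA j x t).2.2.trans (le_max_left _ _)) (by simp) (by simp) (by simp)
  have q2 : ∀ j k, ∃ E, 0 ≤ E ∧ ∀ x t, |-(b (pj x) t j k / a (pj x) t j)| ≤ E ∧ |et j k x t| ≤ E ∧
      |ett j k x t| ≤ E := by
    intro j k
    refine quot_bd (he j k).td (he j k).tdt (hA j).td (hA j).tdt (hB j k).td.neg (hB j k).tdt.neg
      (fun x t => ?_) hΛ₀ hC0
      (fun x t => hal j _ (pj_mem x) t) (fun x t => (bA j x t).2.1)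
      (fun x t => (bA j x t).2.2) (fun x t => ?_) (fun x t => ?_) (fun x t => ?_)
    · have := hane j _ (pj_mem x) t
      field_simp
    · rw [abs_neg]; exact (bB j k x t).1
    · rw [abs_neg]; exact (bB j k x t).2.1
    · rw [abs_neg]; exact (bB j k x t).2.2
  choose E1 hE1 hE1b using q1
  choose E2 hE2 hE2b using q2
  set E := (∑ j, E1 j) + ∑ j, ∑ k, E2 j k with hE
  have le1 : ∀ j, E1 j ≤ E := fun j => by
    have h1 := Finset.single_le_sum (f := E1) (fun j _ => hE1 j) (Finset.mem_univ j)
    have h2 : 0 ≤ ∑ j, ∑ k, E2 j k := Finset.sum_nonneg fun j _ => Finset.sum_nonneg fun k _ => hE2 j k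
    linarith
  have le2 : ∀ j k, E2 j k ≤ E := fun j k => by
    have h1 := Finset.single_le_sum (f := E2 j) (fun k _ => hE2 j k) (Finset.mem_univ k)
    have h2 := Finset.single_le_sum (f := fun j => ∑ k, E2 j k)
      (fun j _ => Finset.sum_nonneg fun k _ => hE2 j k) (Finset.mem_univ j)
    have h3 : 0 ≤ ∑ j, E1 j := Finset.sum_nonneg fun j _ => hE1 j
    linarith
  refine ⟨_, ct, ctt, cx, cxt, _, et, ett, ex, ext, _, mt, mtt, mx, mxt, 1 / C, E, E, E,
    ⟨hc, he, hm, ⟨fun j => ⟨(hc j).td, fun x t => ((hE1b j x t).1).trans (le1 j),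
      fun x t => ((hE1b j x t).2.1).trans (le1 j)⟩, fun j => ?_, by positivity, fun j => ?_,
      (hE1 ⟨0, hn⟩).trans (le1 _)⟩, fun j x t => ((hE1b j x t).2.2).trans (le1 j),
      fun j k x t => ((hE2b j k x t).1).trans (le2 j k),
      fun j k x t => ((hE2b j k x t).2.1).trans (le2 j k),
      fun j k x t => ((hE2b j k x t).2.2).trans (le2 j k), ?_, ?_, ?_, ?_⟩⟩
  · rcases lt_or_ge (j : ℕ) m with h | h
    · left
      refine ⟨by simp [h], fun x t => ?_⟩
      have h1 := ((hLam _ (pj_mem x) t).1 j).1 h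
      have h2 := (le_abs_self _).trans (bA j x t).1
      rw [one_div]
      exact inv_anti₀ (by linarith) h2
    · right
      refine ⟨by simp [h], fun x t => ?_⟩
      have h1 := ((hLam _ (pj_mem x) t).1 j).2 h
      have h2 := (neg_le_abs _).trans (bA j x t).1
      rw [one_div, le_neg, ← inv_neg]
      exact inv_anti₀ (by linarith) h2
  · split_ifs <;> norm_num
  · intro j x t; simp
  · intro j k x t hjk
    have h1 := hane j _ (pj_mem x) t
    have h2 := hane k _ (pj_mem x) t
    have h3 := hdne j k hjk _ (pj_mem x) t
    simp only [hjk, if_false]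
    field_simp
    ring
  · intro j x hx t
    simp only [pj_eq hx]
    exact mul_inv_cancel₀ (hane j x hx t)
  · intro j k x hx t
    simp only [pj_eq hx]
    have := hane j x hx t
    field_simp

end HS

namespace HS

/-- Normal form: the modified time derivative solves an equation with diagonal principal part. -/
theorem normal_form {n : ℕ} {a : ℝ → ℝ → Fin n → ℝ} {b : ℝ → ℝ → Fin n → Fin n → ℝ}
    {c ct ctt cx cxt : Fin n → ℝ → ℝ → ℝ} {e et ett ex ext : Fin n → Fin n → ℝ → ℝ → ℝ}
    {mm mt mtt mx mxt : Fin n → Fin n → ℝ → ℝ → ℝ} {xin xout : Fin n → ℝ} {κ B L E : ℝ}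
    (hco : Coef a b c ct ctt cx cxt e et ett ex ext mm mt mtt mx mxt xin xout κ B L E) :
    ∃ γ γt : Fin n → ℝ → ℝ → ℝ, ∃ F Ft : Fin n → Fin n → ℝ → ℝ → ℝ,
      (∀ j, TD (γ j) (γt j)) ∧ (∀ j k, TD (F j k) (Ft j k)) ∧
      ∀ u w y h ht htt : Fin n → ℝ → ℝ → ℝ, (∀ j, TD (u j) (w j)) → (∀ j, TD (w j) (y j)) →
        (∀ j, TD (h j) (ht j)) → (∀ j, TD (ht j) (htt j)) →
        (∀ j, Along (c j) (u j) (fun x t => ∑ k, e j k x t * u k x t + h j x t)) →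
        ∀ j, TD (fun x t => w j x t + ∑ k, mm j k x t * u k x t)
            (fun x t => y j x t + ∑ k, (mt j k x t * u k x t + mm j k x t * w k x t)) ∧
          Along (c j) (fun x t => w j x t + ∑ k, mm j k x t * u k x t)
            (fun x t => γ j x t * (w j x t + ∑ k, mm j k x t * u k x t) +
              (∑ k, F j k x t * u k x t + (ht j x t + ∑ k, mm j k x t * h k x t))) ∧
          Along (c j) (fun x t => y j x t + ∑ k, (mt j k x t * u k x t + mm j k x t * w k x t))
            (fun x t => (γ j x t - ct j x t) *
                (y j x t + ∑ k, (mt j k x t * u k x t + mm j k x t * w k x t)) +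
              (γt j x t * (w j x t + ∑ k, mm j k x t * u k x t) +
              (∑ k, (Ft j k x t * u k x t + F j k x t * w k x t) +
              (htt j x t + ∑ k, (mt j k x t * h k x t + mm j k x t * ht k x t))))) := by
  have hγ : ∀ j, TD (fun x t => e j j x t - ct j x t) (fun x t => et j j x t - ctt j x t) :=
    fun j => (hco.he j j).td.sub (hco.hc j).tdt
  have hF : ∀ j k, ∃ Ft, TD (fun x t => et j k x t + (mx j k x t + c j x t * mt j k x t)
      - (e j j x t - ct j x t) * mm j k x t + ∑ l, mm j l x t * e l k x t) Ft := fun j k =>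
    ⟨_, (((hco.he j k).tdt.add ((hco.hm j k).tdx.add ((hco.hc j).td.mul (hco.hm j k).tdt))).sub
      ((hγ j).mul (hco.hm j k).td)).add
      (TD.sum (s := Finset.univ) fun l _ => (hco.hm j l).td.mul (hco.he l k).td)⟩
  choose Ft hFt using hF
  refine ⟨_, _, _, Ft, hγ, hFt, ?_⟩
  intro u w y h ht htt hu hw hh hht ha j
  have hz : TD (fun x t => w j x t + ∑ k, mm j k x t * u k x t)
      (fun x t => y j x t + ∑ k, (mt j k x t * u k x t + mm j k x t * w k x t)) :=
    (hw j).add (TD.sum fun k _ => (hco.hm j k).td.mul (hu k))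
  have hza : Along (c j) (fun x t => w j x t + ∑ k, mm j k x t * u k x t)
            (fun x t => (e j j x t - ct j x t) * (w j x t + ∑ k, mm j k x t * u k x t) +
              (∑ k, (et j k x t + (mx j k x t + c j x t * mt j k x t)
      - (e j j x t - ct j x t) * mm j k x t + ∑ l, mm j l x t * e l k x t) * u k x t +
        (ht j x t + ∑ k, mm j k x t * h k x t))) := by
    have hw1 := Along.dt (hco.sys.spd j) (hu j)
      ((TD.sum fun k _ => (hco.he j k).td.mul (hu k)).add (hh j)) (ha j)
    have hm1 : ∀ k, Along (c j) (mm j k) (fun x t => mx j k x t + c j x t * mt j k x t) :=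
      fun k S hS ξ hξ => (hco.hm j k).chain S _ ξ hξ (hS.2 ξ hξ)
    have hu1 := fun k => (ha k).change (c' := c j) (hco.sys.spd k) (hu k)
    refine (hw1.add (Along.sum fun k _ => (hm1 k).mul (hu1 k))).congr ?_
    intro x _ t
    have key : ∑ k, e j k x t * w k x t + ∑ k, mm j k x t * ((c j x t - c k x t) * w k x t)
        = e j j x t * w j x t := by
      rw [← Finset.sum_add_distrib, Finset.sum_eq_single j]
      · rw [hco.mdiag]; ring
      · intro k _ hk
        have := hco.moff j k x t (Ne.symm hk)
        calc _ = (e j k x t + mm j k x t * (c j x t - c k x t)) * w k x t := by ring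
          _ = 0 := by rw [this]; ring
      · intro h; exact absurd (Finset.mem_univ j) h
    have key2 : ∑ k, mm j k x t * ∑ l, e k l x t * u l x t =
        ∑ k, (∑ l, mm j l x t * e l k x t) * u k x t := by
      simp only [Finset.mul_sum, Finset.sum_mul]
      rw [Finset.sum_comm]
      refine Finset.sum_congr rfl fun k _ => Finset.sum_congr rfl fun l _ => by ring
    have key3 : ∑ k, ((e j j x t - ct j x t) * mm j k x t) * u k x t =
        (e j j x t - ct j x t) * ∑ k, mm j k x t * u k x t := by
      rw [Finset.mul_sum]; refine Finset.sum_congr rfl fun k _ => by ring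
    simp only [add_mul _ _ (u _ x t), sub_mul _ _ (u _ x t), mul_add (mm j _ x t),
      Finset.sum_add_distrib, Finset.sum_sub_distrib]
    rw [key2, key3]
    linear_combination key
  refine ⟨hz, hza, ?_⟩
  refine (Along.dt (hco.sys.spd j) hz (((hγ j).mul hz).add
    ((TD.sum fun k _ => (hFt j k).mul (hu k)).add
      ((hht j).add (TD.sum fun k _ => (hco.hm j k).td.mul (hh k))))) hza).congr ?_
  intro x _ t
  ring

end HS

namespace HS

/-- Abstract properties shared by the sup bound and the `L²` bound on time intervals. -/
structure BdAx (Bd : (ℝ → ℝ) → ℝ → ℝ → ℝ → Prop) : Prop where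
  mono : ∀ {f α β α' β' M M'}, α ≤ α' → α' ≤ β' → β' ≤ β → M ≤ M' → Bd f α β M → Bd f α' β' M'
  zero : ∀ {α β}, α ≤ β → Bd (fun _ => 0) α β 0
  add : ∀ {f g α β M N}, α ≤ β → Bd f α β M → Bd g α β N →
    Bd (fun t => f t + g t) α β (2 * M + 2 * N)
  mulc : ∀ {a f α β M A}, α ≤ β → Continuous a → (∀ t ∈ Icc α β, |a t| ≤ A) → Bd f α β M →
    Bd (fun t => a t * f t) α β (A ^ 2 * M)
  congr : ∀ {f g α β M}, α ≤ β → Continuous g → (∀ t ∈ Icc α β, g t = f t) → Bd f α β M →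
    Bd g α β M
  ml : ∀ {c ct γ : ℝ → ℝ → ℝ} {B L α β x0 : ℝ}, Speed c ct B L →
    Continuous (fun q : ℝ × ℝ => γ q.1 q.2) → x0 ∈ Icc (0:ℝ) 1 → α + B ≤ β - B →
    ∃ K, 0 ≤ K ∧ ∀ (v g : ℝ → ℝ → ℝ) (M : ℝ), Continuous (fun q : ℝ × ℝ => v q.1 q.2) →
      Continuous (fun q : ℝ × ℝ => g q.1 q.2) → Along c v (fun x t => γ x t * v x t + g x t) →
      Bd (v x0) α β M → (∀ x ∈ Icc (0:ℝ) 1, Bd (g x) α β M) →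
      ∀ x ∈ Icc (0:ℝ) 1, Bd (v x) (α + B) (β - B) (K * M)

def supBd (f : ℝ → ℝ) (α β M : ℝ) : Prop := Continuous f ∧ ∀ t ∈ Icc α β, f t ^ 2 ≤ M

def l2Bd (f : ℝ → ℝ) (α β M : ℝ) : Prop := Continuous f ∧ ∫ t in α..β, f t ^ 2 ≤ M

lemma cpt_bd {γ : ℝ → ℝ → ℝ} (h : Continuous (fun q : ℝ × ℝ => γ q.1 q.2)) (α β : ℝ) :
    ∃ G, 0 ≤ G ∧ ∀ x ∈ Icc (0:ℝ) 1, ∀ t ∈ Icc α β, |γ x t| ≤ G := by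
  obtain ⟨G, hG⟩ := (isCompact_Icc.prod isCompact_Icc :
    IsCompact (Icc (0:ℝ) 1 ×ˢ Icc α β)).exists_bound_of_continuousOn h.continuousOn
  exact ⟨max G 0, le_max_right _ _, fun x hx t ht => (hG (x, t) ⟨hx, ht⟩).trans (le_max_left _ _)⟩

lemma slice_cont {v : ℝ → ℝ → ℝ} (h : Continuous (fun q : ℝ × ℝ => v q.1 q.2)) (x : ℝ) :
    Continuous (v x) := cont2 h continuous_const continuous_id

lemma supBd_ax : BdAx supBd where
  mono h1 _ h3 h4 h := ⟨h.1, fun t ht => (h.2 t ⟨h1.trans ht.1, ht.2.trans h3⟩).trans h4⟩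
  zero _ := ⟨continuous_const, fun t _ => by simp⟩
  add {f g} _ _ _ _ _ hf hg := ⟨hf.1.add hg.1, fun t ht => by
    simp only
    nlinarith [hf.2 t ht, hg.2 t ht, sq_nonneg (f t - g t)]⟩
  mulc _ ha hA hf := ⟨ha.mul hf.1, fun t ht => by
    rw [mul_pow]
    have h1 := hA t ht
    have h2 := hf.2 t ht
    have h3 : _ ^ 2 ≤ _ ^ 2 := sq_le_sq' (neg_le_of_abs_le h1) (le_of_abs_le h1)
    exact mul_le_mul h3 h2 (sq_nonneg _) (sq_nonneg _)⟩
  congr _ hg he hf := ⟨hg, fun t ht => by rw [he t ht]; exact hf.2 t ht⟩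
  ml := by
    intro c ct γ B L α β x0 hc hγ hx0 hab
    obtain ⟨G, hG0, hG⟩ := cpt_bd hγ α β
    refine ⟨Real.exp (2 * G + 1) * 2, by positivity, fun v g M hv hg ha h1 h2 x hx => ⟨slice_cont hv x, ?_⟩⟩
    exact ml_sup hc ha hv hg hG0 hG hx0 h1.2 (fun ξ hξ => (h2 ξ hξ).2) x hx

lemma l2Bd_ax : BdAx l2Bd where
  mono := by
    intro f α β α' β' M M' h1 h2 h3 h4 h
    refine ⟨h.1, (le_trans ?_ h.2).trans h4⟩
    have hc : Continuous fun t => f t ^ 2 := h.1.pow 2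
    exact intervalIntegral.integral_mono_interval h1 h2 h3
      (Eventually.of_forall fun t => sq_nonneg _) (hc.intervalIntegrable _ _)
  zero _ := ⟨continuous_const, by simp⟩
  add := by
    intro f g α β M N hab hf hg
    refine ⟨hf.1.add hg.1, ?_⟩
    have c1 : Continuous fun t => f t ^ 2 := hf.1.pow 2
    have c2 : Continuous fun t => g t ^ 2 := hg.1.pow 2
    have c3 : Continuous fun t => (f t + g t) ^ 2 := (hf.1.add hg.1).pow 2
    calc ∫ t in α..β, (f t + g t) ^ 2 ≤ ∫ t in α..β, (2 * f t ^ 2 + 2 * g t ^ 2) := by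
          refine intervalIntegral.integral_mono_on hab (c3.intervalIntegrable _ _)
            (((continuous_const.mul c1).add (continuous_const.mul c2)).intervalIntegrable _ _) ?_
          intro t _
          nlinarith [sq_nonneg (f t - g t)]
      _ = 2 * (∫ t in α..β, f t ^ 2) + 2 * ∫ t in α..β, g t ^ 2 := by
          have d1 : Continuous fun t => 2 * f t ^ 2 := continuous_const.mul c1
          have d2 : Continuous fun t => 2 * g t ^ 2 := continuous_const.mul c2
          rw [intervalIntegral.integral_add (d1.intervalIntegrable _ _)
            (d2.intervalIntegrable _ _), intervalIntegral.integral_const_mul, intervalIntegral.integral_const_mul]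
      _ ≤ _ := by linarith [hf.2, hg.2]
  mulc := by
    intro a f α β M A hab ha hA hf
    refine ⟨ha.mul hf.1, ?_⟩
    have c1 : Continuous fun t => f t ^ 2 := hf.1.pow 2
    have c3 : Continuous fun t => (a t * f t) ^ 2 := (ha.mul hf.1).pow 2
    calc ∫ t in α..β, (a t * f t) ^ 2 ≤ ∫ t in α..β, A ^ 2 * f t ^ 2 := by
          refine intervalIntegral.integral_mono_on hab (c3.intervalIntegrable _ _)
            ((continuous_const.mul c1).intervalIntegrable _ _) ?_
          intro t ht
          have h1 := hA t ht
          have h3 : a t ^ 2 ≤ A ^ 2 := sq_le_sq' (neg_le_of_abs_le h1) (le_of_abs_le h1)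
          rw [mul_pow]
          exact mul_le_mul_of_nonneg_right h3 (sq_nonneg _)
      _ = A ^ 2 * ∫ t in α..β, f t ^ 2 := by rw [intervalIntegral.integral_const_mul]
      _ ≤ _ := mul_le_mul_of_nonneg_left hf.2 (sq_nonneg _)
  congr := by
    intro f g α β M hab hg he hf
    refine ⟨hg, le_trans (le_of_eq ?_) hf.2⟩
    refine intervalIntegral.integral_congr fun t ht => ?_
    rw [uIcc_of_le hab] at ht
    simp only [he t ht]
  ml := by
    intro c ct γ B L α β x0 hc hγ hx0 hab
    obtain ⟨G, hG0, hG⟩ := cpt_bd hγ α β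
    have hB : 0 ≤ B := (abs_nonneg _).trans (hc.bd 0 0)
    refine ⟨Real.exp (2 * G + 1) * Real.exp L * 2, by positivity, fun v g M hv hg ha h1 h2 x hx =>
      ⟨slice_cont hv x, ?_⟩⟩
    refine (ml_L2 hc ha hv hg hG0 hG hx0 hab x hx).trans ?_
    rw [mul_assoc (_ * _) 2 M]
    refine mul_le_mul_of_nonneg_left ?_ (by positivity)
    have h3 : ∫ ξ in (0:ℝ)..1, ∫ t in α..β, g ξ t ^ 2 ≤ ∫ ξ in (0:ℝ)..1, M := by
      refine intervalIntegral.integral_mono_on zero_le_one ?_ (by simp)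
        (fun ξ hξ => (h2 ξ hξ).2)
      refine Continuous.intervalIntegrable ?_ _ _
      exact intervalIntegral.continuous_parametric_intervalIntegral_of_continuous' (hg.pow 2) _ _
    have h4 := h1.2
    simp at h3
    linarith

/-- Slicewise bounds, linear in the size functional `J`, uniformly in a family. -/
def SB (Bd : (ℝ → ℝ) → ℝ → ℝ → ℝ → Prop) {ι : Type*} (J : ι → ℝ) (f : ι → ℝ → ℝ → ℝ)
    (α β : ℝ) : Prop :=
  ∃ C, 0 ≤ C ∧ ∀ σ, ∀ x ∈ Icc (0:ℝ) 1, Bd (f σ x) α β (C * J σ)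

section
variable {Bd : (ℝ → ℝ) → ℝ → ℝ → ℝ → Prop} {ι : Type*} {J : ι → ℝ} {f g : ι → ℝ → ℝ → ℝ} {α β : ℝ}

lemma SB.mono (hb : BdAx Bd) (h : SB Bd J f α β) {α' β' : ℝ} (h1 : α ≤ α')
    (h2 : α' ≤ β') (h3 : β' ≤ β) : SB Bd J f α' β' := by
  obtain ⟨C, hC, H⟩ := h
  exact ⟨C, hC, fun σ x hx => hb.mono h1 h2 h3 le_rfl (H σ x hx)⟩

lemma SB.add (hb : BdAx Bd) (hab : α ≤ β) (hf : SB Bd J f α β) (hg : SB Bd J g α β) :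
    SB Bd J (fun σ x t => f σ x t + g σ x t) α β := by
  obtain ⟨C, hC, H⟩ := hf
  obtain ⟨C', hC', H'⟩ := hg
  refine ⟨2 * C + 2 * C', by positivity, fun σ x hx => ?_⟩
  have := hb.add hab (H σ x hx) (H' σ x hx)
  rwa [show (2 * C + 2 * C') * J σ = 2 * (C * J σ) + 2 * (C' * J σ) by ring]

lemma SB.mulc (hb : BdAx Bd) (hab : α ≤ β) (hf : SB Bd J f α β) {a : ℝ → ℝ → ℝ}
    (ha : Continuous (fun q : ℝ × ℝ => a q.1 q.2)) :
    SB Bd J (fun σ x t => a x t * f σ x t) α β := by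
  obtain ⟨C, hC, H⟩ := hf
  obtain ⟨G, hG0, hG⟩ := cpt_bd ha α β
  refine ⟨G ^ 2 * C, by positivity, fun σ x hx => ?_⟩
  rw [mul_assoc]
  exact hb.mulc hab (slice_cont ha x) (hG x hx) (H σ x hx)

lemma SB.constmul (hb : BdAx Bd) (hab : α ≤ β) (hf : SB Bd J f α β) (a : ℝ) :
    SB Bd J (fun σ x t => a * f σ x t) α β :=
  hf.mulc hb hab (a := fun _ _ => a) continuous_const

lemma SB.sub (hb : BdAx Bd) (hab : α ≤ β) (hf : SB Bd J f α β) (hg : SB Bd J g α β) :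
    SB Bd J (fun σ x t => f σ x t - g σ x t) α β := by
  have := hf.add hb hab (hg.constmul hb hab (-1))
  simpa [sub_eq_add_neg] using this

lemma SB.zero (hb : BdAx Bd) (hab : α ≤ β) : SB Bd J (fun _ _ _ => 0) α β :=
  ⟨0, le_rfl, fun σ x _ => by rw [zero_mul]; exact hb.zero hab⟩

lemma SB.sum (hb : BdAx Bd) (hab : α ≤ β) {κ : Type*} (s : Finset κ) {F : κ → ι → ℝ → ℝ → ℝ}
    (hF : ∀ k ∈ s, SB Bd J (F k) α β) : SB Bd J (fun σ x t => ∑ k ∈ s, F k σ x t) α β := by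
  classical
  induction s using Finset.induction_on with
  | empty => simpa using SB.zero hb hab
  | insert a s ha ih =>
    simp only [Finset.sum_insert ha]
    exact (hF a (Finset.mem_insert_self _ _)).add hb hab
      (ih fun k hk => hF k (Finset.mem_insert_of_mem hk))

lemma SB.trace (h : SB Bd J f α β) {x0 : ℝ} (hx0 : x0 ∈ Icc (0:ℝ) 1) :
    SB Bd J (fun σ _ t => f σ x0 t) α β := by
  obtain ⟨C, hC, H⟩ := h
  exact ⟨C, hC, fun σ x hx => H σ x0 hx0⟩

lemma SB.congr (hb : BdAx Bd) (hab : α ≤ β) (h : SB Bd J f α β)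
    (hg : ∀ σ x, x ∈ Icc (0:ℝ) 1 → Continuous (g σ x))
    (he : ∀ σ, ∀ x ∈ Icc (0:ℝ) 1, ∀ t ∈ Icc α β, g σ x t = f σ x t) : SB Bd J g α β := by
  obtain ⟨C, hC, H⟩ := h
  exact ⟨C, hC, fun σ x hx => hb.congr hab (hg σ x hx) (he σ x hx) (H σ x hx)⟩

lemma SB.ml (hb : BdAx Bd) (hJ : ∀ σ, 0 ≤ J σ) {c ct γ : ℝ → ℝ → ℝ} {B L x0 : ℝ}
    (hc : Speed c ct B L)
    (hγ : Continuous (fun q : ℝ × ℝ => γ q.1 q.2)) (hx0 : x0 ∈ Icc (0:ℝ) 1) (hab : α + B ≤ β - B)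
    {v : ι → ℝ → ℝ → ℝ} (hv : ∀ σ, Continuous (fun q : ℝ × ℝ => v σ q.1 q.2))
    (hgc : ∀ σ, Continuous (fun q : ℝ × ℝ => g σ q.1 q.2))
    (ha : ∀ σ, Along c (v σ) (fun x t => γ x t * v σ x t + g σ x t))
    (h0 : SB Bd J (fun σ _ t => v σ x0 t) α β) (hg : SB Bd J g α β) :
    SB Bd J v (α + B) (β - B) := by
  have hB : 0 ≤ B := (abs_nonneg _).trans (hc.bd 0 0)
  have hab' : α ≤ β := by linarith
  obtain ⟨K, hK, H⟩ := hb.ml hc hγ hx0 hab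
  obtain ⟨C, hC, H1⟩ := h0
  obtain ⟨C', hC', H2⟩ := hg
  refine ⟨K * (C + C'), by positivity, fun σ x hx => ?_⟩
  have := H (v σ) (g σ) ((C + C') * J σ) (hv σ) (hgc σ) (ha σ)
    (hb.mono le_rfl hab' le_rfl (by nlinarith [hJ σ]) (H1 σ x0 hx0))
    (fun x hx => hb.mono le_rfl hab' le_rfl (by nlinarith [hJ σ]) (H2 σ x hx)) x hx
  rwa [mul_assoc]

end

/-- There is a chain of `l` nonzero reflection coefficients starting at `j`. -/
def Long {n : ℕ} (p : Fin n → Fin n → ℝ) : ℕ → Fin n → Prop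
  | 0, _ => True
  | l + 1, j => ∃ k, p j k ≠ 0 ∧ Long p l k

lemma long_chain {n : ℕ} (p : Fin n → Fin n → ℝ) : ∀ l j, Long p l j →
    ∃ i : ℕ → Fin n, i 0 = j ∧ ∀ r < l, p (i r) (i (r + 1)) ≠ 0 := by
  intro l
  induction l with
  | zero => intro j _; exact ⟨fun _ => j, rfl, fun r hr => absurd hr (Nat.not_lt_zero r)⟩
  | succ l ih =>
    rintro j ⟨k, hk, hl⟩
    obtain ⟨i, hi0, hi⟩ := ih k hl
    refine ⟨fun r => Nat.casesOn r j i, rfl, fun r hr => ?_⟩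
    cases r with
    | zero => simpa [hi0] using hk
    | succ r => exact hi r (Nat.lt_of_succ_lt_succ hr)

lemma not_long {n : ℕ} {p : Fin n → Fin n → ℝ} (h : H3cond n p) (j : Fin n) : ¬ Long p n j := by
  intro hl
  obtain ⟨i, -, hi⟩ := long_chain p n j hl
  have := h (fun r => i r)
  rw [Finset.prod_eq_zero_iff] at this
  obtain ⟨r, -, hr⟩ := this
  exact hi r r.2 (by simpa using hr)

theorem nil_lemma {Bd : (ℝ → ℝ) → ℝ → ℝ → ℝ → Prop} {ι : Type*} {J : ι → ℝ} {α β : ℝ}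
    (hb : BdAx Bd) (hJ : ∀ σ, 0 ≤ J σ) {n : ℕ} {p : Fin n → Fin n → ℝ} (h3 : H3cond n p)
    {c ct γ : Fin n → ℝ → ℝ → ℝ} {xin xout : Fin n → ℝ} {κ B L : ℝ}
    (hs : SysH c ct xin xout κ B L) (hγ : ∀ j, Continuous (fun q : ℝ × ℝ => γ j q.1 q.2))
    (hB : 0 ≤ B) (hab : α + n * B ≤ β - n * B)
    {z g : Fin n → ι → ℝ → ℝ → ℝ} {b : Fin n → ι → ℝ → ℝ}
    (hz : ∀ j σ, Continuous (fun q : ℝ × ℝ => z j σ q.1 q.2))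
    (hgc : ∀ j σ, Continuous (fun q : ℝ × ℝ => g j σ q.1 q.2))
    (ha : ∀ j σ, Along (c j) (z j σ) (fun x t => γ j x t * z j σ x t + g j σ x t))
    (hbc : ∀ j σ t, z j σ (xin j) t = ∑ k, p j k * z k σ (xout k) t + b j σ t)
    (hg : ∀ j, SB Bd J (g j) α β) (hbb : ∀ j, SB Bd J (fun σ _ t => b j σ t) α β) :
    ∀ j, SB Bd J (z j) (α + n * B) (β - n * B) := by
  have key : ∀ l : ℕ, l ≤ n → ∀ j, ¬ Long p l j → SB Bd J (z j) (α + l * B) (β - l * B) := by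
    intro l
    induction l with
    | zero => intro _ j hj; exact absurd trivial hj
    | succ l ih =>
      intro hl j hj
      have hl1 : ((l:ℝ) + 1) ≤ n := by exact_mod_cast hl
      have hl2 : ((l:ℝ) + 1) * B ≤ n * B := mul_le_mul_of_nonneg_right hl1 hB
      have hl3 : (0:ℝ) ≤ l * B := by positivity
      have hab' : α + l * B ≤ β - l * B := by linarith
      have h0 : SB Bd J (fun σ _ t => z j σ (xin j) t) (α + l * B) (β - l * B) := by
        simp only [hbc]
        refine SB.add hb hab' (SB.sum hb hab' _ fun k _ => ?_)
          ((hbb j).mono hb (by linarith) hab' (by linarith))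
        by_cases hp : p j k = 0
        · simpa [hp] using SB.zero hb hab'
        · refine SB.constmul hb hab' (SB.trace (ih (by omega) k fun hlk => hj ⟨k, hp, hlk⟩)
            (hs.xo_mem k)) _
      have := SB.ml (α := α + l * B) (β := β - l * B) hb hJ (hs.spd j) (hγ j) (hs.dir j).mem
        (by linarith) (hz j) (hgc j) (ha j) h0
        ((hg j).mono hb (by linarith) hab' (by linarith))
      rw [show α + (l + 1 : ℕ) * B = α + l * B + B by push_cast; ring,
        show β - (l + 1 : ℕ) * B = β - l * B - B by push_cast; ring]
      exact this
  exact fun j => key n le_rfl j (not_long h3 j)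

end HS

namespace HS

lemma int_abs_le' {f : ℝ → ℝ} (hf : Continuous f) (h0 : ∀ ξ, 0 ≤ f ξ) {a b α β : ℝ}
    (ha : a ∈ Icc α β) (hb : b ∈ Icc α β) :
    |∫ ξ in a..b, f ξ| ≤ ∫ ξ in α..β, f ξ := by
  rcases le_total a b with h | h
  · rw [abs_of_nonneg (intervalIntegral.integral_nonneg h fun ξ _ => h0 ξ)]
    exact intervalIntegral.integral_mono_interval ha.1 h hb.2
      (Eventually.of_forall h0) (hf.intervalIntegrable _ _)
  · rw [intervalIntegral.integral_symm, abs_neg,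
      abs_of_nonneg (intervalIntegral.integral_nonneg h fun ξ _ => h0 ξ)]
    exact intervalIntegral.integral_mono_interval hb.1 h ha.2
      (Eventually.of_forall h0) (hf.intervalIntegrable _ _)

lemma sobolev_sq {f f' : ℝ → ℝ} (hf : ∀ t, HasDerivAt f (f' t) t) (hc' : Continuous f')
    {α β t : ℝ} (hab : α < β) (ht : t ∈ Icc α β) :
    f t ^ 2 ≤ (1 / (β - α) + 1) * (∫ τ in α..β, f τ ^ 2) + ∫ τ in α..β, f' τ ^ 2 := by
  have hc : Continuous f := continuous_iff_continuousAt.2 fun t => (hf t).continuousAt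
  have c1 : Continuous fun τ => f τ ^ 2 := hc.pow 2
  have c2 : Continuous fun τ => f' τ ^ 2 := hc'.pow 2
  have c3 : Continuous fun τ => f τ ^ 2 + f' τ ^ 2 := c1.add c2
  set I := ∫ τ in α..β, (f τ ^ 2 + f' τ ^ 2) with hI
  have hIe : I = (∫ τ in α..β, f τ ^ 2) + ∫ τ in α..β, f' τ ^ 2 :=
    intervalIntegral.integral_add (c1.intervalIntegrable _ _) (c2.intervalIntegrable _ _)
  have key : ∀ τ ∈ Icc α β, f t ^ 2 - I ≤ f τ ^ 2 := by
    intro τ hτ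
    have h1 : ∫ r in τ..t, 2 * f r * f' r = f t ^ 2 - f τ ^ 2 := by
      refine intervalIntegral.integral_eq_sub_of_hasDerivAt (f := fun r => f r ^ 2) (fun r _ => ?_)
        (Continuous.intervalIntegrable (by fun_prop) _ _)
      simpa using (hf r).fun_pow 2
    have h2 : ‖∫ r in τ..t, 2 * f r * f' r‖ ≤ |∫ r in τ..t, (f r ^ 2 + f' r ^ 2)| := by
      refine intervalIntegral.norm_integral_le_abs_of_norm_le (Eventually.of_forall fun r => ?_)
        (c3.intervalIntegrable _ _)
      rw [Real.norm_eq_abs, abs_le]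
      constructor <;> nlinarith [sq_nonneg (f r - f' r), sq_nonneg (f r + f' r)]
    have h3 := int_abs_le' c3 (fun r => by positivity) hτ ht
    have h4 := (le_abs_self _).trans (h2.trans h3)
    rw [h1] at h4
    linarith
  have h5 : ∫ τ in α..β, (f t ^ 2 - I) ≤ ∫ τ in α..β, f τ ^ 2 :=
    intervalIntegral.integral_mono_on hab.le (by simp) (c1.intervalIntegrable _ _) key
  rw [intervalIntegral.integral_const, smul_eq_mul] at h5
  have hp : 0 < β - α := sub_pos.2 hab
  have h6 : f t ^ 2 - I ≤ (1 / (β - α)) * ∫ τ in α..β, f τ ^ 2 := by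
    rw [one_div, ← div_eq_inv_mul, le_div_iff₀ hp]; linarith
  rw [hIe] at h6
  linarith

lemma SB.sobolev {ι : Type*} {J : ι → ℝ} {f f' : ι → ℝ → ℝ → ℝ} {α β : ℝ} (hab : α < β)
    (ht : ∀ σ, TD (f σ) (f' σ)) (h : SB l2Bd J f α β) (h' : SB l2Bd J f' α β) :
    SB supBd J f α β := by
  obtain ⟨C, hC, H⟩ := h
  obtain ⟨C', hC', H'⟩ := h'
  have hp : 0 < β - α := sub_pos.2 hab
  refine ⟨(1 / (β - α) + 1) * C + C', by positivity, fun σ x hx => ⟨slice_cont (ht σ).cont x, ?_⟩⟩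
  intro t htt
  refine (sobolev_sq ((ht σ).der x) (slice_cont (ht σ).contt x) hab htt).trans ?_
  have h1 : (1 / (β - α) + 1) * (∫ τ in α..β, f σ x τ ^ 2) ≤ (1 / (β - α) + 1) * (C * J σ) :=
    mul_le_mul_of_nonneg_left (H σ x hx).2 (by positivity)
  have h2 := (H' σ x hx).2
  linarith

/-- A solution of the whole-line problem with source vanishing for `t ≥ s`. -/
structure Sol {n : ℕ} (c : Fin n → ℝ → ℝ → ℝ) (e : Fin n → Fin n → ℝ → ℝ → ℝ)
    (p : Fin n → Fin n → ℝ) (xin xout : Fin n → ℝ) (s : ℝ)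
    (u w y h ht htt : Fin n → ℝ → ℝ → ℝ) : Prop where
  tu : ∀ j, TD (u j) (w j)
  tw : ∀ j, TD (w j) (y j)
  th : ∀ j, TD (h j) (ht j)
  tht : ∀ j, TD (ht j) (htt j)
  along : ∀ j, Along (c j) (u j) (fun x t => ∑ k, e j k x t * u k x t + h j x t)
  bc : ∀ j t, u j (xin j) t = ∑ k, p j k * u k (xout k) t
  z0 : ∀ j x t, s ≤ t → h j x t = 0
  z1 : ∀ j x t, s ≤ t → ht j x t = 0
  z2 : ∀ j x t, s ≤ t → htt j x t = 0

lemma bc_diff {n : ℕ} {p : Fin n → Fin n → ℝ} {xin xout : Fin n → ℝ} {u w : Fin n → ℝ → ℝ → ℝ}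
    (hu : ∀ j, TD (u j) (w j)) (hbc : ∀ j t, u j (xin j) t = ∑ k, p j k * u k (xout k) t)
    (j : Fin n) (t : ℝ) : w j (xin j) t = ∑ k, p j k * w k (xout k) t := by
  have h1 := (hu j).der (xin j) t
  have h2 : HasDerivAt (fun t => ∑ k, p j k * u k (xout k) t)
    (∑ k, p j k * w k (xout k) t) t :=
    HasDerivAt.fun_sum fun k _ => ((hu k).der (xout k) t).const_mul (p j k)
  have h3 : u j (xin j) = fun t => ∑ k, p j k * u k (xout k) t := funext (hbc j)
  rw [h3] at h1
  exact h1.unique h2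

theorem apriori {n : ℕ} {a : ℝ → ℝ → Fin n → ℝ} {b : ℝ → ℝ → Fin n → Fin n → ℝ}
    {c ct ctt cx cxt : Fin n → ℝ → ℝ → ℝ} {e et ett ex ext : Fin n → Fin n → ℝ → ℝ → ℝ}
    {mm mt mtt mx mxt : Fin n → Fin n → ℝ → ℝ → ℝ} {xin xout : Fin n → ℝ} {κ B L E : ℝ}
    (hco : Coef a b c ct ctt cx cxt e et ett ex ext mm mt mtt mx mxt xin xout κ B L E)
    {p : Fin n → Fin n → ℝ} (h3 : H3cond n p) (hB : 0 ≤ B) {ι : Type*} {J : ι → ℝ} {α β : ℝ}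
    (hab : α + (3 * n + 1) * B < β - (3 * n + 1) * B)
    (hJ : ∀ σ, 0 ≤ J σ) {u w y h ht htt : Fin n → ι → ℝ → ℝ → ℝ}
    (hS : ∀ σ, Sol c e p xin xout α (fun j => u j σ) (fun j => w j σ) (fun j => y j σ)
      (fun j => h j σ) (fun j => ht j σ) (fun j => htt j σ))
    (hJu : ∀ j σ, ∫ x in (0:ℝ)..1, ∫ t in α..β, u j σ x t ^ 2 ≤ J σ) :
    (∀ j, SB supBd J (u j) (α + (3 * n + 1) * B) (β - (3 * n + 1) * B)) ∧
    (∀ j, SB supBd J (w j) (α + (3 * n + 1) * B) (β - (3 * n + 1) * B)) ∧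
    (∀ j, SB supBd J (y j) (α + (3 * n + 1) * B) (β - (3 * n + 1) * B)) := by
  obtain ⟨γ, γt, F, Ft, hγ, hF, hN⟩ := normal_form hco
  have hNn := fun σ => hN _ _ _ _ _ _ (hS σ).tu (hS σ).tw (hS σ).th (hS σ).tht (hS σ).along
  have hnB : 0 ≤ n * B := by positivity
  have hxi : ∀ j, xin j ∈ Icc (0:ℝ) 1 := fun j => (hco.sys.dir j).mem
  have hxo : ∀ j, xout j ∈ Icc (0:ℝ) 1 := fun j => hco.sys.xo_mem j
  have b2 := l2Bd_ax
  have b1 := supBd_ax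
  -- step 1
  have s1 : ∀ j, SB l2Bd J (u j) (α + B) (β - B) := by
    intro j
    have hab1 : α + B ≤ β - B := by nlinarith
    have hab0 : α ≤ β := by linarith
    refine ⟨Real.exp (2 * 0 + 1) * Real.exp L * (1 + n * E ^ 2 * n), by positivity,
      fun σ x hx => ⟨slice_cont ((hS σ).tu j).cont x, ?_⟩⟩
    have cu : ∀ k, Continuous (fun q : ℝ × ℝ => u k σ q.1 q.2) := fun k => ((hS σ).tu k).cont
    have cu2 : ∀ k, Continuous fun x => ∫ t in α..β, u k σ x t ^ 2 := fun k =>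
      intervalIntegral.continuous_parametric_intervalIntegral_of_continuous' ((cu k).pow 2) _ _
    set g := fun x t => ∑ k, e j k x t * u k σ x t + h j σ x t with hg
    have cg : Continuous (fun q : ℝ × ℝ => g q.1 q.2) :=
      (continuous_finsetSum _ fun k _ => (hco.he j k).td.cont.mul (cu k)).add ((hS σ).th j).cont
    have hA : ∀ x0 ∈ Icc (0:ℝ) 1, ∫ t in (α + B)..(β - B), u j σ x t ^ 2 ≤
        Real.exp (2 * 0 + 1) * Real.exp L *
      ((∫ t in α..β, u j σ x0 t ^ 2) + ∫ ξ in (0:ℝ)..1, ∫ t in α..β, g ξ t ^ 2) := fun x0 hx0 =>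
      ml_L2 (γ := fun _ _ => 0) (g := g) (hco.sys.spd j)
        (((hS σ).along j).congr fun x _ t => by simp [hg])
        (cu j) cg le_rfl (fun _ _ _ _ => by simp) hx0 hab1 x hx
    have cg2 : Continuous fun x => ∫ t in α..β, g x t ^ 2 :=
      intervalIntegral.continuous_parametric_intervalIntegral_of_continuous' (cg.pow 2) _ _
    have hgJ : ∫ ξ in (0:ℝ)..1, ∫ t in α..β, g ξ t ^ 2 ≤ n * E ^ 2 * n * J σ := by
      have r1 : ∀ ξ ∈ Icc (0:ℝ) 1, ∫ t in α..β, g ξ t ^ 2 ≤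
          ∑ k, n * E ^ 2 * ∫ t in α..β, u k σ ξ t ^ 2 := by
        intro ξ _
        have q1 : ∀ k, Continuous fun t => n * E ^ 2 * u k σ ξ t ^ 2 := fun k =>
          continuous_const.mul ((slice_cont (cu k) ξ).pow 2)
        have : ∑ k, n * E ^ 2 * ∫ t in α..β, u k σ ξ t ^ 2 =
            ∫ t in α..β, ∑ k, n * E ^ 2 * u k σ ξ t ^ 2 := by
          rw [intervalIntegral.integral_finsetSum fun k _ => (q1 k).intervalIntegrable _ _]
          simp only [intervalIntegral.integral_const_mul]
        rw [this]
        refine intervalIntegral.integral_mono_on hab0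
          (((slice_cont cg ξ).pow 2).intervalIntegrable _ _)
          ((continuous_finsetSum _ fun k _ => q1 k).intervalIntegrable _ _) ?_
        intro t ht'
        simp only [hg, (hS σ).z0 j ξ t ht'.1, add_zero]
        refine (sq_sum_le_card_mul_sum_sq).trans ?_
        rw [Finset.mul_sum, Finset.card_univ, Fintype.card_fin]
        refine Finset.sum_le_sum fun k _ => ?_
        rw [mul_pow, ← mul_assoc]
        have := hco.be j k ξ t
        have h3 : e j k ξ t ^ 2 ≤ E ^ 2 := sq_le_sq' (neg_le_of_abs_le this) (le_of_abs_le this)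
        gcongr
      have q2 : ∀ k, Continuous fun x => n * E ^ 2 * ∫ t in α..β, u k σ x t ^ 2 := fun k =>
        continuous_const.mul (cu2 k)
      refine (intervalIntegral.integral_mono_on zero_le_one (cg2.intervalIntegrable _ _)
        ((continuous_finsetSum _ fun k _ => q2 k).intervalIntegrable _ _) r1).trans ?_
      rw [intervalIntegral.integral_finsetSum fun k _ => (q2 k).intervalIntegrable _ _]
      simp only [intervalIntegral.integral_const_mul]
      calc ∑ k, n * E ^ 2 * ∫ x in (0:ℝ)..1, ∫ t in α..β, u k σ x t ^ 2
          ≤ ∑ _k : Fin n, n * E ^ 2 * J σ := Finset.sum_le_sum fun k _ =>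
            mul_le_mul_of_nonneg_left (hJu k σ) (by positivity)
        _ = _ := by
          rw [Finset.sum_const, Finset.card_univ, Fintype.card_fin, nsmul_eq_mul]; ring
    have hintg := intervalIntegral.integral_mono_on (a := 0) (b := 1) (μ := volume) zero_le_one
      intervalIntegrable_const
      (Continuous.intervalIntegrable (by fun_prop) _ _) hA
    rw [intervalIntegral.integral_const, intervalIntegral.integral_const_mul,
      intervalIntegral.integral_add ((cu2 j).intervalIntegrable _ _) intervalIntegrable_const,
      intervalIntegral.integral_const] at hintg
    simp only [sub_zero, one_smul] at hintg
    refine hintg.trans ?_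
    rw [mul_assoc _ (1 + _) (J σ)]
    refine mul_le_mul_of_nonneg_left ?_ (by positivity)
    have := hJu j σ
    linarith
  -- boundary terms
  have bz : ∀ {Bd : (ℝ → ℝ) → ℝ → ℝ → ℝ → Prop} {α β : ℝ} (f : Fin n → Fin n → ι → ℝ → ℝ → ℝ),
      BdAx Bd → α ≤ β → (∀ j k, SB Bd J (f j k) α β) → ∀ j,
      SB Bd J (fun σ _ t => (∑ k, f j k σ (xin j) t) -
        ∑ k, p j k * ∑ l, f k l σ (xout k) t) α β := by
    intro Bd α β f hb hab hf j
    exact SB.sub hb hab (SB.sum hb hab _ fun k _ => (hf j k).trace (hxi j))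
      (SB.sum hb hab _ fun k _ => SB.constmul hb hab
        (SB.sum hb hab _ fun l _ => (hf k l).trace (hxo k)) _)
  set z : Fin n → ι → ℝ → ℝ → ℝ := fun j σ x t => w j σ x t + ∑ k, mm j k x t * u k σ x t with hz
  set zt : Fin n → ι → ℝ → ℝ → ℝ := fun j σ x t =>
    y j σ x t + ∑ k, (mt j k x t * u k σ x t + mm j k x t * w k σ x t) with hzt
  have cz : ∀ j σ, Continuous (fun q : ℝ × ℝ => z j σ q.1 q.2) := fun j σ => (hNn σ j).1.cont
  have czt : ∀ j σ, Continuous (fun q : ℝ × ℝ => zt j σ q.1 q.2) := fun j σ => (hNn σ j).1.contt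
  have cu : ∀ j σ, Continuous (fun q : ℝ × ℝ => u j σ q.1 q.2) := fun j σ => ((hS σ).tu j).cont
  have cw : ∀ j σ, Continuous (fun q : ℝ × ℝ => w j σ q.1 q.2) := fun j σ => ((hS σ).tw j).cont
  have cy : ∀ j σ, Continuous (fun q : ℝ × ℝ => y j σ q.1 q.2) := fun j σ => ((hS σ).tw j).contt
  set g1 : Fin n → ι → ℝ → ℝ → ℝ := fun j σ x t =>
    ∑ k, F j k x t * u k σ x t + (ht j σ x t + ∑ k, mm j k x t * h k σ x t) with hg1
  set g2 : Fin n → ι → ℝ → ℝ → ℝ := fun j σ x t =>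
    γt j x t * z j σ x t + (∑ k, (Ft j k x t * u k σ x t + F j k x t * w k σ x t) +
      (htt j σ x t + ∑ k, (mt j k x t * h k σ x t + mm j k x t * ht k σ x t))) with hg2
  have cg1 : ∀ j σ, Continuous (fun q : ℝ × ℝ => g1 j σ q.1 q.2) := fun j σ =>
    (continuous_finsetSum _ fun k _ => (hF j k).cont.mul (cu k σ)).add
      (((hS σ).th j).contt.add
        (continuous_finsetSum _ fun k _ => (hco.hm j k).td.cont.mul ((hS σ).th k).cont))
  have cg2 : ∀ j σ, Continuous (fun q : ℝ × ℝ => g2 j σ q.1 q.2) := fun j σ =>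
    ((hγ j).contt.mul (cz j σ)).add ((continuous_finsetSum _ fun k _ =>
      ((hF j k).contt.mul (cu k σ)).add ((hF j k).cont.mul (cw k σ))).add
      (((hS σ).tht j).contt.add (continuous_finsetSum _ fun k _ =>
        ((hco.hm j k).td.contt.mul ((hS σ).th k).cont).add
          ((hco.hm j k).td.cont.mul ((hS σ).tht k).cont))))
  have bcw := fun σ => bc_diff (hS σ).tu (hS σ).bc
  have bcy := fun σ => bc_diff (hS σ).tw (bcw σ)
  have bcz : ∀ j σ t, z j σ (xin j) t = ∑ k, p j k * z k σ (xout k) t +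
      ((∑ k, mm j k (xin j) t * u k σ (xin j) t) -
        ∑ k, p j k * ∑ l, mm k l (xout k) t * u l σ (xout k) t) := by
    intro j σ t
    have := bcw σ j t
    simp only [hz, mul_add, Finset.sum_add_distrib]
    rw [this]; ring
  have bczt : ∀ j σ t, zt j σ (xin j) t = ∑ k, p j k * zt k σ (xout k) t +
      ((∑ k, (mt j k (xin j) t * u k σ (xin j) t + mm j k (xin j) t * w k σ (xin j) t)) -
        ∑ k, p j k * ∑ l, (mt k l (xout k) t * u l σ (xout k) t
          + mm k l (xout k) t * w l σ (xout k) t)) := by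
    intro j σ t
    have := bcy σ j t
    have h2 : ∑ k, p j k * zt k σ (xout k) t = ∑ k, p j k * y k σ (xout k) t +
        ∑ k, p j k * ∑ l, (mt k l (xout k) t * u l σ (xout k) t
          + mm k l (xout k) t * w l σ (xout k) t) := by
      rw [← Finset.sum_add_distrib]
      refine Finset.sum_congr rfl fun k _ => ?_
      simp only [hzt]; ring
    rw [h2]; simp only [hzt]
    rw [this]; ring
  have zstep : ∀ {Bd : (ℝ → ℝ) → ℝ → ℝ → ℝ → Prop} {α' β' : ℝ}, BdAx Bd → α ≤ α' →
      α' + n * B ≤ β' - n * B → (∀ j, SB Bd J (u j) α' β') →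
      ∀ j, SB Bd J (z j) (α' + n * B) (β' - n * B) := by
    intro Bd α' β' hb h1 h2 hu
    have h2' : α' ≤ β' := by linarith
    refine nil_lemma hb hJ h3 hco.sys (fun j => (hγ j).cont) hB h2 cz cg1
      (fun j σ => (hNn σ j).2.1) bcz (fun j => ?_) ?_
    · refine SB.congr hb h2' (SB.sum hb h2' Finset.univ fun k _ =>
        (hu k).mulc hb h2' (hF j k).cont) (fun σ x _ => slice_cont (cg1 j σ) x) ?_
      intro σ x _ t ht'
      have h0 := fun k => (hS σ).z0 k x t (h1.trans ht'.1)
      have h1' := fun k => (hS σ).z1 k x t (h1.trans ht'.1)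
      simp only [hg1]
      simp only [h0, h1']; simp
    · exact bz (fun j k σ x t => mm j k x t * u k σ x t) hb h2' (fun j k =>
        (hu k).mulc hb h2' (hco.hm j k).td.cont)
  have wstep : ∀ {Bd : (ℝ → ℝ) → ℝ → ℝ → ℝ → Prop} {α' β' : ℝ}, BdAx Bd → 
      α' ≤ β' → (∀ j, SB Bd J (u j) α' β') → (∀ j, SB Bd J (z j) α' β') →
      ∀ j, SB Bd J (w j) α' β' := by
    intro Bd α' β' hb h2 hu hzz j
    refine SB.congr hb h2 (SB.sub hb h2 (hzz j) (SB.sum hb h2 Finset.univ fun k _ =>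
        (hu k).mulc hb h2 (hco.hm j k).td.cont)) (fun σ x _ => slice_cont (cw j σ) x) ?_
    intro σ x _ t _
    simp [hz]
  have hnB' : α + (3 * (n:ℝ) + 1) * B = α + B + n * B + n * B + n * B := by ring
  have hnB'' : β - (3 * (n:ℝ) + 1) * B = β - B - n * B - n * B - n * B := by ring
  rw [hnB', hnB''] at hab ⊢
  have s2 := zstep b2 (by linarith) (by linarith) s1
  have s1' := fun j => (s1 j).mono b2 (α' := α + B + n * B) (β' := β - B - n * B)
    (by linarith) (by linarith) (by linarith)
  have s3 := wstep b2 (by linarith) s1' s2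
  have s4 : ∀ j, SB supBd J (u j) (α + B + n * B) (β - B - n * B) := fun j =>
    SB.sobolev (by linarith) (fun σ => (hS σ).tu j) (s1' j) (s3 j)
  have s5 := zstep b1 (by linarith) (by linarith) s4
  have s4' := fun j => (s4 j).mono b1 (α' := α + B + n * B + n * B) (β' := β - B - n * B - n * B)
    (by linarith) (by linarith) (by linarith)
  have s6 := wstep b1 (by linarith) s4' s5
  have hab6 : α + B + n * B + n * B ≤ β - B - n * B - n * B := by linarith
  have s7 : ∀ j, SB supBd J (zt j) (α + B + n * B + n * B + n * B)
      (β - B - n * B - n * B - n * B) := by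
    refine nil_lemma b1 hJ h3 hco.sys (γ := fun j x t => γ j x t - ct j x t)
      (fun j => (hγ j).cont.sub (hco.hc j).td.contt) hB (by linarith) czt cg2
      (fun j σ => (hNn σ j).2.2) bczt (fun j => ?_) ?_
    · refine SB.congr b1 hab6 (SB.add b1 hab6 ((s5 j).mulc b1 hab6 (hγ j).contt)
        (SB.sum b1 hab6 Finset.univ fun k _ =>
        ((s4' k).mulc b1 hab6 (hF j k).contt).add b1 hab6 ((s6 k).mulc b1 hab6 (hF j k).cont)))
        (fun σ x _ => slice_cont (cg2 j σ) x) ?_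
      intro σ x _ t ht'
      have hαt : α ≤ t := by linarith [ht'.1]
      have h0 := fun k => (hS σ).z0 k x t hαt
      have h1' := fun k => (hS σ).z1 k x t hαt
      have h2' := fun k => (hS σ).z2 k x t hαt
      simp only [hg2]
      simp only [h0, h1', h2']; simp
    · exact bz (fun j k σ x t => mt j k x t * u k σ x t + mm j k x t * w k σ x t) b1 hab6
        (fun j k => ((s4' k).mulc b1 hab6 (hco.hm j k).td.contt).add b1 hab6
          ((s6 k).mulc b1 hab6 (hco.hm j k).td.cont))
  have u7 := fun j => (s4' j).mono b1 (α' := α + B + n * B + n * B + n * B)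
    (β' := β - B - n * B - n * B - n * B) (by linarith) hab.le (by linarith)
  have w7 := fun j => (s6 j).mono b1 (α' := α + B + n * B + n * B + n * B)
    (β' := β - B - n * B - n * B - n * B) (by linarith) hab.le (by linarith)
  refine ⟨u7, w7, fun j => ?_⟩
  refine SB.congr b1 hab.le (SB.sub b1 hab.le (s7 j) (SB.sum b1 hab.le Finset.univ fun k _ =>
    ((u7 k).mulc b1 hab.le (hco.hm j k).td.contt).add b1 hab.le
      ((w7 k).mulc b1 hab.le (hco.hm j k).td.cont))) (fun σ x _ => slice_cont (cy j σ) x) ?_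
  intro σ x _ t _
  simp [hzt]

end HS

namespace HS

lemma exp_bd {f : ℝ → ℝ → ℝ} (hf : Continuous (fun q : ℝ × ℝ => f q.1 q.2)) {α β l : ℝ}
    (hl : 0 < l) (h1 : ∀ x t, t ∉ Icc α β → f x t = 0) (h2 : ∀ x t, x ∉ Icc (0:ℝ) 1 → f x t = 0) :
    ∃ M, 0 ≤ M ∧ ∀ x t, |f x t| ≤ M * Real.exp (l * t) := by
  obtain ⟨G, hG0, hG⟩ := cpt_bd hf α β
  refine ⟨G * Real.exp (-(l * α)), by positivity, fun x t => ?_⟩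
  by_cases hx : x ∈ Icc (0:ℝ) 1
  · by_cases ht : t ∈ Icc α β
    · refine (hG x hx t ht).trans ?_
      rw [mul_assoc, ← Real.exp_add]
      have : 1 ≤ Real.exp (-(l * α) + l * t) := by
        rw [← Real.exp_zero]; apply Real.exp_le_exp.2; nlinarith [ht.1]
      nlinarith
    · rw [h1 x t ht, abs_zero]; positivity
  · rw [h2 x t hx, abs_zero]; positivity

lemma cutoff (s ε : ℝ) (hε : 0 < ε) : ∃ R ρ ρ1 ρ2 : ℝ → ℝ,
    (∀ t, HasDerivAt R (ρ t) t) ∧ (∀ t, HasDerivAt ρ (ρ1 t) t) ∧ (∀ t, HasDerivAt ρ1 (ρ2 t) t) ∧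
    Continuous ρ2 ∧ (∀ t, 0 ≤ R t ∧ R t ≤ 1) ∧ (∀ t, s ≤ t → R t = 1 ∧ ρ t = 0 ∧ ρ1 t = 0 ∧ ρ2 t = 0)
    ∧ (∀ t, t < s - ε → R t = 0 ∧ ρ t = 0 ∧ ρ1 t = 0 ∧ ρ2 t = 0) := by
  set R : ℝ → ℝ := fun t => Real.smoothTransition (2 * (t - s + ε) / ε) with hR
  have hRc : ContDiff ℝ 3 R := by
    apply Real.smoothTransition.contDiff.comp
    fun_prop
  have c1 : ContDiff ℝ 2 (deriv R) := by
    have : ContDiff ℝ (2 + 1) R := by norm_num; exact hRc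
    exact (contDiff_succ_iff_deriv.1 this).2.2
  have c2 : ContDiff ℝ 1 (deriv (deriv R)) := by
    have : ContDiff ℝ (1 + 1) (deriv R) := by norm_num; exact c1
    exact (contDiff_succ_iff_deriv.1 this).2.2
  have c3 : ContDiff ℝ 0 (deriv (deriv (deriv R))) := by
    have : ContDiff ℝ (0 + 1) (deriv (deriv R)) := by norm_num; exact c2
    exact (contDiff_succ_iff_deriv.1 this).2.2
  have key : ∀ t r, (∀ᶠ τ in nhds t, R τ = r) → R t = r ∧ deriv R t = 0 ∧ deriv (deriv R) t = 0 ∧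
      deriv (deriv (deriv R)) t = 0 := by
    intro t r h
    have h1 : R =ᶠ[nhds t] fun _ => r := h
    have h2 : deriv R =ᶠ[nhds t] fun _ => 0 := by
      refine h1.deriv.trans ?_
      simp
    have h3 : deriv (deriv R) =ᶠ[nhds t] fun _ => 0 := by
      refine h2.deriv.trans ?_
      simp
    have h4 : deriv (deriv (deriv R)) =ᶠ[nhds t] fun _ => 0 := by
      refine h3.deriv.trans ?_
      simp
    exact ⟨h1.eq_of_nhds, h2.eq_of_nhds, h3.eq_of_nhds, h4.eq_of_nhds⟩
  refine ⟨R, deriv R, deriv (deriv R), deriv (deriv (deriv R)), fun t => ?_, fun t => ?_,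
    fun t => ?_, c3.continuous, fun t => ⟨Real.smoothTransition.nonneg _,
      Real.smoothTransition.le_one _⟩, fun t ht => ?_, fun t ht => ?_⟩
  · exact (hRc.differentiable (by norm_num) t).hasDerivAt
  · exact (c1.differentiable (by norm_num) t).hasDerivAt
  · exact (c2.differentiable (by norm_num) t).hasDerivAt
  · apply key
    filter_upwards [lt_mem_nhds (show s - ε / 2 < t by linarith)] with τ hτ
    apply Real.smoothTransition.one_of_one_le
    rw [le_div_iff₀ hε]; linarith
  · apply key
    filter_upwards [gt_mem_nhds ht] with τ hτ
    apply Real.smoothTransition.zero_of_nonpos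
    exact div_nonpos_of_nonpos_of_nonneg (by linarith) hε.le

theorem dense_step {n : ℕ} {a : ℝ → ℝ → Fin n → ℝ} {b : ℝ → ℝ → Fin n → Fin n → ℝ}
    {c ct ctt cx cxt : Fin n → ℝ → ℝ → ℝ} {e et ett ex ext : Fin n → Fin n → ℝ → ℝ → ℝ}
    {mm mt mtt mx mxt : Fin n → Fin n → ℝ → ℝ → ℝ} {xin xout : Fin n → ℝ} {κ B L E : ℝ}
    (hco : Coef a b c ct ctt cx cxt e et ett ex ext mm mt mtt mx mxt xin xout κ B L E)
    (p : Fin n → Fin n → ℝ) (s : ℝ) {φ φ' : Fin n → ℝ → ℝ} (hφ : ∀ j x, HasDerivAt (φ j) (φ' j x) x)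
    (hφ' : ∀ j, Continuous (φ' j)) {δ : ℝ} (hδ : 0 < δ)
    (hsup : ∀ j x, 1 / 2 - δ ≤ |x - 1 / 2| → φ j x = 0) {η : ℝ} (hη : 0 < η) :
    ∃ u w y h ht htt, Sol c e p xin xout s u w y h ht htt ∧
      (∀ j, ∀ x ∈ Icc (0:ℝ) 1, 1 / 2 - δ / 2 ≤ |x - 1 / 2| → u j x s = 0) ∧
      ∀ j, ∀ x ∈ Icc (0:ℝ) 1, |u j x s - φ j x| ≤ η := by
  have hφc : ∀ j, Continuous (φ j) := fun j =>
    continuous_iff_continuousAt.2 fun x => (hφ j x).continuousAt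
  have hκ := hco.sys.pos
  -- bound for the inhomogeneity
  have hbd : ∀ f : Fin n → ℝ → ℝ, (∀ j, Continuous (f j)) → ∃ r, 0 ≤ r ∧
      ∀ j, ∀ x ∈ Icc (0:ℝ) 1, |f j x| ≤ r := by
    intro f hf
    have : ∀ j, ∃ r, 0 ≤ r ∧ ∀ x ∈ Icc (0:ℝ) 1, |f j x| ≤ r := fun j => by
      obtain ⟨G, h0, hG⟩ := cpt_bd (γ := fun x _ => f j x) ((hf j).comp continuous_fst) 0 0
      exact ⟨G, h0, fun x hx => hG x hx 0 (by simp)⟩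
    choose r h0 hr using this
    exact ⟨∑ j, r j, Finset.sum_nonneg fun j _ => h0 j, fun j x hx =>
      (hr j x hx).trans (Finset.single_le_sum (fun j _ => h0 j) (Finset.mem_univ j))⟩
  obtain ⟨r0, hr00, hr0⟩ := hbd φ hφc
  obtain ⟨r1, hr10, hr1⟩ := hbd φ' hφ'
  set r := n * |E| * r0 + r1 with hr
  have hrn : 0 ≤ r := by positivity
  obtain ⟨θ, hθ, hθ1, hθ2⟩ : ∃ θ : ℝ, 0 < θ ∧ n * θ * (n * |E|) ≤ 1 / 2 ∧ 2 * n * θ * r ≤ η := by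
    refine ⟨min (1 / (2 * (n * (n * |E|) + 1))) (η / (2 * (n * r + 1))), by positivity, ?_, ?_⟩
    · have h1 := min_le_left (1 / (2 * (n * (n * |E|) + 1))) (η / (2 * (n * r + 1)))
      rw [le_div_iff₀ (by positivity)] at h1
      have h2 : 0 < min (1 / (2 * (n * (n * |E|) + 1))) (η / (2 * (n * r + 1))) := by positivity
      nlinarith
    · have h1 := min_le_right (1 / (2 * (n * (n * |E|) + 1))) (η / (2 * (n * r + 1)))
      rw [le_div_iff₀ (by positivity)] at h1
      have h2 : 0 < min (1 / (2 * (n * (n * |E|) + 1))) (η / (2 * (n * r + 1))) := by positivity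
      nlinarith
  obtain ⟨ε, hε, hε1, hε2⟩ : ∃ ε : ℝ, 0 < ε ∧ Real.exp 3 * ε / (2 * κ) ≤ θ ^ 2 ∧ 1 / κ * ε ≤ δ / 2 := by
    refine ⟨min (θ ^ 2 * (2 * κ) / Real.exp 3) (κ * δ / 2), by positivity, ?_, ?_⟩
    · have h1 := min_le_left (θ ^ 2 * (2 * κ) / Real.exp 3) (κ * δ / 2)
      rw [le_div_iff₀ (by positivity)] at h1
      rw [div_le_iff₀ (by positivity)]; linarith
    · have h1 := min_le_right (θ ^ 2 * (2 * κ) / Real.exp 3) (κ * δ / 2)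
      rw [one_div, ← div_eq_inv_mul, div_le_iff₀ hκ]; linarith
  obtain ⟨R, ρ, ρ1, ρ2, dR, dρ, dρ1, cρ2, R01, hpost, hpre⟩ := cutoff s ε hε
  have cR : Continuous R := continuous_iff_continuousAt.2 fun t => (dR t).continuousAt
  have cρ : Continuous ρ := continuous_iff_continuousAt.2 fun t => (dρ t).continuousAt
  have cρ1 : Continuous ρ1 := continuous_iff_continuousAt.2 fun t => (dρ1 t).continuousAt
  obtain ⟨l, hl, hex⟩ := exist_sol2 hco.sys p (fun j => (hco.hc j).tdt) hco.bctt
    (fun j k => (hco.he j k).td) (fun j k => (hco.he j k).tdt) hco.be hco.bet hco.bett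
  have t0 : ∀ j, TD (fun x t => φ j x * ρ t) (fun x t => φ j x * ρ1 t) := fun j =>
    ⟨by have := hφc j; fun_prop, by have := hφc j; fun_prop, fun x t => (dρ t).const_mul (φ j x)⟩
  have t1 : ∀ j, TD (fun x t => φ j x * ρ1 t) (fun x t => φ j x * ρ2 t) := fun j =>
    ⟨by have := hφc j; fun_prop, by have := hφc j; fun_prop, fun x t => (dρ1 t).const_mul (φ j x)⟩
  have th := fun j => (hco.hc j).td.mul (t0 j)
  have tht := fun j => ((hco.hc j).tdt.mul (t0 j)).add ((hco.hc j).td.mul (t1 j))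
  have out : ∀ j x, x ∉ Icc (0:ℝ) 1 → φ j x = 0 := by
    intro j x hx
    apply hsup
    by_contra hcon
    push Not at hcon
    have := abs_lt.1 hcon
    exact hx ⟨by linarith, by linarith⟩
  have outt : ∀ t, t ∉ Icc (s - ε) s → ρ t = 0 ∧ ρ1 t = 0 ∧ ρ2 t = 0 := by
    intro t ht
    rcases lt_or_ge t (s - ε) with h | h
    · exact (hpre t h).2
    · exact (hpost t (by by_contra hc; push Not at hc; exact ht ⟨h, hc.le⟩)).2
  have eb : ∃ M, ∀ j x t, |c j x t * (φ j x * ρ t)| ≤ M * Real.exp (l * t) ∧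
      |ct j x t * (φ j x * ρ t) + c j x t * (φ j x * ρ1 t)| ≤ M * Real.exp (l * t) ∧
      |ctt j x t * (φ j x * ρ t) + ct j x t * (φ j x * ρ1 t) + (ct j x t * (φ j x * ρ1 t) +
        c j x t * (φ j x * ρ2 t))| ≤ M * Real.exp (l * t) := by
    have b0 := fun j => exp_bd (f := fun x t => c j x t * (φ j x * ρ t)) (th j).cont (α := s - ε) (β := s) hl
      (fun x t h => by simp [outt t h]) (fun x t h => by simp [out j x h])
    have b1 := fun j => exp_bd (f := fun x t => ct j x t * (φ j x * ρ t) + c j x t * (φ j x * ρ1 t)) (th j).contt (α := s - ε) (β := s) hl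
      (fun x t h => by simp [outt t h]) (fun x t h => by simp [out j x h])
    have b2 := fun j => exp_bd (f := fun x t => ctt j x t * (φ j x * ρ t) + ct j x t * (φ j x * ρ1 t) +
      (ct j x t * (φ j x * ρ1 t) + c j x t * (φ j x * ρ2 t))) (tht j).contt (α := s - ε) (β := s) hl
      (fun x t h => by simp [outt t h]) (fun x t h => by simp [out j x h])
    choose M0 p0 q0 using b0
    choose M1 p1 q1 using b1
    choose M2 p2 q2 using b2
    refine ⟨∑ j, (M0 j + M1 j + M2 j), fun j x t => ?_⟩
    have hs : M0 j + M1 j + M2 j ≤ ∑ j, (M0 j + M1 j + M2 j) :=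
      Finset.single_le_sum (f := fun j => M0 j + M1 j + M2 j)
        (fun j _ => by have := p0 j; have := p1 j; have := p2 j; positivity) (Finset.mem_univ j)
    have := p0 j; have := p1 j; have := p2 j
    have he := Real.exp_pos (l * t)
    exact ⟨(q0 j x t).trans (mul_le_mul_of_nonneg_right (by linarith) he.le),
      (q1 j x t).trans (mul_le_mul_of_nonneg_right (by linarith) he.le),
      (q2 j x t).trans (mul_le_mul_of_nonneg_right (by linarith) he.le)⟩
  obtain ⟨u, w, y, hu, hw, ha, hbc, hZ⟩ := hex l le_rfl _ _ _ th tht eb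
  -- domain of dependence
  set Z : ℝ → ℝ → Prop := fun x t => t ≤ s ∧ (t < s - ε ∨
    1 / 2 - δ + 1 / κ * (t - s + ε) ≤ |x - 1 / 2|) with hZd
  have hxi : ∀ j, |xin j - 1 / 2| = 1 / 2 := by
    intro j
    rcases hco.sys.dir j with h | h <;> rw [h.1] <;> norm_num
  have hxo : ∀ j, |xout j - 1 / 2| = 1 / 2 := by
    intro j
    rw [hco.sys.xo j, show 1 - xin j - 1 / 2 = -(xin j - 1 / 2) by ring, abs_neg, hxi j]
  have hbz : ∀ x τ, |x - 1 / 2| = 1 / 2 → τ ≤ s → Z x τ := by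
    intro x τ hx hτ
    refine ⟨hτ, Or.inr ?_⟩
    rw [hx]
    have : 1 / κ * (τ - s + ε) ≤ 1 / κ * ε := by
      apply mul_le_mul_of_nonneg_left _ (by positivity); linarith
    linarith
  have hdc : DepClosed xin xout κ Z := by
    constructor
    · intro x hx t hz ξ hξ τ hτ
      have hk : 0 ≤ κ * |x - ξ| := by positivity
      refine ⟨by linarith [hz.1], ?_⟩
      rcases hz.2 with h | h
      · exact Or.inl (by linarith)
      · right
        have h1 : 1 / κ * (τ - s + ε) ≤ 1 / κ * (t - κ * |x - ξ| - s + ε) :=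
          mul_le_mul_of_nonneg_left (by linarith) (by positivity)
        have h2 : 1 / κ * (t - κ * |x - ξ| - s + ε) = 1 / κ * (t - s + ε) - |x - ξ| := by
          field_simp; ring
        have h3 := abs_sub_abs_le_abs_sub (x - 1 / 2) (ξ - 1 / 2)
        rw [show x - 1 / 2 - (ξ - 1 / 2) = x - ξ by ring] at h3
        linarith
    · intro x hx t hz j k τ hτ
      have hk : 0 ≤ κ * |x - xin j| := by positivity
      exact hbz _ _ (hxo k) (by linarith [hz.1])
  have hzero := hZ Z hdc (by
    intro j x hx t hz
    rcases lt_or_ge t (s - ε) with h | h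
    · simp [hpre t h]
    · have h1 := hz.2.resolve_left (not_lt.2 h)
      have h2 : 0 ≤ 1 / κ * (t - s + ε) := mul_nonneg (by positivity) (by linarith)
      simp [hsup j x (by linarith)])
  refine ⟨u, w, y, _, _, _, ⟨hu, hw, th, tht, ha, hbc, fun j x t h => by simp [hpost t h],
    fun j x t h => by simp [hpost t h], fun j x t h => by simp [hpost t h]⟩, ?_, ?_⟩
  · intro j x hx h
    refine hzero j x hx s ⟨le_rfl, Or.inr ?_⟩
    rw [show s - s + ε = ε by ring]; linarith
  -- smallness
  set v : Fin n → ℝ → ℝ → ℝ := fun j x t => u j x t - φ j x * R t with hv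
  have cv : ∀ j, Continuous (fun q : ℝ × ℝ => v j q.1 q.2) := fun j => by
    have := hφc j; have := (hu j).cont; fun_prop
  set g : Fin n → ℝ → ℝ → ℝ := fun j x t => ∑ k, e j k x t * u k x t - φ' j x * R t with hg
  have cg : ∀ j, Continuous (fun q : ℝ × ℝ => g j q.1 q.2) := fun j => by
    have h1 := hφ' j
    exact (continuous_finsetSum _ fun k _ => (hco.he j k).td.cont.mul (hu k).cont).sub (by fun_prop)
  have av : ∀ j, Along (c j) (v j) (fun x t => (fun _ _ => (0:ℝ)) x t * v j x t + g j x t) := by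
    intro j S hS ξ hξ
    have h1 := ha j S hS ξ hξ
    have h2 : HasDerivAt (fun ξ => φ j ξ * R (S ξ)) _ ξ :=
      (hφ j ξ).mul ((dR (S ξ)).comp ξ (hS.2 ξ hξ))
    refine (h1.sub h2).congr_deriv ?_
    simp only [hg, Function.comp]; ring
  have vpre : ∀ j, ∀ x ∈ Icc (0:ℝ) 1, ∀ t, t < s - ε → v j x t = 0 ∧ ∀ k, u k x t = 0 := by
    intro j x hx t h
    have : ∀ k, u k x t = 0 := fun k => hzero k x hx t ⟨by linarith, Or.inl h⟩
    exact ⟨by simp [hv, this, hpre t h], this⟩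
  have vbd : ∀ j, ∀ τ ≤ s, v j (xin j) τ = 0 := by
    intro j τ hτ
    have h1 := hzero j (xin j) (hco.sys.dir j).mem τ (hbz _ _ (hxi j) hτ)
    have h2 := hsup j (xin j) (by rw [hxi j]; linarith)
    simp [hv, h1, h2]
  obtain ⟨q, hq, hmax⟩ := (isCompact_Icc.prod isCompact_Icc :
      IsCompact (Icc (0:ℝ) 1 ×ˢ Icc (s - ε) s)).exists_isMaxOn
    ⟨(0, s), ⟨by simp, by constructor <;> linarith⟩⟩
    (f := fun q : ℝ × ℝ => ∑ j, |v j q.1 q.2|)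
    (continuous_finsetSum _ fun j _ => (cv j).abs).continuousOn
  set M := ∑ j, |v j q.1 q.2| with hM
  have hM0 : 0 ≤ M := Finset.sum_nonneg fun j _ => abs_nonneg _
  have hvM : ∀ j, ∀ x ∈ Icc (0:ℝ) 1, ∀ t ∈ Icc (s - ε) s, |v j x t| ≤ M := by
    intro j x hx t ht
    refine (Finset.single_le_sum (f := fun j => |v j x t|) (fun j _ => abs_nonneg _)
      (Finset.mem_univ j)).trans ?_
    exact hmax (a := (x, t)) ⟨hx, ht⟩
  have hgM : ∀ j, ∀ x ∈ Icc (0:ℝ) 1, ∀ t ∈ Icc (s - ε) s, |g j x t| ≤ n * |E| * M + r := by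
    intro j x hx t ht
    have hu' : ∀ k, |u k x t| ≤ M + r0 := by
      intro k
      have h1 := hvM k x hx t ht
      have h2 : u k x t = v k x t + φ k x * R t := by simp [hv]
      rw [h2]
      refine (abs_add_le _ _).trans (add_le_add h1 ?_)
      rw [abs_mul, abs_of_nonneg (R01 t).1]
      exact (mul_le_of_le_one_right (abs_nonneg _) (R01 t).2).trans (hr0 k x hx)
    have h1 : |∑ k, e j k x t * u k x t| ≤ n * |E| * (M + r0) :=
      sum_bound (fun k => (hco.be j k x t).trans (le_abs_self _)) hu' (abs_nonneg _)
    have h2 : |φ' j x * R t| ≤ r1 := by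
      rw [abs_mul, abs_of_nonneg (R01 t).1]
      exact (mul_le_of_le_one_right (abs_nonneg _) (R01 t).2).trans (hr1 j x hx)
    refine (abs_sub _ _).trans ?_
    rw [hr]; linarith
  have fin : ∀ j, ∀ x ∈ Icc (0:ℝ) 1, ∀ t ≤ s, |v j x t| ≤ θ * (n * |E| * M + r) := by
    intro j x hx t ht
    have h0 : 0 ≤ n * |E| * M + r := by positivity
    have := ml_exp (Mq := 0) (Mg := (n * |E| * M + r) * Real.exp (-(1 / ε * (s - ε)))) (l := 1 / ε)
      (G := 0) (t := t) (hco.sys.spd j) (hco.sys.dir j) hκ (av j) (cv j) (cg j)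
      (fun _ _ _ => by simp) (by positivity) hx
      (fun τ hτ => by rw [vbd j τ (hτ.trans ht)]; simp)
      (fun ξ hξ τ hτ => by
        rcases lt_or_ge τ (s - ε) with h | h
        · have h1 := (vpre j ξ hξ τ h).2
          have : g j ξ τ = 0 := by simp [hg, h1, hpre τ h]
          rw [this, abs_zero]; positivity
        · refine (hgM j ξ hξ τ ⟨h, hτ.trans ht⟩).trans ?_
          rw [mul_assoc (_ + r), ← Real.exp_add]
          refine le_mul_of_one_le_right h0 ?_
          apply Real.one_le_exp
          have : 0 ≤ 1 / ε * (τ - (s - ε)) := mul_nonneg (by positivity) (by linarith)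
          rw [show -(1 / ε * (s - ε)) + 1 / ε * τ = 1 / ε * (τ - (s - ε)) by ring]; exact this)
    refine abs_le_of_sq_le_sq (this.trans ?_) (by positivity)
    have e1 : Real.exp (2 * 0 + 1) * (0 ^ 2 * Real.exp (-(2 * (1 / ε) * κ) * |x - xin j|) +
        ((n * |E| * M + r) * Real.exp (-(1 / ε * (s - ε)))) ^ 2 / (2 * (1 / ε) * κ)) *
        Real.exp (2 * (1 / ε) * t) = (ε / (2 * κ)) * (n * |E| * M + r) ^ 2 *
        Real.exp (1 + 2 * (-(1 / ε * (s - ε))) + 2 * (1 / ε) * t) := by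
      rw [show (2 * 0 + 1 : ℝ) = 1 by norm_num, Real.exp_add, Real.exp_add,
        two_mul (-(1 / ε * (s - ε))), Real.exp_add (-(1 / ε * (s - ε)))]
      generalize Real.exp (-(1 / ε * (s - ε))) = X
      generalize Real.exp (2 * (1 / ε) * t) = Y
      generalize Real.exp 1 = V
      generalize Real.exp (-(2 * (1 / ε) * κ) * |x - xin j|) = V'
      field_simp
      ring
    rw [e1, mul_pow]
    have e2 : Real.exp (1 + 2 * (-(1 / ε * (s - ε))) + 2 * (1 / ε) * t) ≤ Real.exp 3 := by
      apply Real.exp_le_exp.2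
      have h1 : 1 / ε * (t - s) ≤ 0 := mul_nonpos_of_nonneg_of_nonpos (by positivity) (by linarith)
      have h2 : 1 / ε * ε = 1 := by field_simp
      nlinarith
    calc _ ≤ (ε / (2 * κ)) * (n * |E| * M + r) ^ 2 * Real.exp 3 := by gcongr
      _ = (Real.exp 3 * ε / (2 * κ)) * (n * |E| * M + r) ^ 2 := by ring
      _ ≤ _ := by gcongr
  have hMle : M ≤ n * (θ * (n * |E| * M + r)) := by
    have : M ≤ ∑ _j : Fin n, θ * (n * |E| * M + r) :=
      Finset.sum_le_sum fun j _ => fin j q.1 hq.1 q.2 hq.2.2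
    rwa [Finset.sum_const, Finset.card_univ, Fintype.card_fin, nsmul_eq_mul] at this
  have hMη : M ≤ η := by nlinarith
  intro j x hx
  have := hvM j x hx s ⟨by linarith, le_rfl⟩
  simp only [hv, (hpost s le_rfl).1, mul_one] at this
  exact this.trans hMη

end HS

namespace HS

/-- Assemble a vector function from components. -/
def vec {n : ℕ} (f : Fin n → ℝ → ℝ) (x : ℝ) : Vn n := WithLp.toLp 2 (fun j => f j x)

lemma vec_apply {n : ℕ} (f : Fin n → ℝ → ℝ) (x : ℝ) (j : Fin n) : vec f x j = f j x := rfl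

lemma vec_cont {n : ℕ} {f : Fin n → ℝ → ℝ} (hf : ∀ j, Continuous (f j)) : Continuous (vec f) :=
  (PiLp.continuous_toLp 2 _).comp (continuous_pi hf)

lemma vec_bound {n : ℕ} {f : Fin n → ℝ → ℝ} {x M : ℝ} (hM : 0 ≤ M) (hf : ∀ j, |f j x| ≤ M) :
    ‖vec f x‖ ≤ n * M := by
  rw [EuclideanSpace.norm_eq]
  refine Real.sqrt_le_iff.2 ⟨by positivity, ?_⟩
  have : ∑ j, ‖vec f x j‖ ^ 2 ≤ ∑ _j : Fin n, M ^ 2 := Finset.sum_le_sum fun j _ => by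
    rw [vec_apply, Real.norm_eq_abs]
    exact pow_le_pow_left₀ (abs_nonneg _) (hf j) 2
  rw [Finset.sum_const, Finset.card_univ, Fintype.card_fin, nsmul_eq_mul] at this
  refine this.trans ?_
  rw [mul_pow]
  rcases Nat.eq_zero_or_pos n with h | h
  · simp [h]
  · have h1 : (1:ℝ) ≤ n := by exact_mod_cast h
    have : (n:ℝ) ≤ (n:ℝ) ^ 2 := by nlinarith
    gcongr

lemma mk_L2 {n : ℕ} {f : ℝ → Vn n} (hf : Continuous f) : ∃ ψ : L2 n, ∀ᵐ x ∂μ01, ψ x = f x := by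
  obtain ⟨C, hC⟩ := (isCompact_Icc (a := (0:ℝ)) (b := 1)).exists_bound_of_continuousOn hf.continuousOn
  have : MemLp f 2 μ01 := MemLp.of_bound hf.aestronglyMeasurable C
    ((ae_restrict_iff' measurableSet_Ioo).2 (Eventually.of_forall fun x hx =>
      hC x (Ioo_subset_Icc_self hx)))
  exact ⟨this.toLp, this.coeFn_toLp⟩

lemma norm_L2_le {n : ℕ} {ψ : L2 n} {C : ℝ} (hC : 0 ≤ C) (h : ∀ᵐ x ∂μ01, ‖ψ x‖ ≤ C) :
    ‖ψ‖ ≤ C := by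
  have := Lp.norm_le_of_ae_bound hC h
  refine this.trans_eq ?_
  have : measureUnivNNReal μ01 = 1 := by
    simp [measureUnivNNReal]
  rw [this]; simp

lemma norm_sq_L2 {n : ℕ} (ψ : L2 n) : ‖ψ‖ ^ 2 = ∫ x, ‖ψ x‖ ^ 2 ∂μ01 := by
  rw [← real_inner_self_eq_norm_sq, L2.inner_def]
  simp only [real_inner_self_eq_norm_sq]

lemma integrable_sq_L2 {n : ℕ} (ψ : L2 n) : Integrable (fun x => ‖ψ x‖ ^ 2) μ01 := by
  have := L2.integrable_inner (𝕜 := ℝ) ψ ψ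
  simpa only [real_inner_self_eq_norm_sq] using this

/-- compactly supported `C¹` functions in `(0,1)`. -/
def Cc {n : ℕ} (φ : Fin n → ℝ → ℝ) : Prop :=
  (∀ j, ContDiff ℝ 1 (φ j)) ∧ ∃ δ > 0, ∀ j x, 1 / 2 - δ ≤ |x - 1 / 2| → φ j x = 0

/-- The subspace of such functions in `L²`. -/
def CcSub (n : ℕ) : Submodule ℝ (L2 n) where
  carrier := {ψ | ∃ φ : Fin n → ℝ → ℝ, Cc φ ∧ ∀ᵐ x ∂μ01, ψ x = vec φ x}
  zero_mem' := ⟨fun _ _ => 0, ⟨fun _ => contDiff_const, 1, one_pos, fun _ _ _ => rfl⟩, by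
    filter_upwards [Lp.coeFn_zero (Vn n) 2 μ01] with x hx
    rw [hx]; ext j; rfl⟩
  add_mem' := by
    rintro ψ1 ψ2 ⟨φ1, ⟨h1, δ1, hδ1, k1⟩, e1⟩ ⟨φ2, ⟨h2, δ2, hδ2, k2⟩, e2⟩
    refine ⟨fun j x => φ1 j x + φ2 j x, ⟨fun j => (h1 j).add (h2 j), min δ1 δ2, by positivity,
      fun j x hx => ?_⟩, ?_⟩
    · have := min_le_left δ1 δ2
      have := min_le_right δ1 δ2
      show φ1 j x + φ2 j x = 0
      rw [k1 j x (by linarith), k2 j x (by linarith), add_zero]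
    · filter_upwards [Lp.coeFn_add ψ1 ψ2, e1, e2] with x hx h1 h2
      rw [hx, Pi.add_apply, h1, h2]; ext j; rfl
  smul_mem' := by
    rintro r ψ1 ⟨φ1, ⟨h1, δ1, hδ1, k1⟩, e1⟩
    refine ⟨fun j x => r * φ1 j x, ⟨fun j => contDiff_const.mul (h1 j), δ1, hδ1,
      fun j x hx => by show r * φ1 j x = 0; rw [k1 j x hx, mul_zero]⟩, ?_⟩
    filter_upwards [Lp.coeFn_smul r ψ1, e1] with x hx h1
    rw [hx, Pi.smul_apply, h1]; ext j; rfl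

lemma supp_delta {g : ℝ → ℝ} (hc : HasCompactSupport g) (hs : tsupport g ⊆ Ioo 0 1) :
    ∃ δ > 0, ∀ x, 1 / 2 - δ ≤ |x - 1 / 2| → g x = 0 := by
  rcases (tsupport g).eq_empty_or_nonempty with h | h
  · refine ⟨1, one_pos, fun x _ => ?_⟩
    rw [tsupport_eq_empty_iff] at h
    simp [h]
  · obtain ⟨y, hy, hm⟩ := hc.isCompact.exists_isMaxOn h (f := fun x => |x - 1 / 2|)
      (by fun_prop)
    have hy' := hs hy
    have hlt : |y - 1 / 2| < 1 / 2 := abs_lt.2 ⟨by linarith [hy'.1], by linarith [hy'.2]⟩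
    refine ⟨(1 / 2 - |y - 1 / 2|) / 2, by linarith, fun x hx => ?_⟩
    by_contra hne
    have := hm (subset_tsupport g hne)
    simp only [mem_ofPred_eq] at this
    linarith

lemma CcSub_dense (n : ℕ) : (CcSub n).topologicalClosure = ⊤ := by
  classical
  rw [Submodule.topologicalClosure_eq_top_iff, Submodule.eq_bot_iff]
  intro f hf
  rw [Submodule.mem_orthogonal] at hf
  have key : ∀ j, ∀ᵐ x ∂(volume : Measure ℝ), x ∈ Ioo (0:ℝ) 1 → f x j = 0 := by
    intro j
    refine isOpen_Ioo.ae_eq_zero_of_integral_contDiff_smul_eq_zero ?_ ?_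
    · have h1 : Integrable (fun x => f x) μ01 :=
        (Lp.memLp f).integrable (by norm_num)
      have h2 : Integrable (fun x => f x j) μ01 :=
        (EuclideanSpace.proj (𝕜 := ℝ) j).integrable_comp h1
      exact IntegrableOn.locallyIntegrableOn h2
    · intro g hg hgc hgs
      obtain ⟨δ, hδ, hz⟩ := supp_delta hgc hgs
      set φ : Fin n → ℝ → ℝ := fun i x => if i = j then g x else 0 with hφ
      have hc : Cc φ := by
        refine ⟨fun i => ?_, δ, hδ, fun i x hx => ?_⟩
        · by_cases h : i = j
          · simp only [hφ, h, if_true]; exact hg.of_le (by exact_mod_cast le_top)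
          · simp only [hφ, h, if_false]; exact contDiff_const
        · simp only [hφ, hz x hx, ite_self]
      obtain ⟨ψ, hψ⟩ := mk_L2 (vec_cont fun i => (hc.1 i).continuous)
      have h3 := hf ψ ⟨φ, hc, hψ⟩
      rw [L2.inner_def] at h3
      have h4 : ∫ x, g x • f x j = ∫ x in Ioo (0:ℝ) 1, g x • f x j := by
        symm
        apply setIntegral_eq_integral_of_forall_compl_eq_zero
        intro x hx
        rw [image_eq_zero_of_notMem_tsupport fun h => hx (hgs h), zero_smul]
      rw [h4]
      refine Eq.trans ?_ h3
      apply integral_congr_ae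
      filter_upwards [hψ] with x hx
      rw [hx, PiLp.inner_apply]
      simp [vec_apply, hφ, mul_comm]
  ext1
  refine EventuallyEq.trans ?_ (Lp.coeFn_zero (Vn n) 2 μ01).symm
  refine (ae_restrict_iff' measurableSet_Ioo).2 ?_
  filter_upwards [ae_all_iff.2 key] with x hx hxI
  ext j
  exact hx j hxI

lemma dense_Cc {n : ℕ} (f : L2 n) {ε : ℝ} (hε : 0 < ε) : ∃ φ : Fin n → ℝ → ℝ, Cc φ ∧ ∃ ψ : L2 n,
    (∀ᵐ x ∂μ01, ψ x = vec φ x) ∧ ‖f - ψ‖ < ε := by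
  have h : f ∈ (CcSub n).topologicalClosure := by rw [CcSub_dense]; trivial
  have h' : f ∈ closure (CcSub n : Set (L2 n)) := h
  obtain ⟨ψ, ⟨φ, h1, h2⟩, h3⟩ := Metric.mem_closure_iff.1 h' ε hε
  exact ⟨φ, h1, ψ, h2, by rwa [← dist_eq_norm]⟩

end HS

namespace HS

lemma eq_prim {f g : ℝ → ℝ} (hf : Continuous f) (hg : Continuous g)
    (h : ∀ ξ ∈ Ioo (0:ℝ) 1, HasDerivAt f (g ξ) ξ) : ∀ x ∈ Icc (0:ℝ) 1,
    f x = f 0 + ∫ ξ in (0:ℝ)..x, g ξ := fun x hx =>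
  ftc_eq (f := f) (f' := g) hf hg h (by simp) hx

lemma deriv_ext {f g : ℝ → ℝ} (hf : Continuous f) (hg : Continuous g)
    (h : ∀ ξ ∈ Ioo (0:ℝ) 1, HasDerivAt f (g ξ) ξ) {x : ℝ} (hx : x ∈ Icc (0:ℝ) 1) :
    HasDerivWithinAt f (g x) (Icc 0 1) x := by
  have h1 : HasDerivAt (fun x => f 0 + ∫ ξ in (0:ℝ)..x, g ξ) (g x) x :=
    (hasDerivAt_prim hg 0 x).const_add _
  exact h1.hasDerivWithinAt.congr (eq_prim hf hg h) (eq_prim hf hg h x hx)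

lemma slice_x {v : ℝ → ℝ → ℝ} (h : Continuous (fun q : ℝ × ℝ => v q.1 q.2)) (t : ℝ) :
    Continuous (fun x => v x t) := cont2 h continuous_id continuous_const

section
variable {n : ℕ} {a : ℝ → ℝ → Fin n → ℝ} {b : ℝ → ℝ → Fin n → Fin n → ℝ}
    {c ct ctt cx cxt : Fin n → ℝ → ℝ → ℝ} {e et ett ex ext : Fin n → Fin n → ℝ → ℝ → ℝ}
    {mm mt mtt mx mxt : Fin n → Fin n → ℝ → ℝ → ℝ} {xin xout : Fin n → ℝ} {κ B L E : ℝ}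
    {p : Fin n → Fin n → ℝ} {s : ℝ} {u w y h ht htt : Fin n → ℝ → ℝ → ℝ}

/-- The `x`-derivative of a solution. -/
def ux1 (c : Fin n → ℝ → ℝ → ℝ) (e : Fin n → Fin n → ℝ → ℝ → ℝ) (u w : Fin n → ℝ → ℝ → ℝ) :
    Fin n → ℝ → ℝ → ℝ := fun j x t => ∑ k, e j k x t * u k x t - c j x t * w j x t

/-- The `x`-derivative of `w`. -/
def wx1 (c ct : Fin n → ℝ → ℝ → ℝ) (e et : Fin n → Fin n → ℝ → ℝ → ℝ)
    (u w y : Fin n → ℝ → ℝ → ℝ) : Fin n → ℝ → ℝ → ℝ := fun j x t =>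
  ∑ k, (et j k x t * u k x t + e j k x t * w k x t) - ct j x t * w j x t - c j x t * y j x t

/-- The second `x`-derivative of a solution. -/
def ux2 (c ct cx : Fin n → ℝ → ℝ → ℝ) (e et ex : Fin n → Fin n → ℝ → ℝ → ℝ)
    (u w y : Fin n → ℝ → ℝ → ℝ) : Fin n → ℝ → ℝ → ℝ := fun j x t =>
  ∑ k, (ex j k x t * u k x t + e j k x t * ux1 c e u w k x t) -
    (cx j x t * w j x t + c j x t * wx1 c ct e et u w y j x t)

lemma ux1_cont
    (hco : Coef a b c ct ctt cx cxt e et ett ex ext mm mt mtt mx mxt xin xout κ B L E)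
    (hS : Sol c e p xin xout s u w y h ht htt) (j : Fin n) :
    Continuous (fun q : ℝ × ℝ => ux1 c e u w j q.1 q.2) :=
  (continuous_finsetSum _ fun k _ => (hco.he j k).td.cont.mul (hS.tu k).cont).sub
    ((hco.hc j).td.cont.mul (hS.tw j).cont)

lemma wx1_cont
    (hco : Coef a b c ct ctt cx cxt e et ett ex ext mm mt mtt mx mxt xin xout κ B L E)
    (hS : Sol c e p xin xout s u w y h ht htt) (j : Fin n) :
    Continuous (fun q : ℝ × ℝ => wx1 c ct e et u w y j q.1 q.2) :=
  ((continuous_finsetSum _ fun k _ => ((hco.he j k).td.contt.mul (hS.tu k).cont).add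
    ((hco.he j k).td.cont.mul (hS.tw k).cont)).sub
    ((hco.hc j).td.contt.mul (hS.tw j).cont)).sub ((hco.hc j).td.cont.mul (hS.tw j).contt)

lemma ux2_cont
    (hco : Coef a b c ct ctt cx cxt e et ett ex ext mm mt mtt mx mxt xin xout κ B L E)
    (hS : Sol c e p xin xout s u w y h ht htt) (j : Fin n) :
    Continuous (fun q : ℝ × ℝ => ux2 c ct cx e et ex u w y j q.1 q.2) :=
  (continuous_finsetSum _ fun k _ => ((hco.he j k).tdx.cont.mul (hS.tu k).cont).add
    ((hco.he j k).td.cont.mul (ux1_cont hco hS k))).sub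
    (((hco.hc j).tdx.cont.mul (hS.tw j).cont).add
      ((hco.hc j).td.cont.mul (wx1_cont hco hS j)))

lemma Sol.dx (hco : Coef a b c ct ctt cx cxt e et ett ex ext mm mt mtt mx mxt xin xout κ B L E)
    (hS : Sol c e p xin xout s u w y h ht htt) (j : Fin n) {t : ℝ} (hst : s ≤ t) {ξ : ℝ}
    (hξ : ξ ∈ Ioo (0:ℝ) 1) : HasDerivAt (fun x => u j x t) (ux1 c e u w j ξ t) ξ := by
  refine ((hS.along j).deriv_x (hco.sys.spd j) (hS.tu j) t hξ).congr_deriv ?_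
  simp [ux1, hS.z0 j ξ t hst]

lemma Sol.dxw (hco : Coef a b c ct ctt cx cxt e et ett ex ext mm mt mtt mx mxt xin xout κ B L E)
    (hS : Sol c e p xin xout s u w y h ht htt) (j : Fin n) {t : ℝ} (hst : s ≤ t) {ξ : ℝ}
    (hξ : ξ ∈ Ioo (0:ℝ) 1) : HasDerivAt (fun x => w j x t) (wx1 c ct e et u w y j ξ t) ξ := by
  have h1 := (hS.along j).dt (hco.sys.spd j) (hS.tu j)
    ((TD.sum fun k _ => (hco.he j k).td.mul (hS.tu k)).add (hS.th j))
  refine (h1.deriv_x (hco.sys.spd j) (hS.tw j) t hξ).congr_deriv ?_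
  simp [wx1, hS.z1 j ξ t hst]

lemma C2.dx {g gt gtt gx gxt : ℝ → ℝ → ℝ} (hg : C2 g gt gtt gx gxt) (t : ℝ) {ξ : ℝ}
    (hξ : ξ ∈ Ioo (0:ℝ) 1) : HasDerivAt (fun x => g x t) (gx ξ t) ξ := by
  have := hg.chain (fun _ => t) 0 ξ hξ (hasDerivAt_const ξ t)
  exact this.congr_deriv (by simp)

lemma Sol.dxx (hco : Coef a b c ct ctt cx cxt e et ett ex ext mm mt mtt mx mxt xin xout κ B L E)
    (hS : Sol c e p xin xout s u w y h ht htt) (j : Fin n) {t : ℝ} (hst : s ≤ t) {ξ : ℝ}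
    (hξ : ξ ∈ Ioo (0:ℝ) 1) :
    HasDerivAt (fun x => ux1 c e u w j x t) (ux2 c ct cx e et ex u w y j ξ t) ξ := by
  have h1 : HasDerivAt (fun x => ∑ k, e j k x t * u k x t)
      (∑ k, (ex j k ξ t * u k ξ t + e j k ξ t * ux1 c e u w k ξ t)) ξ :=
    HasDerivAt.fun_sum fun k _ => ((hco.he j k).dx t hξ).mul (hS.dx hco k hst hξ)
  exact h1.sub (((hco.hc j).dx t hξ).mul (hS.dxw hco j hst hξ))

/-- Bound on derivatives at a fixed time. -/
lemma dx_bound (hn : 1 ≤ n)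
    (hco : Coef a b c ct ctt cx cxt e et ett ex ext mm mt mtt mx mxt xin xout κ B L E) (t : ℝ) :
    ∃ C, 1 ≤ C ∧ ∀ (u w y : Fin n → ℝ → ℝ → ℝ) (x M : ℝ), x ∈ Icc (0:ℝ) 1 →
      (∀ k, |u k x t| ≤ M) → (∀ k, |w k x t| ≤ M) → (∀ k, |y k x t| ≤ M) →
      ∀ j, |ux1 c e u w j x t| ≤ C * M ∧ |ux2 c ct cx e et ex u w y j x t| ≤ C * M := by
  have b1 := fun j => cpt_bd (hco.hc j).td.cont t t
  have b2 := fun j => cpt_bd (hco.hc j).td.contt t t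
  have b3 := fun j => cpt_bd (hco.hc j).tdx.cont t t
  have b4 := fun j k => cpt_bd (hco.he j k).td.cont t t
  have b5 := fun j k => cpt_bd (hco.he j k).td.contt t t
  have b6 := fun j k => cpt_bd (hco.he j k).tdx.cont t t
  choose G1 p1 q1 using b1
  choose G2 p2 q2 using b2
  choose G3 p3 q3 using b3
  choose G4 p4 q4 using b4
  choose G5 p5 q5 using b5
  choose G6 p6 q6 using b6
  set G := 1 + ∑ j, (G1 j + G2 j + G3 j + ∑ k, (G4 j k + G5 j k + G6 j k)) with hG
  have i1 : ∀ j k, G4 j k + G5 j k + G6 j k ≤ ∑ k, (G4 j k + G5 j k + G6 j k) := fun j k =>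
    Finset.single_le_sum (f := fun k => G4 j k + G5 j k + G6 j k) (fun k _ => by
      have := p4 j k; have := p5 j k; have := p6 j k; positivity) (Finset.mem_univ k)
  have i0 : ∀ j, 0 ≤ ∑ k, (G4 j k + G5 j k + G6 j k) := fun j => Finset.sum_nonneg fun k _ => by
      have := p4 j k; have := p5 j k; have := p6 j k; positivity
  have i2 : ∀ j, 1 + (G1 j + G2 j + G3 j + ∑ k, (G4 j k + G5 j k + G6 j k)) ≤ G := fun j =>
    add_le_add_right (Finset.single_le_sum
      (f := fun j => G1 j + G2 j + G3 j + ∑ k, (G4 j k + G5 j k + G6 j k)) (fun j _ => by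
      have := p1 j; have := p2 j; have := p3 j; have := i0 j; positivity) (Finset.mem_univ j)) _
  have hn1 : (1:ℝ) ≤ n := by exact_mod_cast hn
  have G1' : 1 ≤ G := by
    have j : Fin n := ⟨0, hn⟩
    have := i2 j; have := p1 j; have := p2 j; have := p3 j; have := i0 j; linarith
  have tt : t ∈ Icc t t := by simp
  have c1 : ∀ j, ∀ x ∈ Icc (0:ℝ) 1, |c j x t| ≤ G := fun j x hx => (q1 j x hx t tt).trans (by
    have := i2 j; have := p1 j; have := p2 j; have := p3 j; have := i0 j; linarith)
  have c2 : ∀ j, ∀ x ∈ Icc (0:ℝ) 1, |ct j x t| ≤ G := fun j x hx => (q2 j x hx t tt).trans (by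
    have := i2 j; have := p1 j; have := p2 j; have := p3 j; have := i0 j; linarith)
  have c3 : ∀ j, ∀ x ∈ Icc (0:ℝ) 1, |cx j x t| ≤ G := fun j x hx => (q3 j x hx t tt).trans (by
    have := i2 j; have := p1 j; have := p2 j; have := p3 j; have := i0 j; linarith)
  have ii : ∀ j k, G4 j k + G5 j k + G6 j k ≤ G := fun j k => by
    have := i2 j; have := p1 j; have := p2 j; have := p3 j; have := i1 j k; linarith
  have c4 : ∀ j k, ∀ x ∈ Icc (0:ℝ) 1, |e j k x t| ≤ G := fun j k x hx =>
    (q4 j k x hx t tt).trans (by have := ii j k; have := p4 j k; have := p5 j k; have := p6 j k; linarith)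
  have c5 : ∀ j k, ∀ x ∈ Icc (0:ℝ) 1, |et j k x t| ≤ G := fun j k x hx =>
    (q5 j k x hx t tt).trans (by have := ii j k; have := p4 j k; have := p5 j k; have := p6 j k; linarith)
  have c6 : ∀ j k, ∀ x ∈ Icc (0:ℝ) 1, |ex j k x t| ≤ G := fun j k x hx =>
    (q6 j k x hx t tt).trans (by have := ii j k; have := p4 j k; have := p5 j k; have := p6 j k; linarith)
  have G0 : 0 ≤ G := by linarith
  have pm : ∀ {α β A X : ℝ}, |α| ≤ A → |β| ≤ X → |α * β| ≤ A * X := by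
    intro α β A X h1 h2
    rw [abs_mul]
    exact mul_le_mul h1 h2 (abs_nonneg _) ((abs_nonneg _).trans h1)
  refine ⟨(n * G + G) + (n * G + n * G * (n * G + G) + (G + G * (n * G + n * G + G + G))),
    by nlinarith [mul_nonneg G0 G0, mul_nonneg (mul_nonneg G0 G0) (by positivity : (0:ℝ) ≤ n)], ?_⟩
  intro u w y x M hx hu hw hy j
  have M0 : 0 ≤ M := (abs_nonneg _).trans (hu j)
  have a1 : ∀ j, |ux1 c e u w j x t| ≤ (n * G + G) * M := by
    intro j
    have h1 : |∑ k, e j k x t * u k x t| ≤ n * G * M := sum_bound (fun k => c4 j k x hx) hu G0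
    have h2 := pm (c1 j x hx) (hw j)
    refine (abs_sub _ _).trans ?_
    linarith
  have a2 : |wx1 c ct e et u w y j x t| ≤ (n * G + n * G + G + G) * M := by
    have h1 : |∑ k, e j k x t * w k x t| ≤ n * G * M := sum_bound (fun k => c4 j k x hx) hw G0
    have h1' : |∑ k, et j k x t * u k x t| ≤ n * G * M := sum_bound (fun k => c5 j k x hx) hu G0
    have h2 := pm (c2 j x hx) (hw j)
    have h3 := pm (c1 j x hx) (hy j)
    rw [wx1, Finset.sum_add_distrib]
    refine (abs_sub _ _).trans ?_
    have h4 := abs_sub (∑ k, et j k x t * u k x t + ∑ k, e j k x t * w k x t) (ct j x t * w j x t)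
    have h5 := abs_add_le (∑ k, et j k x t * u k x t) (∑ k, e j k x t * w k x t)
    linarith
  have a3 : |ux2 c ct cx e et ex u w y j x t| ≤
      (n * G + n * G * (n * G + G) + (G + G * (n * G + n * G + G + G))) * M := by
    have h1 : |∑ k, ex j k x t * u k x t| ≤ n * G * M := sum_bound (fun k => c6 j k x hx) hu G0
    have h1' : |∑ k, e j k x t * ux1 c e u w k x t| ≤ n * G * ((n * G + G) * M) :=
      sum_bound (fun k => c4 j k x hx) a1 G0
    have h2 := pm (c3 j x hx) (hw j)
    have h3 := pm (c1 j x hx) a2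
    rw [ux2, Finset.sum_add_distrib]
    refine (abs_sub _ _).trans ?_
    have h4 := abs_add_le (cx j x t * w j x t) (c j x t * wx1 c ct e et u w y j x t)
    have h5 := abs_add_le (∑ k, ex j k x t * u k x t) (∑ k, e j k x t * ux1 c e u w k x t)
    linarith
  constructor
  · refine (a1 j).trans (mul_le_mul_of_nonneg_right ?_ M0)
    have : 0 ≤ (n * G + n * G * (n * G + G) + (G + G * (n * G + n * G + G + G))) := by positivity
    linarith
  · refine a3.trans (mul_le_mul_of_nonneg_right ?_ M0)
    have : 0 ≤ n * G + G := by positivity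
    linarith

end
end HS

namespace HS

lemma cut_contDiff {f g : ℝ → ℝ} (hf : Continuous f) (hg : Continuous g)
    (h : ∀ ξ ∈ Ioo (0:ℝ) 1, HasDerivAt f (g ξ) ξ) {δ : ℝ} (hδ : 0 < δ)
    (hz : ∀ x ∈ Icc (0:ℝ) 1, 1 / 2 - δ ≤ |x - 1 / 2| → f x = 0) :
    ContDiff ℝ 1 ((Icc (0:ℝ) 1).indicator f) := by
  rw [contDiff_iff_contDiffAt]
  intro x
  by_cases hx : |x - 1 / 2| < 1 / 2
  · have hG : ContDiff ℝ 1 (fun x => f 0 + ∫ ξ in (0:ℝ)..x, g ξ) := by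
      have hd : ∀ x, HasDerivAt (fun x => f 0 + ∫ ξ in (0:ℝ)..x, g ξ) (g x) x := fun x =>
        (hasDerivAt_prim hg 0 x).const_add _
      rw [contDiff_one_iff_deriv]
      refine ⟨fun x => (hd x).differentiableAt, ?_⟩
      rw [show deriv (fun x => f 0 + ∫ ξ in (0:ℝ)..x, g ξ) = g from funext fun x => (hd x).deriv]
      exact hg
    refine hG.contDiffAt.congr_of_eventuallyEq ?_
    rw [abs_lt] at hx
    filter_upwards [Ioo_mem_nhds (a := (0:ℝ)) (b := 1) (by linarith [hx.1]) (by linarith [hx.2])]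
      with y hy
    rw [indicator_of_mem (Ioo_subset_Icc_self hy)]
    exact eq_prim hf hg h y (Ioo_subset_Icc_self hy)
  · have : (Icc (0:ℝ) 1).indicator f =ᶠ[nhds x] fun _ => 0 := by
      have ho : IsOpen {y : ℝ | 1 / 2 - δ < |y - 1 / 2|} :=
        isOpen_lt continuous_const (by fun_prop)
      filter_upwards [ho.mem_nhds (show 1 / 2 - δ < |x - 1 / 2| by linarith)] with y hy
      by_cases hy' : y ∈ Icc (0:ℝ) 1
      · rw [indicator_of_mem hy']; exact hz y hy' (le_of_lt hy)
      · rw [indicator_of_notMem hy']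
    exact contDiffAt_const.congr_of_eventuallyEq this

section
variable {n m : ℕ} {a : ℝ → ℝ → Fin n → ℝ} {b : ℝ → ℝ → Fin n → Fin n → ℝ}
    {c ct ctt cx cxt : Fin n → ℝ → ℝ → ℝ} {e et ett ex ext : Fin n → Fin n → ℝ → ℝ → ℝ}
    {mm mt mtt mx mxt : Fin n → Fin n → ℝ → ℝ → ℝ} {κ B L E : ℝ}
    {p : Fin n → Fin n → ℝ} {s : ℝ} {u w y h ht htt : Fin n → ℝ → ℝ → ℝ}

/-- inflow ends -/
def Xin (n m : ℕ) : Fin n → ℝ := fun j => if (j:ℕ) < m then 0 else 1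
/-- outflow ends -/
def Xout (n m : ℕ) : Fin n → ℝ := fun j => if (j:ℕ) < m then 1 else 0

lemma link (hco : Coef a b c ct ctt cx cxt e et ett ex ext mm mt mtt mx mxt (Xin n m) (Xout n m)
      κ B L E) (hS : Sol c e p (Xin n m) (Xout n m) s u w y h ht htt) {δ : ℝ} (hδ : 0 < δ)
    (hz : ∀ j, ∀ x ∈ Icc (0:ℝ) 1, 1 / 2 - δ ≤ |x - 1 / 2| → u j x s = 0)
    {U : ℝ → ℝ → L2 n →L[ℝ] L2 n} (hU : GeneratedBy n m p a b U) {φh : L2 n}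
    (hφ : ∀ᵐ x ∂μ01, φh x = vec (fun j x => u j x s) x) {t : ℝ} (hst : s ≤ t) :
    ∀ᵐ x ∂μ01, (U t s φh) x = vec (fun j x => u j x t) x := by
  have hcon : ∀ {v : Fin n → ℝ → ℝ → ℝ}, (∀ j, Continuous (fun q : ℝ × ℝ => v j q.1 q.2)) →
      Continuous (fun q : ℝ × ℝ => vec (fun j x => v j x q.2) q.1) := fun hv =>
    (PiLp.continuous_toLp 2 _).comp (continuous_pi hv)
  refine hU.2.2.2 s (vec fun j => (Icc (0:ℝ) 1).indicator fun x => u j x s) ?_ ?_ φh ?_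
    (fun x t => vec (fun j x => u j x t) x) (fun x t => vec (fun j x => ux1 c e u w j x t) x)
    (fun x t => vec (fun j x => w j x t) x) ?_ t hst
  · rw [contDiff_euclidean]
    intro j
    exact cut_contDiff (slice_x (hS.tu j).cont s) (slice_x (ux1_cont hco hS j) s)
      (fun ξ hξ => hS.dx hco j le_rfl hξ) hδ (hz j)
  · have hcl : IsClosed {x : ℝ | |x - 1 / 2| ≤ 1 / 2 - δ} := isClosed_le (by fun_prop) continuous_const
    refine (closure_minimal ?_ hcl).trans ?_
    · intro x hx
      by_contra hne
      have hne' : 1 / 2 - δ < |x - 1 / 2| := not_le.1 hne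
      apply hx
      ext j
      rw [vec_apply]
      by_cases hy' : x ∈ Icc (0:ℝ) 1
      · rw [indicator_of_mem hy']; exact hz j x hy' (le_of_lt hne')
      · rw [indicator_of_notMem hy']; rfl
    · intro x hx
      have hx' : |x - 1 / 2| ≤ 1 / 2 - δ := hx
      rw [abs_le] at hx'
      constructor <;> linarith [hx'.1, hx'.2]
  · filter_upwards [hφ, ae_restrict_mem measurableSet_Ioo] with x hx hx'
    rw [hx]
    ext j
    rw [vec_apply, vec_apply, indicator_of_mem (Ioo_subset_Icc_self hx')]
  · refine ⟨(hcon fun j => (hS.tu j).cont).continuousOn, (hcon (ux1_cont hco hS)).continuousOn,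
      (hcon fun j => (hS.tu j).contt).continuousOn, ?_, ?_, ?_, ?_⟩
    · intro x hx t ht' j
      exact ⟨deriv_ext (slice_x (hS.tu j).cont t) (slice_x (ux1_cont hco hS j) t)
        (fun ξ hξ => hS.dx hco j ht' hξ) hx, ((hS.tu j).der x t).hasDerivWithinAt⟩
    · intro x hx t ht' j
      show w j x t + a x t j * (∑ k, e j k x t * u k x t - c j x t * w j x t) +
        ∑ k, b x t j k * u k x t = 0
      have h1 : a x t j * ∑ k, e j k x t * u k x t = - ∑ k, b x t j k * u k x t := by
        rw [Finset.mul_sum, ← Finset.sum_neg_distrib]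
        refine Finset.sum_congr rfl fun k _ => ?_
        rw [← mul_assoc, hco.ae j k x hx t]; ring
      have h2 := hco.ac j x hx t
      linear_combination h1 - w j x t * h2
    · intro t ht' j
      have h1 := hS.bc j t
      have h2 : (∑ k : Fin n, if m ≤ (k : ℕ) then p j k * u k 0 t else p j k * u k 1 t) =
          ∑ k, p j k * u k (Xout n m k) t := by
        refine Finset.sum_congr rfl fun k _ => ?_
        by_cases hk : m ≤ (k:ℕ)
        · simp [Xout, hk, not_lt.2 hk]
        · simp [Xout, hk, not_le.1 hk]
      constructor
      · intro hj
        refine Eq.trans ?_ h2.symm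
        rw [← h1]; simp [Xin, hj, vec_apply]
      · intro hj
        refine Eq.trans ?_ h2.symm
        rw [← h1]; simp [Xin, not_lt.2 hj, vec_apply]
    · intro x hx
      ext j
      rw [vec_apply, vec_apply, indicator_of_mem hx]

/-- The energy bound. -/
lemma J_bound (hco : Coef a b c ct ctt cx cxt e et ett ex ext mm mt mtt mx mxt (Xin n m) (Xout n m)
      κ B L E)
    {U : ℝ → ℝ → L2 n →L[ℝ] L2 n} (hU : GeneratedBy n m p a b U) (s : ℝ) {β : ℝ} (hβ : s ≤ β) :
    ∃ C, 0 ≤ C ∧ ∀ {u w y h ht htt : Fin n → ℝ → ℝ → ℝ} {δ : ℝ} {φh : L2 n},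
      Sol c e p (Xin n m) (Xout n m) s u w y h ht htt → 0 < δ →
      (∀ j, ∀ x ∈ Icc (0:ℝ) 1, 1 / 2 - δ ≤ |x - 1 / 2| → u j x s = 0) →
      (∀ᵐ x ∂μ01, φh x = vec (fun j x => u j x s) x) →
      ∀ j, ∫ x in (0:ℝ)..1, ∫ t in s..β, u j x t ^ 2 ≤ C * ‖φh‖ ^ 2 := by
  obtain ⟨K, hK, ν, hν⟩ := hU.2.2.1
  refine ⟨(β - s) * (K * Real.exp (|ν| * (β - s))) ^ 2,
    mul_nonneg (by linarith) (by positivity), ?_⟩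
  intro u w y h ht htt δ φh hS hδ hz hφ j
  have hcu := (hS.tu j).cont
  have hcu2 : Continuous (fun q : ℝ × ℝ => u j q.1 q.2 ^ 2) := hcu.pow 2
  have key : ∀ τ ∈ Icc s β, ∫ x in (0:ℝ)..1, u j x τ ^ 2 ≤
      (K * Real.exp (|ν| * (β - s))) ^ 2 * ‖φh‖ ^ 2 := by
    intro τ hτ
    have h1 : ‖U τ s φh‖ ≤ K * Real.exp (|ν| * (β - s)) * ‖φh‖ := by
      refine ((U τ s).le_opNorm φh).trans (mul_le_mul_of_nonneg_right ?_ (norm_nonneg _))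
      refine (hν s τ hτ.1).trans (mul_le_mul_of_nonneg_left ?_ (by linarith))
      rw [Real.exp_le_exp]
      have := le_abs_self ν
      have := abs_nonneg ν
      have := hτ.1
      have := hτ.2
      nlinarith
    have h2 : ∫ x in (0:ℝ)..1, u j x τ ^ 2 ≤ ‖U τ s φh‖ ^ 2 := by
      rw [norm_sq_L2, intervalIntegral.integral_of_le zero_le_one, integral_Ioc_eq_integral_Ioo]
      refine integral_mono_ae ?_ (integrable_sq_L2 _) ?_
      · exact (((slice_x hcu τ).pow 2).continuousOn.integrableOn_Icc).mono_set Ioo_subset_Icc_self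
      · filter_upwards [link hco hS hδ hz hU hφ hτ.1] with x hx
        rw [hx]
        have := PiLp.norm_apply_le (vec (fun j x => u j x τ) x) j
        rw [vec_apply, Real.norm_eq_abs] at this
        show u j x τ ^ 2 ≤ _
        rw [← sq_abs]
        exact pow_le_pow_left₀ (abs_nonneg _) this 2
    refine h2.trans ?_
    rw [← mul_pow]
    exact pow_le_pow_left₀ (norm_nonneg _) h1 2
  have hsw : ∫ x in (0:ℝ)..1, ∫ t in s..β, u j x t ^ 2 = ∫ t in s..β, ∫ x in (0:ℝ)..1, u j x t ^ 2 := by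
    refine MeasureTheory.intervalIntegral_intervalIntegral_swap ?_
    refine IntegrableOn.mono_set (t := Icc 0 1 ×ˢ Icc s β) ?_ ?_
    · exact hcu2.continuousOn.integrableOn_compact (isCompact_Icc.prod isCompact_Icc)
    · rw [uIoc_of_le zero_le_one, uIoc_of_le hβ]
      exact prod_mono Ioc_subset_Icc_self Ioc_subset_Icc_self
  rw [hsw]
  have : ∫ t in s..β, ∫ x in (0:ℝ)..1, u j x t ^ 2 ≤
      ∫ _t in s..β, (K * Real.exp (|ν| * (β - s))) ^ 2 * ‖φh‖ ^ 2 := by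
    refine intervalIntegral.integral_mono_on (μ := volume) hβ ?_ intervalIntegrable_const key
    refine Continuous.intervalIntegrable ?_ _ _
    exact intervalIntegral.continuous_parametric_intervalIntegral_of_continuous'
      (f := fun t x => u j x t ^ 2) (hcu2.comp continuous_swap) 0 1
  refine this.trans_eq ?_
  rw [intervalIntegral.integral_const, smul_eq_mul]; ring

/-- The dense class of smooth solutions. -/
def Cls (c : Fin n → ℝ → ℝ → ℝ) (e : Fin n → Fin n → ℝ → ℝ → ℝ) (p : Fin n → Fin n → ℝ) (m : ℕ)
    (s : ℝ) (u w y h ht htt : Fin n → ℝ → ℝ → ℝ) (φh : L2 n) : Prop :=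
  Sol c e p (Xin n m) (Xout n m) s u w y h ht htt ∧
  (∃ δ > 0, ∀ j, ∀ x ∈ Icc (0:ℝ) 1, 1 / 2 - δ ≤ |x - 1 / 2| → u j x s = 0) ∧
  ∀ᵐ x ∂μ01, φh x = vec (fun j x => u j x s) x

lemma dense_Cls (hco : Coef a b c ct ctt cx cxt e et ett ex ext mm mt mtt mx mxt (Xin n m) (Xout n m)
      κ B L E) (p : Fin n → Fin n → ℝ) (s : ℝ) (f : L2 n) {ε : ℝ} (hε : 0 < ε) :
    ∃ u w y h ht htt ψ, Cls c e p m s u w y h ht htt ψ ∧ ‖f - ψ‖ < ε := by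
  obtain ⟨φ, ⟨h1, δ, hδ, hsup⟩, ψ0, e0, hn0⟩ := dense_Cc f (half_pos hε)
  have hd : ∀ j x, HasDerivAt (φ j) (deriv (φ j) x) x := fun j x =>
    ((h1 j).differentiable one_ne_zero x).hasDerivAt
  have hη : 0 < ε / (2 * (n + 1)) := by positivity
  obtain ⟨u, w, y, h, ht, htt, hS, hz, hc⟩ := dense_step hco p s hd
    (fun j => (h1 j).continuous_deriv le_rfl) hδ hsup hη
  obtain ⟨ψ, hψ⟩ := mk_L2 (vec_cont fun j => slice_x (hS.tu j).cont s)
  refine ⟨u, w, y, h, ht, htt, ψ, ⟨hS, ⟨δ / 2, half_pos hδ, hz⟩, hψ⟩, ?_⟩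
  have h2 : ‖ψ0 - ψ‖ ≤ n * (ε / (2 * (n + 1))) := by
    refine norm_L2_le (by positivity) ?_
    filter_upwards [Lp.coeFn_sub ψ0 ψ, hψ, e0, ae_restrict_mem measurableSet_Ioo] with x hx hx1 hx2 hx3
    rw [hx, Pi.sub_apply, hx1, hx2]
    have : vec φ x - vec (fun j x => u j x s) x = vec (fun j x => φ j x - u j x s) x := by
      ext j; rfl
    rw [this]
    refine vec_bound hη.le fun j => ?_
    rw [abs_sub_comm]
    exact hc j x (Ioo_subset_Icc_self hx3)
  have h3 : n * (ε / (2 * (n + 1))) ≤ ε / 2 := by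
    rw [← mul_div_assoc, div_le_div_iff₀ (by positivity) (by positivity)]
    nlinarith
  calc ‖f - ψ‖ = ‖(f - ψ0) + (ψ0 - ψ)‖ := by congr 1; abel
    _ ≤ ‖f - ψ0‖ + ‖ψ0 - ψ‖ := norm_add_le _ _
    _ < ε := by linarith

end
end HS

namespace HS

/-- `ψ` has a `C²` representative `g` on `[0,1]` bounded by `M`. -/
def Good {n : ℕ} (ψ : L2 n) (g g1 g2 : Fin n → ℝ → ℝ) (M : ℝ) : Prop :=
  (∀ j, Continuous (g j) ∧ Continuous (g1 j) ∧ Continuous (g2 j)) ∧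
  (∀ j, ∀ ξ ∈ Ioo (0:ℝ) 1, HasDerivAt (g j) (g1 j ξ) ξ ∧ HasDerivAt (g1 j) (g2 j ξ) ξ) ∧
  (∀ j x, |g j x| ≤ M ∧ |g1 j x| ≤ M ∧ |g2 j x| ≤ M) ∧
  ∀ᵐ x ∂μ01, ψ x = vec g x

lemma pj_deriv {f : ℝ → ℝ} {f' ξ : ℝ} (hξ : ξ ∈ Ioo (0:ℝ) 1) (h : HasDerivAt f f' ξ) :
    HasDerivAt (fun x => f (pj x)) f' ξ := by
  refine h.congr_of_eventuallyEq ?_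
  filter_upwards [Ioo_mem_nhds hξ.1 hξ.2] with x hx
  rw [pj_eq (Ioo_subset_Icc_self hx)]

section
variable {n m : ℕ} {a : ℝ → ℝ → Fin n → ℝ} {b : ℝ → ℝ → Fin n → Fin n → ℝ}
    {c ct ctt cx cxt : Fin n → ℝ → ℝ → ℝ} {e et ett ex ext : Fin n → Fin n → ℝ → ℝ → ℝ}
    {mm mt mtt mx mxt : Fin n → Fin n → ℝ → ℝ → ℝ} {κ B L E : ℝ}
    {p : Fin n → Fin n → ℝ}

lemma SB_const {ι : Type*} {J : ι → ℝ} {f : Fin n → ι → ℝ → ℝ → ℝ} {α β t : ℝ}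
    (hJ : ∀ σ, 0 ≤ J σ) (ht : t ∈ Icc α β) (h : ∀ j, SB supBd J (f j) α β) :
    ∃ C, 0 ≤ C ∧ ∀ j σ, ∀ x ∈ Icc (0:ℝ) 1, f j σ x t ^ 2 ≤ C * J σ := by
  choose C hC hb using h
  refine ⟨∑ j, C j, Finset.sum_nonneg fun j _ => hC j, fun j σ x hx => ?_⟩
  refine ((hb j σ x hx).2 t ht).trans (mul_le_mul_of_nonneg_right ?_ (hJ σ))
  exact Finset.single_le_sum (f := C) (fun j _ => hC j) (Finset.mem_univ j)

lemma cls_good (hn : 1 ≤ n)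
    (hco : Coef a b c ct ctt cx cxt e et ett ex ext mm mt mtt mx mxt (Xin n m) (Xout n m)
      κ B L E) (h3 : H3cond n p) (hB : 0 ≤ B)
    {U : ℝ → ℝ → L2 n →L[ℝ] L2 n} (hU : GeneratedBy n m p a b U) {s t : ℝ}
    (hst : s + (3 * n + 1) * B ≤ t) :
    ∃ C, 0 ≤ C ∧ ∀ u w y h ht htt φh, Cls c e p m s u w y h ht htt φh →
      ∃ g g1 g2, Good (U t s φh) g g1 g2 (C * ‖φh‖) := by
  have hN : 0 ≤ (3 * (n:ℝ) + 1) * B := by positivity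
  have hst' : s ≤ t := by linarith
  obtain ⟨C1, hC1, hJb⟩ := J_bound hco hU s (β := t + (3 * n + 1) * B + 1) (by linarith)
  let F := Fin n → ℝ → ℝ → ℝ
  let ι := {z : F × F × F × F × F × F × L2 n //
    Cls c e p m s z.1 z.2.1 z.2.2.1 z.2.2.2.1 z.2.2.2.2.1 z.2.2.2.2.2.1 z.2.2.2.2.2.2}
  have hJ : ∀ σ : ι, 0 ≤ C1 * ‖σ.1.2.2.2.2.2.2‖ ^ 2 := fun σ => by positivity
  have hA := apriori (ι := ι) hco h3 hB (J := fun σ => C1 * ‖σ.1.2.2.2.2.2.2‖ ^ 2)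
    (α := s) (β := t + (3 * n + 1) * B + 1) (by linarith) hJ
    (u := fun j σ => σ.1.1 j) (w := fun j σ => σ.1.2.1 j) (y := fun j σ => σ.1.2.2.1 j)
    (h := fun j σ => σ.1.2.2.2.1 j) (ht := fun j σ => σ.1.2.2.2.2.1 j)
    (htt := fun j σ => σ.1.2.2.2.2.2.1 j)
    (fun σ => σ.2.1) (fun j σ => by
      obtain ⟨δ, hδ, hz⟩ := σ.2.2.1
      exact hJb σ.2.1 hδ hz σ.2.2.2 j)
  have htm : t ∈ Icc (s + (3 * n + 1) * B) (t + (3 * n + 1) * B + 1 - (3 * n + 1) * B) :=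
    ⟨hst, by linarith⟩
  obtain ⟨D1, hD1, k1⟩ := SB_const hJ htm hA.1
  obtain ⟨D2, hD2, k2⟩ := SB_const hJ htm hA.2.1
  obtain ⟨D3, hD3, k3⟩ := SB_const hJ htm hA.2.2
  obtain ⟨G, hG, hGb⟩ := dx_bound hn hco t
  set S := Real.sqrt ((D1 + D2 + D3) * C1) with hSdef
  have hS0 : 0 ≤ S := Real.sqrt_nonneg _
  refine ⟨G * S, by positivity, ?_⟩
  intro u w y h ht htt φh hC
  have aux : ∀ {v D : ℝ}, D ≤ D1 + D2 + D3 → v ^ 2 ≤ D * (C1 * ‖φh‖ ^ 2) → |v| ≤ S * ‖φh‖ := by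
    intro v D h1 h2
    have h3 : v ^ 2 ≤ (D1 + D2 + D3) * C1 * ‖φh‖ ^ 2 := by
      refine h2.trans ?_
      rw [mul_assoc]
      exact mul_le_mul_of_nonneg_right h1 (by positivity)
    refine (Real.abs_le_sqrt h3).trans_eq ?_
    rw [Real.sqrt_mul (by positivity), Real.sqrt_sq (norm_nonneg _)]
  have q1 : ∀ x ∈ Icc (0:ℝ) 1, ∀ j, |u j x t| ≤ S * ‖φh‖ := fun x hx j =>
    aux (by linarith) (k1 j ⟨(u, w, y, h, ht, htt, φh), hC⟩ x hx)
  have q2 : ∀ x ∈ Icc (0:ℝ) 1, ∀ j, |w j x t| ≤ S * ‖φh‖ := fun x hx j =>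
    aux (by linarith) (k2 j ⟨(u, w, y, h, ht, htt, φh), hC⟩ x hx)
  have q3 : ∀ x ∈ Icc (0:ℝ) 1, ∀ j, |y j x t| ≤ S * ‖φh‖ := fun x hx j =>
    aux (by linarith) (k3 j ⟨(u, w, y, h, ht, htt, φh), hC⟩ x hx)
  obtain ⟨hS, ⟨δ, hδ, hz⟩, hφ⟩ := hC
  refine ⟨fun j x => u j (pj x) t, fun j x => ux1 c e u w j (pj x) t,
    fun j x => ux2 c ct cx e et ex u w y j (pj x) t, ?_, ?_, ?_, ?_⟩
  · intro j
    exact ⟨(slice_x (hS.tu j).cont t).comp pj_cont, (slice_x (ux1_cont hco hS j) t).comp pj_cont,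
      (slice_x (ux2_cont hco hS j) t).comp pj_cont⟩
  · intro j ξ hξ
    have e1 : pj ξ = ξ := pj_eq (Ioo_subset_Icc_self hξ)
    simp only [e1]
    exact ⟨pj_deriv (f := fun x => u j x t) hξ (hS.dx hco j hst' hξ),
      pj_deriv (f := fun x => ux1 c e u w j x t) hξ (hS.dxx hco j hst' hξ)⟩
  · intro j x
    have hx := pj_mem x
    have h1 := hGb u w y (pj x) (S * ‖φh‖) hx (q1 _ hx) (q2 _ hx) (q3 _ hx) j
    rw [← mul_assoc] at h1
    refine ⟨(q1 _ hx j).trans ?_, h1.1, h1.2⟩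
    have : 0 ≤ S * ‖φh‖ := by positivity
    nlinarith
  · filter_upwards [link hco hS hδ hz hU hφ hst', ae_restrict_mem measurableSet_Ioo] with x hx hx'
    rw [hx]
    ext j
    rw [vec_apply, vec_apply, pj_eq (Ioo_subset_Icc_self hx')]

end

/-- Extension from a dense class by summing a series. -/
lemma good_ext {n : ℕ} (T : L2 n →L[ℝ] L2 n) (D : Set (L2 n))
    (hD : ∀ f : L2 n, ∀ ε : ℝ, 0 < ε → ∃ ψ ∈ D, ‖f - ψ‖ < ε) {C : ℝ} (hC : 0 ≤ C)
    (hg : ∀ ψ ∈ D, ∃ g g1 g2, Good (T ψ) g g1 g2 (C * ‖ψ‖)) (φ : L2 n) :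
    ∃ g g1 g2, Good (T φ) g g1 g2 (4 * C * ‖φ‖) := by
  by_cases h0 : φ = 0
  · subst h0
    refine ⟨fun _ _ => 0, fun _ _ => 0, fun _ _ => 0,
      fun _ => ⟨continuous_const, continuous_const, continuous_const⟩,
      fun _ ξ _ => ⟨hasDerivAt_const _ _, hasDerivAt_const _ _⟩, fun _ _ => by simp, ?_⟩
    rw [map_zero]
    filter_upwards [Lp.coeFn_zero (Vn n) 2 μ01] with x hx
    rw [hx]; ext j; rfl
  have hφ : 0 < ‖φ‖ := norm_pos_iff.2 h0
  choose! A hA1 hA2 using hD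
  let r : ℕ → L2 n := fun k => Nat.rec φ (fun k r => r - A r (‖φ‖ * (1 / 2) ^ (k + 1))) k
  have r0 : r 0 = φ := rfl
  let ψ : ℕ → L2 n := fun k => A (r k) (‖φ‖ * (1 / 2) ^ (k + 1))
  have rs : ∀ k, r (k + 1) = r k - ψ k := fun k => rfl
  have hpos : ∀ k : ℕ, 0 < ‖φ‖ * (1 / 2 : ℝ) ^ k := fun k => by positivity
  have rb : ∀ k, ‖r k‖ ≤ ‖φ‖ * (1 / 2) ^ k := by
    intro k
    cases k with
    | zero => simp [r0]
    | succ k => rw [rs]; exact (hA2 (r k) _ (hpos (k + 1))).le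
  have ψD : ∀ k, ψ k ∈ D := fun k => hA1 (r k) _ (hpos (k + 1))
  have ψb : ∀ k, ‖ψ k‖ ≤ 2 * ‖φ‖ * (1 / 2) ^ k := by
    intro k
    have e1 : ψ k = r k - r (k + 1) := by rw [rs]; abel
    rw [e1]
    have h1 := norm_sub_le (r k) (r (k + 1))
    have h2 := rb k
    have h3 := rb (k + 1)
    rw [pow_succ] at h3
    have h4 := hpos k
    linarith
  choose g g1 g2 hgood using fun k => hg (ψ k) (ψD k)
  set v : ℕ → ℝ := fun k => 2 * C * ‖φ‖ * (1 / 2) ^ k with hv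
  have hvs : HasSum v (4 * C * ‖φ‖) := by
    have := hasSum_geometric_two.mul_left (2 * C * ‖φ‖)
    rwa [show 2 * C * ‖φ‖ * 2 = 4 * C * ‖φ‖ by ring] at this
  have hle : ∀ k, C * ‖ψ k‖ ≤ v k := fun k => by
    have := mul_le_mul_of_nonneg_left (ψb k) hC
    simp only [hv]; linarith
  have c0 : ∀ k j x, ‖g k j x‖ ≤ v k := fun k j x => ((hgood k).2.2.1 j x).1.trans (hle k)
  have c1 : ∀ k j x, ‖g1 k j x‖ ≤ v k := fun k j x => ((hgood k).2.2.1 j x).2.1.trans (hle k)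
  have c2 : ∀ k j x, ‖g2 k j x‖ ≤ v k := fun k j x => ((hgood k).2.2.1 j x).2.2.trans (hle k)
  have hhalf : (1 / 2 : ℝ) ∈ Ioo (0:ℝ) 1 := by constructor <;> norm_num
  refine ⟨fun j x => ∑' k, g k j x, fun j x => ∑' k, g1 k j x, fun j x => ∑' k, g2 k j x,
    ?_, ?_, ?_, ?_⟩
  · intro j
    exact ⟨continuous_tsum (fun k => ((hgood k).1 j).1) hvs.summable fun k x => c0 k j x,
      continuous_tsum (fun k => ((hgood k).1 j).2.1) hvs.summable fun k x => c1 k j x,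
      continuous_tsum (fun k => ((hgood k).1 j).2.2) hvs.summable fun k x => c2 k j x⟩
  · intro j ξ hξ
    exact ⟨hasDerivAt_tsum_of_isPreconnected (g := fun k => g k j) (g' := fun k => g1 k j)
        hvs.summable isOpen_Ioo isPreconnected_Ioo (fun k y hy => ((hgood k).2.1 j y hy).1)
        (fun k y _ => c1 k j y) hhalf
        (Summable.of_norm_bounded hvs.summable fun k => c0 k j _) hξ,
      hasDerivAt_tsum_of_isPreconnected (g := fun k => g1 k j) (g' := fun k => g2 k j)
        hvs.summable isOpen_Ioo isPreconnected_Ioo (fun k y hy => ((hgood k).2.1 j y hy).2)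
        (fun k y _ => c2 k j y) hhalf
        (Summable.of_norm_bounded hvs.summable fun k => c1 k j _) hξ⟩
  · intro j x
    exact ⟨tsum_of_norm_bounded hvs fun k => c0 k j x, tsum_of_norm_bounded hvs fun k => c1 k j x,
      tsum_of_norm_bounded hvs fun k => c2 k j x⟩
  · have hr : Tendsto r atTop (nhds 0) := by
      refine squeeze_zero_norm rb ?_
      have := (tendsto_pow_atTop_nhds_zero_of_lt_one (r := (1 / 2 : ℝ)) (by norm_num)
        (by norm_num)).const_mul ‖φ‖
      simpa using this
    have hT : Tendsto (fun K => T (φ - r K)) atTop (nhds (T φ)) := by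
      have h1 : Tendsto (fun K => φ - r K) atTop (nhds φ) := by
        simpa using hr.const_sub φ
      exact (T.continuous.tendsto φ).comp h1
    obtain ⟨ns, hns, hae⟩ := (tendstoInMeasure_of_tendsto_Lp hT).exists_seq_tendsto_ae
    have hpar : ∀ K, ∀ᵐ x ∂μ01, ∀ j, (T (φ - r K)) x j = ∑ k ∈ Finset.range K, g k j x := by
      intro K
      induction K with
      | zero =>
        rw [r0, sub_self, map_zero]
        filter_upwards [Lp.coeFn_zero (Vn n) 2 μ01] with x hx j
        rw [hx]; simp
      | succ K ih =>
        have e1 : T (φ - r (K + 1)) = T (φ - r K) + T (ψ K) := by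
          rw [← map_add, rs]; congr 1; abel
        rw [e1]
        filter_upwards [ih, Lp.coeFn_add (T (φ - r K)) (T (ψ K)), (hgood K).2.2.2] with x h1 h2 h3 j
        rw [h2, Finset.sum_range_succ, ← h1 j, Pi.add_apply, h3]
        rfl
    filter_upwards [hae, ae_all_iff.2 hpar] with x h1 h2
    ext j
    rw [vec_apply]
    have h3 : Tendsto (fun i => (T (φ - r (ns i))) x j) atTop (nhds ((T φ) x j)) :=
      ((PiLp.continuous_apply 2 (fun _ : Fin n => ℝ) j).tendsto _).comp h1
    have h4 : Tendsto (fun i => (T (φ - r (ns i))) x j) atTop (nhds (∑' k, g k j x)) := by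
      simp only [h2]
      have := (Summable.of_norm_bounded hvs.summable fun k => c0 k j x).hasSum.tendsto_sum_nat
      exact this.comp hns.tendsto_atTop
    exact tendsto_nhds_unique h3 h4

lemma ae_unique {n : ℕ} {f g : ℝ → Vn n} (hf : Continuous f) (hg : Continuous g)
    (h : ∀ᵐ x ∂μ01, f x = g x) : EqOn f g (Icc 0 1) := by
  refine Measure.eqOn_Icc_of_ae_eq volume zero_ne_one ?_ hf.continuousOn hg.continuousOn
  rw [← restrict_Ioo_eq_restrict_Icc]
  exact h

/-- Packaging of the operator. -/
lemma pack {n : ℕ} (T : L2 n →L[ℝ] L2 n) {C : ℝ} (hC : 0 ≤ C)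
    (hg : ∀ φ, ∃ g g1 g2, Good (T φ) g g1 g2 (C * ‖φ‖)) :
    ∃ W : L2 n →ₗ[ℝ] (ℝ → Vn n), ∃ C : ℝ, 0 ≤ C ∧
        ∀ φ : L2 n, ∃ g' g'' : ℝ → Vn n,
          ContinuousOn (W φ) (Set.Icc 0 1) ∧
          ContinuousOn g' (Set.Icc 0 1) ∧
          ContinuousOn g'' (Set.Icc 0 1) ∧
          (∀ x ∈ Set.Icc (0:ℝ) 1, ∀ j : Fin n,
            HasDerivWithinAt (fun y => W φ y j) (g' x j) (Set.Icc 0 1) x ∧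
            HasDerivWithinAt (fun y => g' y j) (g'' x j) (Set.Icc 0 1) x) ∧
          (∀ x ∈ Set.Icc (0:ℝ) 1, ‖W φ x‖ + ‖g' x‖ + ‖g'' x‖ ≤ C * ‖φ‖) ∧
          (∀ᵐ x ∂μ01, (T φ) x = W φ x) := by
  choose g g1 g2 hgood using hg
  have hc : ∀ φ, Continuous (vec (g φ)) := fun φ => vec_cont fun j => ((hgood φ).1 j).1
  let W : L2 n →ₗ[ℝ] (ℝ → Vn n) :=
    { toFun := fun φ => (Icc (0:ℝ) 1).indicator (vec (g φ))
      map_add' := by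
        intro φ1 φ2
        have h1 : EqOn (vec (g (φ1 + φ2))) (fun x => vec (g φ1) x + vec (g φ2) x) (Icc 0 1) := by
          refine ae_unique (hc _) ((hc _).add (hc _)) ?_
          filter_upwards [(hgood φ1).2.2.2, (hgood φ2).2.2.2, (hgood (φ1 + φ2)).2.2.2,
            Lp.coeFn_add (T φ1) (T φ2)] with x a1 a2 a3 a4
          rw [← a1, ← a2, ← a3, map_add, a4]; rfl
        funext x
        by_cases hx : x ∈ Icc (0:ℝ) 1
        · simp only [Pi.add_apply, indicator_of_mem hx]; exact h1 hx
        · simp only [Pi.add_apply, indicator_of_notMem hx, add_zero]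
      map_smul' := by
        intro r φ
        have h1 : EqOn (vec (g (r • φ))) (fun x => r • vec (g φ) x) (Icc 0 1) := by
          refine ae_unique (hc _) ((hc _).const_smul r) ?_
          filter_upwards [(hgood φ).2.2.2, (hgood (r • φ)).2.2.2,
            Lp.coeFn_smul r (T φ)] with x a1 a3 a4
          rw [← a1, ← a3, map_smul, a4]; rfl
        funext x
        by_cases hx : x ∈ Icc (0:ℝ) 1
        · simp only [Pi.smul_apply, indicator_of_mem hx, RingHom.id_apply]; exact h1 hx
        · simp only [Pi.smul_apply, indicator_of_notMem hx, smul_zero] }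
  have hW : ∀ φ, ∀ x ∈ Icc (0:ℝ) 1, W φ x = vec (g φ) x := fun φ x hx => indicator_of_mem hx _
  refine ⟨W, 3 * n * C, by positivity, fun φ => ⟨vec (g1 φ), vec (g2 φ),
    (hc φ).continuousOn.congr (hW φ), (vec_cont fun j => ((hgood φ).1 j).2.1).continuousOn,
    (vec_cont fun j => ((hgood φ).1 j).2.2).continuousOn, ?_, ?_, ?_⟩⟩
  · intro x hx j
    obtain ⟨k0, k1, k2⟩ := (hgood φ).1 j
    constructor
    · refine (deriv_ext k0 k1 (fun ξ hξ => ((hgood φ).2.1 j ξ hξ).1) hx).congr ?_ ?_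
      · intro y hy
        rw [hW φ y hy]; rfl
      · rw [hW φ x hx]; rfl
    · exact deriv_ext k1 k2 (fun ξ hξ => ((hgood φ).2.1 j ξ hξ).2) hx
  · intro x hx
    rw [hW φ x hx]
    have hM : 0 ≤ C * ‖φ‖ := by positivity
    have b0 := vec_bound hM (f := g φ) (x := x) fun j => ((hgood φ).2.2.1 j x).1
    have b1 := vec_bound hM (f := g1 φ) (x := x) fun j => ((hgood φ).2.2.1 j x).2.1
    have b2 := vec_bound hM (f := g2 φ) (x := x) fun j => ((hgood φ).2.2.1 j x).2.2
    linarith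
  · filter_upwards [(hgood φ).2.2.2, ae_restrict_mem measurableSet_Ioo] with x h1 h2
    rw [h1, hW φ x (Ioo_subset_Icc_self h2)]

end HS

/- STATEMENT 8: smoothing property of the evolution family: for `t ≥ s + 3d`,
`U(t,s)` factors through `C²([0,1];ℝⁿ)` via a bounded linear operator. -/
theorem stmt_8 (n m : ℕ) (hn : 1 ≤ n) (hmn : m ≤ n)
    (p : Fin n → Fin n → ℝ) (hH3 : H3cond n p)
    (a : ℝ → ℝ → Fin n → ℝ) (b : ℝ → ℝ → Fin n → Fin n → ℝ)
    -- `a`, `b` have bounded continuous partial derivatives up to second order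
    (hab : ∃ C : ℝ, ∀ j : Fin n, BCle 2 (fun x t => a x t j) C ∧
      ∀ k : Fin n, BCle 2 (fun x t => b x t j k) C)
    (Λ₀ : ℝ) (hΛ₀ : 0 < Λ₀) (hLam : LamCond n m Λ₀ a)
    (U : ℝ → ℝ → L2 n →L[ℝ] L2 n) (hU : GeneratedBy n m p a b U) :
    ∃ d : ℝ, 0 < d ∧ ∀ s t : ℝ, s + 3 * d ≤ t →
      -- a linear operator `W` from `L²` into `C²([0,1];ℝⁿ)` ...
      ∃ W : L2 n →ₗ[ℝ] (ℝ → Vn n), ∃ C : ℝ, 0 ≤ C ∧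
        ∀ φ : L2 n, ∃ g' g'' : ℝ → Vn n,
          ContinuousOn (W φ) (Set.Icc 0 1) ∧
          ContinuousOn g' (Set.Icc 0 1) ∧
          ContinuousOn g'' (Set.Icc 0 1) ∧
          (∀ x ∈ Set.Icc (0:ℝ) 1, ∀ j : Fin n,
            HasDerivWithinAt (fun y => W φ y j) (g' x j) (Set.Icc 0 1) x ∧
            HasDerivWithinAt (fun y => g' y j) (g'' x j) (Set.Icc 0 1) x) ∧
          -- ... which is bounded ...
          (∀ x ∈ Set.Icc (0:ℝ) 1, ‖W φ x‖ + ‖g' x‖ + ‖g'' x‖ ≤ C * ‖φ‖) ∧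
          -- ... and whose composition with the inclusion `C² ↪ L²` is `U(t,s)`
          (∀ᵐ x ∂μ01, (U t s φ) x = W φ x) := by
  obtain ⟨c, ct, ctt, cx, cxt, e, et, ett, ex, ext, mm, mt, mtt, mx, mxt, κ, B, L, E, hco0⟩ :=
    HS.coef_exists hn hab Λ₀ hΛ₀ hLam
  have hco : HS.Coef a b c ct ctt cx cxt e et ett ex ext mm mt mtt mx mxt (HS.Xin n m)
    (HS.Xout n m) κ B L E := hco0
  have hB : 0 ≤ B := (abs_nonneg _).trans ((hco.sys.spd ⟨0, hn⟩).bd 0 0)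
  have hN : 0 ≤ (3 * (n:ℝ) + 1) * B := by positivity
  refine ⟨((3 * (n:ℝ) + 1) * B + 1) / 3, by positivity, fun s t hst => ?_⟩
  obtain ⟨C, hC, hgood⟩ := HS.cls_good hn hco hH3 hB hU (s := s) (t := t) (by linarith)
  refine HS.pack (U t s) (C := 4 * C) (by positivity) fun φ => ?_
  refine HS.good_ext (U t s)
    {ψ | ∃ u w y h ht htt, HS.Cls c e p m s u w y h ht htt ψ} ?_ hC ?_ φ
  · intro f ε hε
    obtain ⟨u, w, y, h, ht, htt, ψ, h1, h2⟩ := HS.dense_Cls hco p s f hε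
    exact ⟨ψ, ⟨u, w, y, h, ht, htt, h1⟩, h2⟩
  · rintro ψ ⟨u, w, y, h, ht, htt, h1⟩
    exact hgood u w y h ht htt ψ h1
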